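/- Let n > 1 be a fixed integer, let T ⊆ OnePoint ℂ be a finite set with |T| = n, and let x ∈ (OnePoint ℂ) \ T. For every real C > 0 there exists M such that for all m ≥ M: for any m pairwise non-homotopic x-loops γ₁, …, γ_m in the complement of T, the total number of crossings — half the cardinality (computed in ℕ∞) of the set {((i,s),(j,t)) : i,j ∈ Fin m, s,t ∈ (0,1), (i,s) ≠ (j,t), γ_i(s) = γ_j(t)} — is at least C·m². (That is, the minimal number of crossings among m pairwise non-homotopic x-loops is super-quadratic in m.) -/

import Mathlib

open unitInterval ENNReal

namespace LoopCrossing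

open Set Topology Filter

/-- A nonvanishing continuous function on a simply connected, locally path connected space has
a continuous logarithm. -/
theorem exists_log {X : Type*} [TopologicalSpace X] [SimplyConnectedSpace X]
    [LocallyPathConnectedSpace X] (f : X → ℂ) (hf : Continuous f) (h0 : ∀ x, f x ≠ 0) :
    ∃ g : X → ℂ, Continuous g ∧ ∀ x, Complex.exp (g x) = f x := by
  obtain ⟨x₀⟩ : Nonempty X := inferInstance
  obtain ⟨F, ⟨-, hF⟩, -⟩ := Complex.isCoveringMap_exp.existsUnique_continuousMap_lifts
    (⟨fun x => ⟨f x, h0 x⟩, by fun_prop⟩ : C(X, {z : ℂ // z ≠ 0})) x₀ (Complex.log (f x₀))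
    (Subtype.ext (Complex.exp_log (h0 x₀)))
  exact ⟨F, F.continuous, fun x => congrArg Subtype.val (congrFun hF x)⟩

theorem exists_log_I (f : I → ℂ) (hf : Continuous f) (h0 : ∀ x, f x ≠ 0) :
    ∃ g : I → ℂ, Continuous g ∧ ∀ x, Complex.exp (g x) = f x := by
  obtain ⟨g, hg, hg'⟩ := exists_log (fun t : ℝ => f (projIcc 0 1 zero_le_one t))
    (hf.comp continuous_projIcc) (fun _ => h0 _)
  exact ⟨fun t => g t, hg.comp continuous_subtype_val, fun t => by rw [hg', projIcc_val]⟩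

theorem exists_log_II (f : I × I → ℂ) (hf : Continuous f) (h0 : ∀ x, f x ≠ 0) :
    ∃ g : I × I → ℂ, Continuous g ∧ ∀ x, Complex.exp (g x) = f x := by
  obtain ⟨g, hg, hg'⟩ := exists_log
    (fun t : ℂ => f (projIcc 0 1 zero_le_one t.re, projIcc 0 1 zero_le_one t.im))
    (hf.comp ((continuous_projIcc.comp Complex.continuous_re).prodMk
      (continuous_projIcc.comp Complex.continuous_im))) (fun _ => h0 _)
  refine ⟨fun t => g ⟨t.1, t.2⟩, hg.comp ?_, fun t => by rw [hg', projIcc_val, projIcc_val]⟩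
  exact Complex.equivRealProdCLM.symm.continuous.comp
    ((continuous_subtype_val.comp continuous_fst).prodMk
      (continuous_subtype_val.comp continuous_snd))

theorem exists_log_C (f : ℂ → ℂ) (hf : Continuous f) (h0 : ∀ x, f x ≠ 0) :
    ∃ g : ℂ → ℂ, Continuous g ∧ ∀ x, Complex.exp (g x) = f x := by
  have : ContractibleSpace ℂ := inferInstance
  exact exists_log f hf h0

/-- Two continuous logarithms of the same function on a connected space differ by a constant. -/
theorem log_sub_const {X : Type*} [TopologicalSpace X] [PreconnectedSpace X] {g h : X → ℂ}
    (hg : Continuous g) (hh : Continuous h) (e : ∀ x, Complex.exp (g x) = Complex.exp (h x))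
    (x y : X) : g x - h x = g y - h y := by
  have key : ∀ x, ∃ n : ℤ, g x - h x = n * (2 * Real.pi * Complex.I) := fun x => by
    obtain ⟨n, hn⟩ := Complex.exp_eq_exp_iff_exists_int.1 (e x)
    exact ⟨n, by rw [hn]; ring⟩
  choose n hn using key
  have hc : Continuous fun x => ((n x : ℤ) : ℝ) := by
    have h1 : Continuous fun x => ((g x - h x) / (2 * Real.pi * Complex.I)).re := by fun_prop
    refine h1.congr fun x => ?_
    rw [hn, mul_div_assoc, div_self Complex.two_pi_I_ne_zero]
    simp
  have hc' : Continuous n := (Int.isClosedEmbedding_coe_real.isInducing.continuous_iff).2 hc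
  rw [hn, hn, PreconnectedSpace.constant inferInstance hc']

/-- The path `a` avoids the set `T`. -/
def Avoids (T : Set ℂ) {p q : ℂ} (a : Path p q) : Prop := ∀ t, a t ∉ T

/-- Homotopy of paths in the complement of `T`. -/
def HomT (T : Set ℂ) {p q : ℂ} (a b : Path p q) : Prop := ∃ F : a.Homotopy b, ∀ z, F z ∉ T

/-- The path `a` seen in the complement of `T`. -/
noncomputable def liftT {T : Set ℂ} {p q : ℂ} (a : Path p q) (h : Avoids T a) :
    Path (X := {z : ℂ // z ∉ T}) ⟨p, by simpa using h 0⟩ ⟨q, by simpa using h 1⟩ where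
  toFun t := ⟨a t, h t⟩
  continuous_toFun := by fun_prop
  source' := by simp
  target' := by simp

theorem homT_iff {T : Set ℂ} {p q : ℂ} (a b : Path p q) (ha : Avoids T a) (hb : Avoids T b) :
    HomT T a b ↔ (liftT a ha).Homotopic (liftT b hb) := by
  constructor
  · rintro ⟨F, hF⟩
    refine ⟨⟨⟨⟨fun z => ⟨F z, hF z⟩, by fun_prop⟩, fun t => ?_, fun t => ?_⟩, fun s t ht => ?_⟩⟩
    · exact Subtype.ext (F.apply_zero t)
    · exact Subtype.ext (F.apply_one t)
    · exact Subtype.ext (F.prop' s t ht)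
  · rintro ⟨F⟩
    refine ⟨⟨⟨⟨fun z => (F z).1, by fun_prop⟩, fun t => ?_, fun t => ?_⟩, fun s t ht => ?_⟩,
      fun z => (F z).2⟩
    · exact congrArg Subtype.val (F.apply_zero t)
    · exact congrArg Subtype.val (F.apply_one t)
    · exact congrArg Subtype.val (F.prop' s t ht)

theorem isPathConnected_compl {T : Set ℂ} (hT : T.Finite) : IsPathConnected Tᶜ :=
  hT.countable.isPathConnected_compl_of_one_lt_rank (by simp)

/-- Holonomy in the complement of `T`: a group valued invariant of paths, multiplicative under
concatenation, which detects homotopy of paths with common endpoints. -/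
structure Holonomy (T : Set ℂ) where
  /-- The group of values. -/
  G : Type
  /-- The group structure. -/
  group : Group G
  /-- The value on a path. -/
  cls : ∀ {p q : ℂ}, Path p q → G
  trans : ∀ {p q r : ℂ} (a : Path p q) (b : Path q r), Avoids T a → Avoids T b →
    cls (a.trans b) = cls a * cls b
  symm : ∀ {p q : ℂ} (a : Path p q), Avoids T a → cls a.symm = (cls a)⁻¹
  eq_iff : ∀ {p q : ℂ} (a b : Path p q), Avoids T a → Avoids T b → (cls a = cls b ↔ HomT T a b)
  subpath : ∀ {p q : ℂ} (a : Path p q) (s t u : I), Avoids T a →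
    cls (a.subpath s t) * cls (a.subpath t u) = cls (a.subpath s u)

attribute [instance] Holonomy.group

open CategoryTheory in
theorem exists_holonomy {T : Set ℂ} (hT : T.Finite) : Nonempty (Holonomy T) := by
  classical
  obtain ⟨x, hx⟩ := (isPathConnected_compl hT).nonempty
  let X := {z : ℂ // z ∉ T}
  let ob (p : ℂ) (hp : p ∉ T) : FundamentalGroupoid X := ⟨⟨p, hp⟩⟩
  have hc : ∀ (p : ℂ) (hp : p ∉ T), Nonempty (ob x hx ⟶ ob p hp) := by
    intro p hp
    have := (isPathConnected_iff_pathConnectedSpace.1 (isPathConnected_compl hT))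
    exact ⟨Path.Homotopic.Quotient.mk
      (this.somePath (X := (Tᶜ : Set ℂ)) ⟨x, hx⟩ ⟨p, hp⟩)⟩
  let c (p : ℂ) (hp : p ∉ T) := (hc p hp).some
  let hom {p q : ℂ} (a : Path p q) (h : Avoids T a) :
      ob p (by simpa using h 0) ⟶ ob q (by simpa using h 1) :=
    Path.Homotopic.Quotient.mk (liftT a h)
  have hom_trans : ∀ {p q r : ℂ} (a : Path p q) (b : Path q r) (ha : Avoids T a)
      (hb : Avoids T b) (hab : Avoids T (a.trans b)),
        hom (a.trans b) hab = hom a ha ≫ hom b hb := by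
    intro p q r a b ha hb hab
    change _ = Path.Homotopic.Quotient.trans (.mk (liftT a ha)) (.mk (liftT b hb))
    rw [← Path.Homotopic.Quotient.mk_trans]
    refine congrArg Path.Homotopic.Quotient.mk ?_
    ext t
    simp only [liftT, Path.trans_apply, Path.coe_mk', ContinuousMap.coe_mk]
    split_ifs <;> rfl
  have hom_symm : ∀ {p q : ℂ} (a : Path p q) (ha : Avoids T a) (ha' : Avoids T a.symm),
      hom a.symm ha' = inv (hom a ha) := by
    intro p q a ha ha'
    rw [← Groupoid.inv_eq_inv]
    rfl
  have av_trans : ∀ {p q r : ℂ} (a : Path p q) (b : Path q r) (ha : Avoids T a)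
      (hb : Avoids T b), Avoids T (a.trans b) := by
    intro p q r a b ha hb t
    rw [Path.trans_apply]
    split_ifs
    exacts [ha _, hb _]
  have hom_sub : ∀ {p q : ℂ} (a : Path p q) (s t u : I) (ha : Avoids T a),
      hom (a.subpath s t) (fun _ => ha _) ≫ hom (a.subpath t u) (fun _ => ha _) =
        hom (a.subpath s u) (fun _ => ha _) := by
    intro p q a s t u ha
    exact Path.Homotopic.Quotient.eq.2 ⟨Path.Homotopy.subpathTransSubpath (liftT a ha) s t u⟩
  refine ⟨⟨(End (ob x hx))ᵐᵒᵖ, inferInstance, fun {p q} a => if h : Avoids T a then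
    .op (c p (by simpa using h 0) ≫ hom a h ≫ inv (c q (by simpa using h 1))) else 1,
    ?_, ?_, ?_, ?_⟩⟩
  · intro p q r a b ha hb
    rw [dif_pos ha, dif_pos hb, dif_pos (av_trans a b ha hb), ← MulOpposite.op_mul, End.mul_def,
      hom_trans a b ha hb]
    simp
  · intro p q a ha
    have ha' : Avoids T a.symm := fun t => ha _
    rw [dif_pos ha, dif_pos ha', eq_comm, inv_eq_iff_mul_eq_one, ← MulOpposite.op_mul, End.mul_def,
      hom_symm a ha]
    simp only [Category.assoc, IsIso.inv_hom_id_assoc, IsIso.hom_inv_id_assoc, IsIso.hom_inv_id]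
    rfl
  · intro p q a b ha hb
    rw [dif_pos ha, dif_pos hb, homT_iff a b ha hb, MulOpposite.op_inj, cancel_epi, cancel_mono]
    exact Path.Homotopic.Quotient.eq
  · intro p q a s t u ha
    have h (s t : I) : Avoids T (a.subpath s t) := fun _ => ha _
    rw [dif_pos (h _ _), dif_pos (h _ _), dif_pos (h _ _), ← MulOpposite.op_mul, End.mul_def,
      ← hom_sub a s t u ha]
    simp

/-- `L` is a continuous logarithm of `φ` along the path `a`. -/
def LogAlong (φ : ℂ → ℂ) {p q : ℂ} (a : Path p q) (L : I → ℂ) : Prop :=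
  Continuous L ∧ ∀ t, Complex.exp (L t) = φ (a t)

theorem exists_logAlong {p q : ℂ} (a : Path p q) (τ : ℂ) (h : ∀ t, a t ≠ τ) :
    ∃ L, LogAlong (fun z => z - τ) a L := by
  obtain ⟨g, hg, hg'⟩ := exists_log_I (fun t => a t - τ) (by fun_prop)
    (fun t => sub_ne_zero.2 (h t))
  exact ⟨g, hg, hg'⟩

theorem LogAlong.sub_eq {φ : ℂ → ℂ} {p q : ℂ} {a : Path p q} {L L' : I → ℂ}
    (h : LogAlong φ a L) (h' : LogAlong φ a L') (s t : I) : L t - L s = L' t - L' s := by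
  have := log_sub_const h.1 h'.1 (fun x => by rw [h.2, h'.2]) s t
  linear_combination -this

theorem LogAlong.subpath {φ : ℂ → ℂ} {p q : ℂ} {a : Path p q} {L : I → ℂ}
    (h : LogAlong φ a L) (s t : I) :
    LogAlong φ (a.subpath s t) (L ∘ Set.Icc.convexComb s t) :=
  ⟨h.1.comp (by fun_prop), fun u => h.2 _⟩

theorem LogAlong.symm {φ : ℂ → ℂ} {p q : ℂ} {a : Path p q} {L : I → ℂ}
    (h : LogAlong φ a L) : LogAlong φ a.symm (L ∘ unitInterval.symm) :=
  ⟨h.1.comp (by fun_prop), fun u => h.2 _⟩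

theorem LogAlong.add_const {φ : ℂ → ℂ} {p q : ℂ} {a : Path p q} {L : I → ℂ}
    (h : LogAlong φ a L) {c : ℂ} (hc : Complex.exp c = 1) : LogAlong φ a (fun t => L t + c) :=
  ⟨h.1.add continuous_const, fun u => by rw [Complex.exp_add, hc, mul_one, h.2]⟩

theorem LogAlong.div {φ ψ : ℂ → ℂ} {p q : ℂ} {a : Path p q} {L M : I → ℂ}
    (h : LogAlong φ a L) (h' : LogAlong ψ a M) :
    LogAlong (fun z => φ z / ψ z) a (fun t => L t - M t) :=
  ⟨h.1.sub h'.1, fun u => by rw [Complex.exp_sub, h.2, h'.2]⟩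

/-- Concatenation of functions on the unit interval. -/
noncomputable def join (L M : I → ℂ) (t : I) : ℂ :=
  if h : (t : ℝ) ≤ 1 / 2 then L ⟨2 * t, (unitInterval.mul_pos_mem_iff zero_lt_two).2 ⟨t.2.1, h⟩⟩
  else M ⟨2 * t - 1, unitInterval.two_mul_sub_one_mem_iff.2 ⟨(not_le.1 h).le, t.2.2⟩⟩

theorem join_continuous {L M : I → ℂ} (hL : Continuous L) (hM : Continuous M) (h : L 1 = M 0) :
    Continuous (join L M) := by
  let P : Path (L 0) (L 1) := ⟨⟨L, hL⟩, rfl, rfl⟩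
  let Q : Path (L 1) (M 1) := ⟨⟨M, hM⟩, h.symm, rfl⟩
  refine (P.trans Q).continuous.congr fun t => ?_
  rw [Path.trans_apply]
  rfl

theorem join_zero (L M : I → ℂ) : join L M 0 = L 0 := by
  simp [join]

theorem join_one (L M : I → ℂ) : join L M 1 = M 1 := by
  have : ¬ ((1 : ℝ) ≤ 1 / 2) := by norm_num
  simp only [join, Set.Icc.coe_one, this, dif_neg, not_false_eq_true]
  congr 1
  ext
  norm_num

theorem join_mem (L M : I → ℂ) (t : I) : (∃ u, join L M t = L u) ∨ ∃ u, join L M t = M u := by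
  unfold join
  split_ifs
  exacts [Or.inl ⟨_, rfl⟩, Or.inr ⟨_, rfl⟩]

theorem LogAlong.trans {φ : ℂ → ℂ} {p q r : ℂ} {a : Path p q} {b : Path q r} {L M : I → ℂ}
    (h : LogAlong φ a L) (h' : LogAlong φ b M) (e : L 1 = M 0) :
    LogAlong φ (a.trans b) (join L M) := by
  refine ⟨join_continuous h.1 h'.1 e, fun t => ?_⟩
  rw [Path.trans_apply]
  unfold join
  split_ifs
  exacts [h.2 _, h'.2 _]

/-- The variation of the logarithm of `z - τ` along the path `a`. -/
noncomputable def wnd (τ : ℂ) {p q : ℂ} (a : Path p q) : ℂ :=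
  open Classical in
  if h : ∃ L, LogAlong (fun z => z - τ) a L then h.choose 1 - h.choose 0 else 0

theorem wnd_eq {τ : ℂ} {p q : ℂ} {a : Path p q} {L : I → ℂ}
    (h : LogAlong (fun z => z - τ) a L) : wnd τ a = L 1 - L 0 := by
  have h' : ∃ L, LogAlong (fun z => z - τ) a L := ⟨L, h⟩
  rw [wnd, dif_pos h']
  exact h'.choose_spec.sub_eq h 0 1

theorem wnd_trans {τ p q r : ℂ} (a : Path p q) (b : Path q r) (ha : ∀ t, a t ≠ τ)
    (hb : ∀ t, b t ≠ τ) : wnd τ (a.trans b) = wnd τ a + wnd τ b := by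
  obtain ⟨L, hL⟩ := exists_logAlong a τ ha
  obtain ⟨M, hM⟩ := exists_logAlong b τ hb
  have hM' := hM.add_const (c := L 1 - M 0) (by
    rw [Complex.exp_sub, hL.2, hM.2, a.target, b.source, div_self]
    simpa [sub_eq_zero] using hb 0)
  rw [wnd_eq (hL.trans hM' (by ring)), wnd_eq hL, wnd_eq hM, join_zero, join_one]
  ring

theorem wnd_symm {τ p q : ℂ} (a : Path p q) (ha : ∀ t, a t ≠ τ) : wnd τ a.symm = - wnd τ a := by
  obtain ⟨L, hL⟩ := exists_logAlong a τ ha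
  rw [wnd_eq hL.symm, wnd_eq hL]
  simp

theorem wnd_subpath {τ p q : ℂ} {a : Path p q} {L : I → ℂ}
    (h : LogAlong (fun z => z - τ) a L) (s t : I) : wnd τ (a.subpath s t) = L t - L s := by
  rw [wnd_eq (h.subpath s t)]
  simp

theorem exp_wnd {τ p q : ℂ} (a : Path p q) (ha : ∀ t, a t ≠ τ) :
    Complex.exp (wnd τ a) = (q - τ) / (p - τ) := by
  obtain ⟨L, hL⟩ := exists_logAlong a τ ha
  rw [wnd_eq hL, Complex.exp_sub, hL.2, hL.2, a.source, a.target]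

/-- `f` has a continuous logarithm on `X`. -/
def HasLog (X : Set ℂ) (f : ℂ → ℂ) : Prop :=
  ∃ g : ℂ → ℂ, ContinuousOn g X ∧ ∀ z ∈ X, Complex.exp (g z) = f z

theorem HasLog.congr {X : Set ℂ} {f f' : ℂ → ℂ} (h : HasLog X f) (e : ∀ z ∈ X, f' z = f z) :
    HasLog X f' := by
  obtain ⟨g, hg, hg'⟩ := h
  exact ⟨g, hg, fun z hz => by rw [hg' z hz, e z hz]⟩

theorem HasLog.mul {X : Set ℂ} {f f' : ℂ → ℂ} (h : HasLog X f) (h' : HasLog X f') :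
    HasLog X fun z => f z * f' z := by
  obtain ⟨g, hg, hg'⟩ := h
  obtain ⟨k, hk, hk'⟩ := h'
  exact ⟨fun z => g z + k z, hg.add hk, fun z hz => by rw [Complex.exp_add, hg' z hz, hk' z hz]⟩

theorem HasLog.inv {X : Set ℂ} {f : ℂ → ℂ} (h : HasLog X f) : HasLog X fun z => (f z)⁻¹ := by
  obtain ⟨g, hg, hg'⟩ := h
  exact ⟨fun z => - g z, hg.neg, fun z hz => by rw [Complex.exp_neg, hg' z hz]⟩

theorem hasLog_of_slitPlane {X : Set ℂ} {f : ℂ → ℂ} (hf : ContinuousOn f X)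
    (h : ∀ z ∈ X, f z ∈ Complex.slitPlane) : HasLog X f :=
  ⟨fun z => Complex.log (f z), hf.clog h, fun z hz =>
    Complex.exp_log (Complex.slitPlane_ne_zero (h z hz))⟩

theorem one_sub_mem_slitPlane {w : ℂ} (h : ‖w‖ < 1) : 1 - w ∈ Complex.slitPlane :=
  Or.inl (by
    have := (Complex.abs_re_le_norm w).trans_lt h
    simp only [Complex.sub_re, Complex.one_re]
    linarith [le_abs_self w.re])

/-- Points of a connected set disjoint from `X` are not distinguished by logarithms on `X`. -/
theorem hasLog_ratio {S X : Set ℂ} (hX : IsCompact X) (hS : IsPreconnected S)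
    (hd : ∀ z ∈ S, z ∉ X) {u v : ℂ} (hu : u ∈ S) (hv : v ∈ S) :
    HasLog X fun z => (z - u) / (z - v) := by
  refine hS.induction₂' (fun u v => HasLog X fun z => (z - u) / (z - v)) ?_ ?_ hu hv
  · intro w hw
    have hsymm : ∀ u v : ℂ, (HasLog X fun z => (z - u) / (z - v)) →
        HasLog X fun z => (z - v) / (z - u) := fun u v h =>
      h.inv.congr fun z _ => by rw [inv_div]
    obtain ⟨r, hr, hr'⟩ := Metric.isOpen_iff.1 hX.isClosed.isOpen_compl w (hd w hw)
    refine mem_nhdsWithin_of_mem_nhds ?_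
    filter_upwards [Metric.ball_mem_nhds w hr] with v hv
    suffices HasLog X fun z => (z - v) / (z - w) from ⟨hsymm _ _ this, this⟩
    have hne : ∀ z ∈ X, z - w ≠ 0 := fun z hz e => hd w hw (by rwa [← sub_eq_zero.1 e])
    refine hasLog_of_slitPlane ?_ fun z hz => ?_
    · exact ContinuousOn.div (by fun_prop) (by fun_prop) hne
    · have e : (z - v) / (z - w) = 1 - (v - w) / (z - w) := by
        field_simp [hne z hz]
        ring
      rw [e]
      refine one_sub_mem_slitPlane ?_
      rw [norm_div, div_lt_one (norm_pos_iff.2 (hne z hz))]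
      have h1 : ¬ dist z w < r := fun h => hr' h hz
      rw [Metric.mem_ball, dist_eq_norm] at hv
      rw [dist_eq_norm] at h1
      exact hv.trans_le (not_lt.1 h1)
  · intro a b c ha hb hc h1 h2
    refine (h1.mul h2).congr fun z hz => ?_
    have hne : z - b ≠ 0 := fun e => hd b hb (by rwa [← sub_eq_zero.1 e])
    field_simp

/-- Far away points do not see `X`. -/
theorem hasLog_far {X : Set ℂ} {R : ℝ} (hX : ∀ z ∈ X, ‖z‖ ≤ R) {u : ℂ} (hu : R < ‖u‖) :
    HasLog X fun z => z - u := by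
  rcases X.eq_empty_or_nonempty with rfl | ⟨z₀, hz₀⟩
  · exact ⟨0, by simp, by simp⟩
  have hu0 : 0 < ‖u‖ := ((norm_nonneg _).trans (hX z₀ hz₀)).trans_lt hu
  have hu' : u ≠ 0 := norm_pos_iff.1 hu0
  have h1 : HasLog X fun z => 1 - z / u :=
    hasLog_of_slitPlane (by fun_prop) fun z hz => one_sub_mem_slitPlane (by
      rw [norm_div, div_lt_one hu0]; exact (hX z hz).trans_lt hu)
  have h2 : HasLog X fun _ => -u :=
    ⟨fun _ => Complex.log (-u), continuousOn_const, fun _ _ => Complex.exp_log (neg_ne_zero.2 hu')⟩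
  exact (h2.mul h1).congr fun z _ => by field_simp; ring

theorem wnd_eq_of_hasLog {X : Set ℂ} {p : ℂ} (a : Path p p) (ha : ∀ t, a t ∈ X) {u v : ℂ}
    (hu : ∀ t, a t ≠ u) (hv : ∀ t, a t ≠ v) (h : HasLog X fun z => (z - u) / (z - v)) :
    wnd u a = wnd v a := by
  obtain ⟨L, hL⟩ := exists_logAlong a u hu
  obtain ⟨M, hM⟩ := exists_logAlong a v hv
  obtain ⟨g, hg, hg'⟩ := h
  have h1 : LogAlong (fun z => (z - u) / (z - v)) a (fun t => g (a t)) :=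
    ⟨hg.comp_continuous a.continuous ha, fun t => hg' _ (ha t)⟩
  have := (hL.div hM).sub_eq h1 0 1
  rw [a.source, a.target] at this
  rw [wnd_eq hL, wnd_eq hM]
  linear_combination this

theorem wnd_eq_zero_of_hasLog {X : Set ℂ} {p : ℂ} (a : Path p p) (ha : ∀ t, a t ∈ X) {u : ℂ}
    (h : HasLog X fun z => z - u) : wnd u a = 0 := by
  obtain ⟨g, hg, hg'⟩ := h
  have h1 : LogAlong (fun z => z - u) a (fun t => g (a t)) :=
    ⟨hg.comp_continuous a.continuous ha, fun t => hg' _ (ha t)⟩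
  rw [wnd_eq h1, a.source, a.target, sub_self]

/-- Winding numbers agree at points of a connected set missed by the loop. -/
theorem wnd_eq_of_preconnected {S : Set ℂ} (hS : IsPreconnected S) {p : ℂ} (a : Path p p)
    (hd : ∀ t, a t ∉ S) {u v : ℂ} (hu : u ∈ S) (hv : v ∈ S) : wnd u a = wnd v a := by
  refine wnd_eq_of_hasLog a (X := range a) (fun t => ⟨t, rfl⟩) (fun t e => hd t (e ▸ hu))
    (fun t e => hd t (e ▸ hv)) (hasLog_ratio (isCompact_range a.continuous) hS ?_ hu hv)
  rintro z hz ⟨t, rfl⟩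
  exact hd t hz

theorem wnd_eq_zero_of_unbounded {S : Set ℂ} (hS : IsPreconnected S) (hb : ¬ Bornology.IsBounded S)
    {p : ℂ} (a : Path p p) (hd : ∀ t, a t ∉ S) {u : ℂ} (hu : u ∈ S) : wnd u a = 0 := by
  obtain ⟨R, hR⟩ := (isCompact_range a.continuous).isBounded.exists_norm_le
  obtain ⟨v, hv, hv'⟩ : ∃ v ∈ S, R < ‖v‖ := by
    by_contra! h
    exact hb (isBounded_iff_forall_norm_le.2 ⟨R, h⟩)
  rw [wnd_eq_of_preconnected hS a hd hu hv]
  exact wnd_eq_zero_of_hasLog a (X := range a) (fun t => ⟨t, rfl⟩) (hasLog_far hR hv')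

/-- The circle of radius `R` about the origin as a loop. -/
noncomputable def circleLoop (R : ℝ) : Path (R : ℂ) (R : ℂ) where
  toFun s := R * Complex.exp (2 * Real.pi * Complex.I * (s : ℝ))
  continuous_toFun := by fun_prop
  source' := by simp
  target' := by simp [Complex.exp_two_pi_mul_I]

theorem norm_circleLoop {R : ℝ} (hR : 0 < R) (t : I) : ‖circleLoop R t‖ = R := by
  change ‖(R : ℂ) * Complex.exp (2 * Real.pi * Complex.I * (t : ℝ))‖ = R
  rw [norm_mul, Complex.norm_real, Real.norm_of_nonneg hR.le, Complex.norm_exp]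
  simp

theorem wnd_circleLoop {R : ℝ} (hR : 0 < R) {t : ℂ} (ht : ‖t‖ < R) :
    wnd t (circleLoop R) = 2 * Real.pi * Complex.I := by
  have h1 : wnd t (circleLoop R) = wnd 0 (circleLoop R) := by
    refine wnd_eq_of_preconnected (S := Metric.ball 0 R) (convex_ball _ _).isPreconnected _ ?_
      (by simpa using ht) (by simpa using hR)
    intro s hs
    rw [mem_ball_zero_iff, norm_circleLoop hR] at hs
    exact lt_irrefl _ hs
  have h2 : LogAlong (fun z => z - 0) (circleLoop R)
      (fun s => (Real.log R : ℂ) + 2 * Real.pi * Complex.I * (s : ℝ)) := by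
    refine ⟨by fun_prop, fun s => ?_⟩
    rw [Complex.exp_add, ← Complex.ofReal_exp, Real.exp_log hR]
    exact (sub_zero _).symm
  rw [h1, wnd_eq h2]
  simp

/-- The obstruction to logarithms: on the frontier of a bounded open set containing `t`, the
function `z - t` is not the product of an exponential and a nonvanishing function on the closure. -/
theorem no_log_core {U X : Set ℂ} (hX : IsClosed X) (hUb : Bornology.IsBounded U)
    (hfr : frontier U ⊆ X) {t : ℂ} (ht : t ∈ U) {g q : ℂ → ℂ} (hg : ContinuousOn g X)
    (hq : ContinuousOn q (closure U)) (hq0 : ∀ z ∈ closure U, q z ≠ 0)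
    (e : ∀ z ∈ X, z - t = Complex.exp (g z) * q z) : False := by
  classical
  obtain ⟨k, hk⟩ := ContinuousMap.exists_restrict_eq hX ⟨X.domRestrict g, hg.domRestrict⟩
  have hk' : ∀ z ∈ X, k z = g z := fun z hz => congrArg (fun f : C(X, ℂ) => f ⟨z, hz⟩) hk
  let F : ℂ → ℂ := (closure U).piecewise (fun z => Complex.exp (k z) * q z) (fun z => z - t)
  have hF : Continuous F := by
    refine continuous_piecewise (fun z hz => ?_) ?_ (by fun_prop)
    · have hz' : z ∈ X := hfr (frontier_closure_subset hz)
      simp only [hk' z hz', e z hz']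
    · rw [closure_closure]
      exact (k.continuous.cexp.continuousOn).mul hq
  have hF0 : ∀ z, F z ≠ 0 := fun z => by
    by_cases hz : z ∈ closure U
    · simpa [F, hz] using hq0 z hz
    · simp only [F, hz, piecewise_eq_of_notMem, not_false_eq_true]
      exact fun h => hz (subset_closure (by rwa [sub_eq_zero.1 h]))
  obtain ⟨G, hG, hG'⟩ := exists_log_C F hF hF0
  obtain ⟨R, hR⟩ := hUb.closure.exists_norm_le
  have hR0 : 0 < R + 1 := by
    linarith [norm_nonneg t, hR t (subset_closure ht)]
  have h0 : wnd t (circleLoop (R + 1)) = 0 := by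
    refine wnd_eq_zero_of_hasLog (X := Metric.sphere 0 (R + 1)) _ (fun s => ?_)
      ⟨G, hG.continuousOn, fun z hz => ?_⟩
    · simpa using norm_circleLoop hR0 s
    · rw [hG']
      refine piecewise_eq_of_notMem _ _ _ fun hz' => ?_
      have := hR z hz'
      rw [mem_sphere_zero_iff_norm] at hz
      linarith
  rw [wnd_circleLoop hR0 (by linarith [hR t (subset_closure ht)])] at h0
  exact Complex.two_pi_I_ne_zero h0

/-- The component of `t` in the complement of `X`. -/
abbrev comp (X : Set ℂ) (t : ℂ) : Set ℂ := connectedComponentIn Xᶜ t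

theorem isOpen_comp {X : Set ℂ} (hX : IsClosed X) (t : ℂ) : IsOpen (comp X t) :=
  hX.isOpen_compl.connectedComponentIn

theorem frontier_comp {X : Set ℂ} (hX : IsClosed X) (t : ℂ) : frontier (comp X t) ⊆ X := by
  intro z hz
  by_contra hzX
  have h1 : IsOpen (comp X z) := isOpen_comp hX z
  have hz1 : z ∈ comp X z := mem_connectedComponentIn hzX
  obtain ⟨w, hw, hw'⟩ := mem_closure_iff.1 (frontier_subset_closure hz) _ h1 hz1
  have e : comp X z = comp X t :=
    (connectedComponentIn_eq hw).trans (connectedComponentIn_eq hw').symm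
  rw [(isOpen_comp hX t).frontier_eq] at hz
  exact hz.2 (e ▸ hz1)

theorem unbounded_of_hasLog {X : Set ℂ} (hX : IsClosed X) {t : ℂ} (ht : t ∉ X)
    (h : HasLog X fun z => z - t) : ¬ Bornology.IsBounded (comp X t) := by
  intro hb
  obtain ⟨g, hg, hg'⟩ := h
  exact no_log_core hX hb (frontier_comp hX t) (mem_connectedComponentIn ht) hg
    (q := fun _ => 1) continuousOn_const (by simp) (fun z hz => by rw [hg' z hz, mul_one])

theorem mem_comp_of_hasLog {X : Set ℂ} (hX : IsClosed X) {t u : ℂ} (ht : t ∉ X) (hu : u ∉ X)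
    (h : HasLog X fun z => (z - t) / (z - u)) (hb : Bornology.IsBounded (comp X t)) :
    u ∈ comp X t := by
  by_contra hn
  obtain ⟨g, hg, hg'⟩ := h
  refine no_log_core hX hb (frontier_comp hX t) (mem_connectedComponentIn ht) hg
    (q := fun z => z - u) (by fun_prop) (fun z hz e => ?_) (fun z hz => ?_)
  · rw [sub_eq_zero.1 e] at hz
    by_cases hu' : u ∈ frontier (comp X t)
    · exact hu (frontier_comp hX t hu')
    · rw [(isOpen_comp hX t).frontier_eq] at hu'
      exact hu' ⟨hz, hn⟩
  · have : z - u ≠ 0 := fun e => hu (by rwa [← sub_eq_zero.1 e])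
    rw [hg' z hz]
    field_simp

/-- Radial projection away from the open ball of radius `r` about `c`. -/
noncomputable def push (c : ℂ) (r : ℝ) (z : ℂ) : ℂ := c + (max 1 (r / ‖z - c‖) : ℝ) * (z - c)

theorem push_continuousOn (c : ℂ) (r : ℝ) : ContinuousOn (push c r) {c}ᶜ := by
  unfold push
  have : ∀ z ∈ ({c} : Set ℂ)ᶜ, ‖z - c‖ ≠ 0 := fun z hz => norm_ne_zero_iff.2 (sub_ne_zero.2 hz)
  refine continuousOn_const.add (ContinuousOn.mul ?_ (by fun_prop))
  refine Complex.continuous_ofReal.comp_continuousOn (continuousOn_const.sup ?_)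
  exact continuousOn_const.div (by fun_prop) this

theorem push_of_le {c : ℂ} {r : ℝ} {z : ℂ} (hr : 0 < r) (h : r ≤ ‖z - c‖) : push c r z = z := by
  have : r / ‖z - c‖ ≤ 1 := (div_le_one (hr.trans_le h)).2 h
  rw [push, max_eq_left this]
  simp

theorem norm_push {c : ℂ} {r : ℝ} {z : ℂ} (hz : z ≠ c) :
    ‖push c r z - c‖ = max ‖z - c‖ r := by
  have h0 : 0 < ‖z - c‖ := norm_pos_iff.2 (sub_ne_zero.2 hz)
  rw [push, add_sub_cancel_left, norm_mul, Complex.norm_real, Real.norm_of_nonneg (by positivity),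
    max_mul_of_nonneg _ _ h0.le, one_mul, div_mul_cancel₀ _ h0.ne']

/-- The statement that `t` can be added to the omitted set `T` without moving points of `X`. -/
def Push (X T : Set ℂ) (t : ℂ) : Prop :=
  ∃ ρ : ℂ → ℂ, ContinuousOn ρ Tᶜ ∧ (∀ z ∈ X, ρ z = z) ∧ ∀ z ∉ T, ρ z ∉ insert t T

theorem Push.near {X T : Set ℂ} {s t : ℂ} {r : ℝ} (h : Push X T s)
    (hr : ∀ z ∈ Metric.closedBall s r, z ∉ X ∧ z ∉ T) (ht : dist t s < r) : Push X T t := by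
  obtain ⟨ρ, hρ, hX, hT⟩ := h
  have hr0 : 0 < r := dist_nonneg.trans_lt ht
  have hs : ∀ z ∉ T, ρ z ≠ s := fun z hz e => hT z hz (e ▸ mem_insert _ _)
  refine ⟨fun z => push s r (ρ z), (push_continuousOn s r).comp hρ hs, fun z hz => ?_,
    fun z hz h => ?_⟩
  · show push s r (ρ z) = z
    rw [hX z hz]
    refine push_of_le hr0 (not_lt.1 fun h => ?_)
    exact (hr z (by rw [Metric.mem_closedBall, dist_eq_norm]; exact h.le)).1 hz
  · have h1 := norm_push (r := r) (hs z hz)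
    rcases h with h | h
    · rw [dist_eq_norm] at ht
      simp only at h
      rw [h] at h1
      exact (ht.trans_le (h1 ▸ le_max_right _ _)).false
    · rcases le_or_gt r ‖ρ z - s‖ with h2 | h2
      · simp only [push_of_le hr0 h2] at h
        exact hT z hz (mem_insert_of_mem _ h)
      · rw [max_eq_right h2.le] at h1
        exact (hr _ (by rw [Metric.mem_closedBall, dist_eq_norm, h1])).2 h

theorem Push.of_preconnected {X T V : Set ℂ} {s t : ℂ} (h : Push X T s) (hVo : IsOpen V)
    (hV : IsPreconnected V) (hd : ∀ z ∈ V, z ∉ X ∧ z ∉ T) (hs : s ∈ V) (ht : t ∈ V) :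
    Push X T t := by
  refine hV.induction₂' (fun u v => Push X T u → Push X T v) (fun w hw => ?_)
    (fun a b c _ _ _ h1 h2 h3 => h2 (h1 h3)) hs ht h
  obtain ⟨r, hr, hr'⟩ := Metric.isOpen_iff.1 hVo w hw
  refine mem_nhdsWithin_of_mem_nhds ?_
  filter_upwards [Metric.ball_mem_nhds w (show 0 < r / 3 by positivity)] with v hv
  rw [Metric.mem_ball] at hv
  refine ⟨fun h => h.near (r := r / 3) (fun z hz => hd z (hr' ?_)) hv,
    fun h => h.near (r := r / 3) (fun z hz => hd z (hr' ?_)) (by rwa [dist_comm])⟩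
  · rw [Metric.mem_closedBall] at hz
    rw [Metric.mem_ball]
    linarith
  · rw [Metric.mem_closedBall] at hz
    rw [Metric.mem_ball]
    linarith [dist_triangle z v w]

theorem isPreconnected_ball_diff (c : ℂ) (r : ℝ) : IsPreconnected (Metric.ball c r \ {c}) := by
  have h : IsPreconnected ((Ioo 0 r) ×ˢ (univ : Set ℝ)) :=
    isPreconnected_Ioo.prod isPreconnected_univ
  convert h.image (fun x : ℝ × ℝ => c + x.1 * Complex.exp (x.2 * Complex.I)) (by fun_prop) using 1
  ext z
  constructor
  · rintro ⟨hz, hc⟩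
    refine ⟨(‖z - c‖, (z - c).arg), ⟨⟨norm_pos_iff.2 (sub_ne_zero.2 hc), by
      rwa [Metric.mem_ball, dist_eq_norm] at hz⟩, mem_univ _⟩, ?_⟩
    simp
  · rintro ⟨⟨ρ, θ⟩, ⟨⟨h1, h2⟩, -⟩, rfl⟩
    refine ⟨?_, ?_⟩
    · rw [Metric.mem_ball, dist_eq_norm, add_sub_cancel_left, norm_mul, Complex.norm_real,
        Complex.norm_exp_ofReal_mul_I, Real.norm_of_nonneg (le_of_lt h1), mul_one]
      exact h2
    · simp [(show (0 : ℝ) < ρ from h1).ne']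

theorem IsPreconnected.diff_singleton {U : Set ℂ} (hU : IsOpen U) (h : IsPreconnected U) (c : ℂ) :
    IsPreconnected (U \ {c}) := by
  by_cases hc : c ∈ U
  swap
  · rwa [sdiff_singleton_eq_self hc]
  obtain ⟨r, hr, hr'⟩ := Metric.isOpen_iff.1 hU c hc
  have key : ∀ u v : Set ℂ, IsOpen u → IsOpen v → U \ {c} ⊆ u ∪ v → ((U \ {c}) ∩ v).Nonempty →
      Metric.ball c r \ {c} ⊆ u → ((U \ {c}) ∩ (u ∩ v)).Nonempty := by
    rintro u v hu hv huv ⟨w, hw, hwv⟩ hd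
    have hV : IsOpen (U \ {c}) := hU.sdiff isClosed_singleton
    obtain ⟨z, hz, h1, h2⟩ := h (u ∪ Metric.ball c r) (v ∩ (U \ {c}))
      (hu.union Metric.isOpen_ball) (hv.inter hV)
      (fun z hz => by
        by_cases e : z = c
        · exact .inl (.inr (e ▸ Metric.mem_ball_self hr))
        · exact (huv ⟨hz, e⟩).imp .inl fun h => ⟨h, hz, e⟩)
      ⟨c, hc, .inr (Metric.mem_ball_self hr)⟩ ⟨w, hw.1, hwv, hw⟩
    exact ⟨z, h2.2, h1.elim id fun h => hd ⟨h, h2.2.2⟩, h2.1⟩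
  intro u v hu hv huv hnu hnv
  by_contra hne
  have hD : Metric.ball c r \ {c} ⊆ U \ {c} := sdiff_subset_sdiff_left hr'
  rcases isPreconnected_iff_subset_of_disjoint.1 (isPreconnected_ball_diff c r) u v hu hv
    (hD.trans huv) (by
      rw [← not_nonempty_iff_eq_empty]
      exact fun hh => hne (hh.mono (inter_subset_inter_left _ hD))) with h1 | h1
  · exact hne (key u v hu hv huv hnv h1)
  · rw [inter_comm u v] at hne
    exact hne (key v u hv hu (by rwa [union_comm]) hnu h1)

theorem IsPreconnected.diff_finite {U F : Set ℂ} (hU : IsOpen U) (h : IsPreconnected U)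
    (hF : F.Finite) : IsPreconnected (U \ F) := by
  induction F, hF using Set.Finite.induction_on with
  | empty => simpa
  | @insert c F _ hF ih =>
    rw [← union_singleton, ← sdiff_sdiff]
    exact IsPreconnected.diff_singleton (hU.sdiff hF.isClosed) ih c

theorem push_of_comp {X T : Set ℂ} {t : ℂ} (hX : IsCompact X) (hT : T.Finite) (htX : t ∉ X)
    (htT : t ∉ T)
    (h : ¬ Bornology.IsBounded (comp X t) ∨ ∃ s ∈ T, s ∈ comp X t) : Push X T t := by
  have hVo : IsOpen (comp X t \ T) := (isOpen_comp hX.isClosed t).sdiff hT.isClosed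
  have hV : IsPreconnected (comp X t \ T) :=
    IsPreconnected.diff_finite (isOpen_comp hX.isClosed t) isPreconnected_connectedComponentIn hT
  have ht : t ∈ comp X t \ T := ⟨mem_connectedComponentIn htX, htT⟩
  have hd : ∀ z ∈ comp X t \ T, z ∉ X ∧ z ∉ T :=
    fun z hz => ⟨connectedComponentIn_subset _ _ hz.1, hz.2⟩
  rcases h with h | ⟨s, hs, hst⟩
  · obtain ⟨R, hR0, hR⟩ := (hX.isBounded.union hT.isBounded).exists_pos_norm_lt
    obtain ⟨u, hu, huR⟩ : ∃ u ∈ comp X t, R < ‖u‖ := by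
      by_contra! hh
      exact h (isBounded_iff_forall_norm_le.2 ⟨R, hh⟩)
    have huT : u ∉ T := fun hu' => (hR u (.inr hu')).not_gt huR
    refine Push.of_preconnected (s := u) ?_ hVo hV hd ⟨hu, huT⟩ ht
    have hle : ∀ z : ℂ, ‖z‖ ≤ R → ((min 1 (R / ‖z‖) : ℝ) : ℂ) * z = z := fun z hz => by
      rcases eq_or_ne z 0 with rfl | h0
      · simp
      rw [min_eq_left ((one_le_div (norm_pos_iff.2 h0)).2 hz)]
      simp
    refine ⟨fun z => (min 1 (R / ‖z‖) : ℝ) * z, ?_, fun z hz => hle z (hR z (.inl hz)).le, ?_⟩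
    · have e : ∀ z : ℂ, ((min 1 (R / ‖z‖) : ℝ) : ℂ) * z = ((R / max R ‖z‖ : ℝ) : ℂ) * z :=
        fun z => by
        rcases eq_or_ne z 0 with rfl | h0
        · simp
        congr 2
        rcases le_total R ‖z‖ with h1 | h1
        · rw [max_eq_right h1, min_eq_right ((div_le_one (hR0.trans_le h1)).2 h1)]
        · rw [max_eq_left h1, div_self hR0.ne',
            min_eq_left ((one_le_div (norm_pos_iff.2 h0)).2 h1)]
      simp only [e]
      refine Continuous.continuousOn ?_
      refine (Complex.continuous_ofReal.comp (continuous_const.div (by fun_prop) fun z => ?_)).mul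
        continuous_id
      exact (hR0.trans_le (le_max_left _ _)).ne'
    · intro z hz
      show ((min 1 (R / ‖z‖) : ℝ) : ℂ) * z ∉ insert u T
      rcases le_or_gt ‖z‖ R with h1 | h1
      · rw [hle z h1]
        rintro (rfl | h2)
        · exact h1.not_gt huR
        · exact hz h2
      · have h0 := hR0.trans h1
        have : ‖((min 1 (R / ‖z‖) : ℝ) : ℂ) * z‖ = R := by
          rw [norm_mul, Complex.norm_real, Real.norm_of_nonneg (by positivity),
            min_eq_right ((div_le_one h0).2 h1.le), div_mul_cancel₀ _ h0.ne']
        rintro (h2 | h2)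
        · rw [h2] at this
          exact huR.ne' this
        · exact (hR _ (.inr h2)).ne this
  · obtain ⟨r, hr, hr'⟩ := Metric.isOpen_iff.1
      ((isOpen_comp hX.isClosed t).sdiff ((hT.subset sdiff_subset).isClosed (s := T \ {s}))) s
      ⟨hst, by simp⟩
    have hs2 : s + (r / 2 : ℝ) ∈ Metric.ball s r := by
      rw [Metric.mem_ball, dist_eq_norm, add_sub_cancel_left, Complex.norm_real,
        Real.norm_of_nonneg (by positivity)]
      linarith
    have hb : ∀ z ∈ Metric.ball s r, z ≠ s → z ∈ comp X t \ T := fun z hz hzs =>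
      ⟨(hr' hz).1, fun hzT => (hr' hz).2 ⟨hzT, hzs⟩⟩
    refine Push.of_preconnected (s := s + (r / 2 : ℝ)) ?_ hVo hV hd (hb _ hs2 ?_) ht
    · refine ⟨push s (3 * r / 4), ?_, ?_, ?_⟩
      · exact (push_continuousOn s _).mono (compl_subset_compl.2 (singleton_subset_iff.2 hs))
      · intro z hz
        refine push_of_le (by positivity) (not_lt.1 fun hlt => ?_)
        have hz2 : z ∈ Metric.ball s r := by
          rw [Metric.mem_ball, dist_eq_norm]
          linarith
        exact connectedComponentIn_subset _ _ (hr' hz2).1 hz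
      · intro z hz h'
        have hzs : z ≠ s := fun e => hz (e ▸ hs)
        have hn := norm_push (r := 3 * r / 4) hzs
        rcases le_or_gt (3 * r / 4) ‖z - s‖ with h2 | h2
        · rw [push_of_le (by positivity) h2] at h'
          rcases h' with rfl | h'
          · rw [add_sub_cancel_left, Complex.norm_real, Real.norm_of_nonneg (by positivity)] at h2
            linarith
          · exact hz h'
        · rw [max_eq_right h2.le] at hn
          rcases h' with h' | h'
          · rw [h', add_sub_cancel_left, Complex.norm_real, Real.norm_of_nonneg (by positivity)]
              at hn
            linarith
          · have hm : push s (3 * r / 4) z ∈ Metric.ball s r := by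
              rw [Metric.mem_ball, dist_eq_norm, hn]
              linarith
            refine (hb _ hm fun e => ?_).2 h'
            rw [e, sub_self, norm_zero] at hn
            linarith
    · simp [hr.ne']

theorem HomT.of_push {X T : Set ℂ} {t p q : ℂ} (h : Push X T t) {a b : Path p q}
    (ha : ∀ s, a s ∈ X) (hb : ∀ s, b s ∈ X) (hab : HomT T a b) : HomT (insert t T) a b := by
  obtain ⟨ρ, hρ, hX, hT⟩ := h
  obtain ⟨F, hF⟩ := hab
  refine ⟨⟨⟨⟨fun z => ρ (F z), hρ.comp_continuous F.continuous hF⟩, fun s => ?_, fun s => ?_⟩,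
    fun u s hs => ?_⟩, fun z => hT _ (hF z)⟩
  · simpa using hX _ (ha s)
  · simpa using hX _ (hb s)
  · have := F.eq_fst u hs
    show ρ (F (u, s)) = a s
    rw [this]
    exact hX _ (ha s)

/-- Omitting further points that lie in unbounded faces or share a face with an omitted point does
not change homotopy of paths in `X`. -/
theorem HomT.extend {X T T' : Set ℂ} (hX : IsCompact X) (hT : T.Finite) (hXT : ∀ z ∈ X, z ∉ T)
    (hT' : T' ⊆ T) (h : ∀ t ∈ T, ¬ Bornology.IsBounded (comp X t) ∨ ∃ s ∈ T', s ∈ comp X t)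
    {p q : ℂ} {a b : Path p q} (ha : ∀ s, a s ∈ X) (hb : ∀ s, b s ∈ X) (hab : HomT T' a b) :
    HomT T a b := by
  suffices ∀ F : Set ℂ, F.Finite → F ⊆ T → HomT (F ∪ T') a b by
    simpa [union_eq_left.2 hT'] using this T hT subset_rfl
  intro F hF
  induction F, hF using Set.Finite.induction_on with
  | empty => simpa
  | @insert t F _ hF ih =>
    intro hFT
    rw [insert_subset_iff] at hFT
    rw [insert_union]
    by_cases ht : t ∈ F ∪ T'
    · rw [insert_eq_of_mem ht]
      exact ih hFT.2
    refine HomT.of_push (push_of_comp hX (hF.union (hT.subset hT')) (fun h => hXT t h hFT.1)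
      ht ?_) ha hb (ih hFT.2)
    exact (h t hFT.1).imp_right fun ⟨s, hs, h⟩ => ⟨s, .inr hs, h⟩

theorem continuousOn_range_of_comp {c : I → ℂ} (hc : Continuous c) {h : ℂ → ℂ}
    (hh : Continuous (h ∘ c)) : ContinuousOn h (range c) := by
  rw [continuousOn_iff_continuous_domRestrict]
  have hq : IsQuotientMap (rangeFactorization c) :=
    (Continuous.isClosedMap (by fun_prop)).isQuotientMap (by fun_prop) rangeFactorization_surjective
  exact hq.continuous_iff.2 hh

theorem hasLog_of_comp {α β : I → ℂ} (hα : Continuous α) (hβ : Continuous β) {h f : ℂ → ℂ}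
    (ha : Continuous (h ∘ α)) (hb : Continuous (h ∘ β)) (ea : ∀ t, Complex.exp (h (α t)) = f (α t))
    (eb : ∀ t, Complex.exp (h (β t)) = f (β t)) : HasLog (range α ∪ range β) f := by
  refine ⟨h, (continuousOn_range_of_comp hα ha).union_of_isClosed (continuousOn_range_of_comp hβ hb)
    (isCompact_range hα).isClosed (isCompact_range hβ).isClosed, ?_⟩
  rintro z (⟨t, rfl⟩ | ⟨t, rfl⟩)
  exacts [ea t, eb t]

theorem homT_empty {p q : ℂ} (a b : Path p q) : HomT ∅ a b := by
  refine ⟨⟨⟨⟨fun z => (1 - (z.1 : ℝ) : ℂ) * a z.2 + ((z.1 : ℝ) : ℂ) * b z.2, by fun_prop⟩, ?_, ?_⟩,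
    ?_⟩, fun z => id⟩
  · intro s
    simp
  · intro s
    simp
  · rintro u s (rfl | rfl)
    · simp [← add_mul]
    · simp [← add_mul]

theorem homT_singleton {p q τ : ℂ} {a b : Path p q} (ha : ∀ t, a t ≠ τ) (hb : ∀ t, b t ≠ τ)
    (h : wnd τ a = wnd τ b) : HomT {τ} a b := by
  obtain ⟨L, hL⟩ := exists_logAlong a τ ha
  obtain ⟨M, hM⟩ := exists_logAlong b τ hb
  rw [wnd_eq hL, wnd_eq hM] at h
  obtain ⟨hL, eL⟩ := hL
  obtain ⟨hM, eM⟩ := hM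
  let d : ℂ := L 0 - M 0
  have hd : Complex.exp d = 1 := by
    have h0 := eM 0
    have h1 := eL 0
    rw [a.source] at h1
    rw [b.source] at h0
    rw [Complex.exp_sub, h0, h1, div_self]
    have := ha 0
    rw [a.source] at this
    exact sub_ne_zero.2 this
  have e1 : L 1 = M 1 + d := by
    linear_combination h
  refine ⟨⟨⟨⟨fun z => τ + Complex.exp ((1 - (z.1 : ℝ) : ℂ) * L z.2 + ((z.1 : ℝ) : ℂ) * (M z.2 + d)),
    by fun_prop⟩, ?_, ?_⟩, ?_⟩, fun z hz => ?_⟩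
  · intro s
    simp [eL]
  · intro s
    simp [Complex.exp_add, hd, eM]
  · rintro u s (rfl | rfl)
    · have : L 0 = M 0 + d := by simp [d]
      simp [← add_mul, ← this, eL]
    · simp [← add_mul, ← e1, eL]
  · have : τ + Complex.exp ((1 - (z.1 : ℝ) : ℂ) * L z.2 + ((z.1 : ℝ) : ℂ) * (M z.2 + d)) = τ := hz
    simp [Complex.exp_ne_zero] at this

/-- Two paths with equal winding numbers are homotopic if, on a compact set containing both,
suitable logarithms exist. -/
theorem homT_of_hasLog {X T : Set ℂ} (hX : IsCompact X) (hT : T.Finite) (hXT : ∀ z ∈ X, z ∉ T)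
    {p q : ℂ} {a b : Path p q} (ha : ∀ s, a s ∈ X) (hb : ∀ s, b s ∈ X)
    (hw : ∀ τ ∈ T, wnd τ a = wnd τ b) (P : ℂ → Prop)
    (h1 : ∀ τ ∈ T, P τ → HasLog X fun z => z - τ)
    (h2 : ∀ τ ∈ T, ∀ τ' ∈ T, ¬ P τ → ¬ P τ' → HasLog X fun z => (z - τ) / (z - τ')) :
    HomT T a b := by
  have hX' := hX.isClosed
  by_cases h : ∃ τ ∈ T, ¬ P τ
  · obtain ⟨τ, hτ, hP⟩ := h
    refine HomT.extend hX hT hXT (singleton_subset_iff.2 hτ) (fun t ht => ?_) ha hb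
      (homT_singleton (fun t e => hXT _ (ha t) (e ▸ hτ)) (fun t e => hXT _ (hb t) (e ▸ hτ))
        (hw τ hτ))
    by_cases hPt : P t
    · exact .inl (unbounded_of_hasLog hX' (fun h => hXT _ h ht) (h1 t ht hPt))
    · by_cases hbd : Bornology.IsBounded (comp X t)
      · exact .inr ⟨τ, rfl, mem_comp_of_hasLog hX' (fun h => hXT _ h ht) (fun h => hXT _ h hτ)
          (h2 t ht τ hτ hPt hP) hbd⟩
      · exact .inl hbd
  · push Not at h
    refine HomT.extend hX hT hXT (empty_subset _) (fun t ht => ?_) ha hb (homT_empty a b)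
    exact .inl (unbounded_of_hasLog hX' (fun h => hXT _ h ht) (h1 t ht (h t ht)))

section

open Complex

theorem arg_change_of_re_nonneg {F Θ : I → ℂ} (hF : Continuous F) (hΘ : Continuous Θ)
    (h : ∀ t, exp (Θ t) = F t) (hr : ∀ t, 0 ≤ (F t).re) (s t : I) :
    (Θ t - Θ s).im = arg (F t) - arg (F s) := by
  have hs : ∀ t, F t ∈ slitPlane := fun t => by
    have hne : F t ≠ 0 := h t ▸ exp_ne_zero _
    rcases (hr t).lt_or_eq with h1 | h1
    · exact .inl h1
    · exact .inr fun h2 => hne (Complex.ext h1.symm h2)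
  have := log_sub_const hΘ (hF.clog hs) (fun x => by rw [h x, exp_log (slitPlane_ne_zero (hs x))])
      s t
  have e : Θ t - Θ s = log (F t) - log (F s) := by linear_combination -this
  rw [e, sub_im, log_im, log_im]

theorem arg_change_of_re_nonpos {F Θ : I → ℂ} (hF : Continuous F) (hΘ : Continuous Θ)
    (h : ∀ t, exp (Θ t) = F t) (hr : ∀ t, (F t).re ≤ 0) (s t : I) :
    (Θ t - Θ s).im = arg (-F t) - arg (-F s) := by
  have := arg_change_of_re_nonneg (F := fun t => - F t) (Θ := fun t => Θ t + Real.pi * Complex.I)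
    (by fun_prop) (by fun_prop) (fun t => by rw [exp_add, h, exp_pi_mul_I]; ring)
    (fun t => by simpa using hr t) s t
  rw [← this]
  ring_nf

theorem arg_two_pi_I_mul {k : ℤ} (h : 0 < k) : arg (2 * Real.pi * Complex.I * k) = Real.pi / 2 := by
  have : (2 * Real.pi * Complex.I * k : ℂ) = ((2 * Real.pi * k : ℝ) : ℂ) * Complex.I := by
    push_cast; ring
  rw [this, arg_real_mul _ (by positivity), arg_I]

theorem arg_neg_two_pi_I_mul {k : ℤ} (h : k < 0) :
    arg (2 * Real.pi * Complex.I * k) = -(Real.pi / 2) := by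
  have : (2 * Real.pi * Complex.I * k : ℂ) = ((2 * Real.pi * -k : ℝ) : ℂ) * -Complex.I := by
    push_cast; ring
  rw [this, arg_real_mul _ (by
    have : (0 : ℝ) < -k := by exact_mod_cast neg_pos.2 h
    positivity), arg_neg_I]

theorem exists_sub_eq {A B : I → ℂ} (hA : Continuous A) (hB : Continuous B) {k k' j : ℤ}
    (h0 : A 0 = B 0) (hA1 : A 1 = A 0 + 2 * Real.pi * Complex.I * k)
    (hB1 : B 1 = B 0 + 2 * Real.pi * Complex.I * k') (hk' : 0 < k')
    (hj : max 0 (k - k') < j) (hjk : j < k) (hrA : ∀ t, (A t).re ≤ (A 0).re)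
    (hrB : ∀ t, (B t).re ≤ (B 0).re) : ∃ u v, A u - B v = 2 * Real.pi * Complex.I * j := by
  by_contra! hne
  obtain ⟨hj0, hjk'⟩ := max_lt_iff.1 hj
  obtain ⟨Θ, hΘ, eΘ⟩ := exists_log_II (fun z => A z.1 - B z.2 - 2 * Real.pi * Complex.I * j)
    (by fun_prop) (fun z => sub_ne_zero.2 (hne _ _))
  have b := arg_change_of_re_nonpos (F := fun u => A u - B 0 - 2 * Real.pi * Complex.I * j)
    (Θ := fun u => Θ (u, 0)) (by fun_prop) (by fun_prop) (fun u => eΘ (u, 0))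
    (fun t => by have := hrA t; simp; rw [← h0]; exact this) 0 1
  have tt := arg_change_of_re_nonpos (F := fun u => A u - B 1 - 2 * Real.pi * Complex.I * j)
    (Θ := fun u => Θ (u, 1)) (by fun_prop) (by fun_prop) (fun u => eΘ (u, 1))
    (fun t => by have := hrA t; simp [hB1]; rw [← h0]; exact this) 0 1
  have l := arg_change_of_re_nonneg (F := fun v => A 0 - B v - 2 * Real.pi * Complex.I * j)
    (Θ := fun v => Θ (0, v)) (by fun_prop) (by fun_prop) (fun u => eΘ (0, u))
    (fun t => by have := hrB t; simp; rw [h0]; exact this) 0 1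
  have r := arg_change_of_re_nonneg (F := fun v => A 1 - B v - 2 * Real.pi * Complex.I * j)
    (Θ := fun v => Θ (1, v)) (by fun_prop) (by fun_prop) (fun u => eΘ (1, u))
    (fun t => by have := hrB t; simp [hA1]; rw [h0]; exact this) 0 1
  have e1 : -(A 1 - B 0 - 2 * Real.pi * Complex.I * j) =
    2 * Real.pi * Complex.I * (j - k : ℤ) := by rw [hA1, h0]; push_cast; ring
  have e2 : -(A 0 - B 0 - 2 * Real.pi * Complex.I * j) =
    2 * Real.pi * Complex.I * (j : ℤ) := by rw [h0]; ring
  have e3 : -(A 1 - B 1 - 2 * Real.pi * Complex.I * j) =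
    2 * Real.pi * Complex.I * (j - k + k' : ℤ) := by rw [hA1, hB1, h0]; push_cast; ring
  have e4 : -(A 0 - B 1 - 2 * Real.pi * Complex.I * j) =
    2 * Real.pi * Complex.I * (j + k' : ℤ) := by rw [hB1, h0]; push_cast; ring
  have e5 : (A 0 - B 1 - 2 * Real.pi * Complex.I * j) =
    2 * Real.pi * Complex.I * (-j - k' : ℤ) := by rw [hB1, h0]; push_cast; ring
  have e6 : (A 0 - B 0 - 2 * Real.pi * Complex.I * j) =
    2 * Real.pi * Complex.I * (-j : ℤ) := by rw [h0]; push_cast; ring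
  have e7 : (A 1 - B 1 - 2 * Real.pi * Complex.I * j) =
    2 * Real.pi * Complex.I * (k - k' - j : ℤ) := by rw [hA1, hB1, h0]; push_cast; ring
  have e8 : (A 1 - B 0 - 2 * Real.pi * Complex.I * j) =
    2 * Real.pi * Complex.I * (k - j : ℤ) := by rw [hA1, h0]; push_cast; ring
  rw [e1, e2, arg_two_pi_I_mul hj0, arg_neg_two_pi_I_mul (by omega)] at b
  rw [e3, e4, arg_two_pi_I_mul (by omega), arg_two_pi_I_mul (by omega)] at tt
  rw [e5, e6, arg_neg_two_pi_I_mul (by omega), arg_neg_two_pi_I_mul (by omega)] at l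
  rw [e7, e8, arg_neg_two_pi_I_mul (by omega), arg_two_pi_I_mul (by omega)] at r
  simp only [sub_im] at b tt l r
  linarith [Real.pi_pos]

theorem exists_sub_eq' {A B : I → ℂ} (hA : Continuous A) (hB : Continuous B) {k k' j : ℤ}
    (h0 : A 0 = B 0) (hA1 : A 1 = A 0 + 2 * Real.pi * Complex.I * k)
    (hB1 : B 1 = B 0 + 2 * Real.pi * Complex.I * k') (hk' : 0 < k')
    (hj : max 0 (k - k') < j) (hjk : j < k) (hrA : ∀ t, (A 0).re ≤ (A t).re)
    (hrB : ∀ t, (B 0).re ≤ (B t).re) : ∃ u v, A u - B v = 2 * Real.pi * Complex.I * j := by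
  have hc : ∀ m : ℤ, -(starRingEnd ℂ) (2 * Real.pi * Complex.I * m) = 2 * Real.pi * Complex.I * m :=
    fun m => by simp [Complex.conj_ofNat]
  obtain ⟨u, v, h⟩ := exists_sub_eq (A := fun t => -(starRingEnd ℂ) (A t))
    (B := fun t => -(starRingEnd ℂ) (B t)) (k := k) (k' := k') (j := j) (by fun_prop) (by fun_prop)
    (by rw [h0]) (by rw [hA1, map_add, neg_add, hc]) (by rw [hB1, map_add, neg_add, hc]) hk' hj hjk
    (fun t => by simpa using hrA t) (fun t => by simpa using hrB t)
  refine ⟨u, v, ?_⟩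
  have : -(starRingEnd ℂ) (A u - B v) = -(starRingEnd ℂ) (2 * Real.pi * Complex.I * j) := by
    rw [hc, ← h, map_sub]; ring
  exact (starRingEnd ℂ).injective (neg_injective this)

theorem two_pi_I_mul_inj {j k : ℤ} (h : 2 * Real.pi * Complex.I * j = 2 * Real.pi * Complex.I * k) :
    j = k := by
  simpa using h

theorem exp_two_pi_I_mul (k : ℤ) : exp (2 * Real.pi * Complex.I * k) = 1 := by
  rw [mul_comm, exp_int_mul_two_pi_mul_I]

theorem natAbs_le_one_of_pos {L : I → ℂ} (hL : Continuous L) {k : ℤ}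
    (h1 : L 1 = L 0 + 2 * Real.pi * Complex.I * k)
    (hs : ∀ s t, exp (L s) = exp (L t) → L s - L t = 0 ∨ L s - L t = 2 * Real.pi * Complex.I * k ∨
      L s - L t = - (2 * Real.pi * Complex.I * k)) : k ≤ 1 := by
  by_contra! hk
  obtain ⟨t₀, -, ht₀⟩ := isCompact_univ.exists_isMaxOn univ_nonempty
    (f := fun t => (L t).re) (by fun_prop : Continuous fun t => (L t).re).continuousOn
  have hmax : ∀ t, (L t).re ≤ (L t₀).re := fun t => ht₀ (mem_univ t)
  set c : ℂ := 2 * Real.pi * Complex.I * k with hc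
  have hcr : c.re = 0 := by simp [hc]
  let A := join (L ∘ Set.Icc.convexComb t₀ 1) (fun t => (L ∘ Set.Icc.convexComb 0 t₀) t + c)
  have hmem : ∀ t, ∃ s, A t = L s ∨ A t = L s + c := fun t => by
    rcases join_mem (L ∘ Set.Icc.convexComb t₀ 1) (fun t => (L ∘ Set.Icc.convexComb 0 t₀) t + c) t
      with ⟨u, hu⟩ | ⟨u, hu⟩
    · exact ⟨_, .inl hu⟩
    · exact ⟨_, .inr hu⟩
  have hA : Continuous A := join_continuous (hL.comp (by fun_prop))
    ((hL.comp (by fun_prop)).add continuous_const) (by simp [h1])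
  have hA0 : A 0 = L t₀ := by simp [A, join_zero]
  have hA1 : A 1 = L t₀ + c := by simp [A, join_one]
  have hr : ∀ t, (A t).re ≤ (A 0).re := fun t => by
    obtain ⟨s, h | h⟩ := hmem t <;> simp [h, hA0, hmax, hcr]
  obtain ⟨u, v, huv⟩ := exists_sub_eq (k := k) (k' := k) (j := 1) hA hA rfl (by rw [hA1, hA0])
    (by rw [hA1, hA0]) (by omega) (by simp) hk hr hr
  have key : ∃ s t, ∃ m : ℤ, (m = 1 ∨ m = 1 - k ∨ m = 1 + k) ∧
      L s - L t = 2 * Real.pi * Complex.I * m := by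
    obtain ⟨s, hs⟩ := hmem u
    obtain ⟨t, ht⟩ := hmem v
    rcases hs with hs | hs <;> rcases ht with ht | ht <;> rw [hs, ht] at huv
    · exact ⟨s, t, 1, .inl rfl, huv⟩
    · exact ⟨s, t, 1 + k, .inr (.inr rfl), by push_cast at huv ⊢; linear_combination huv⟩
    · exact ⟨s, t, 1 - k, .inr (.inl rfl), by push_cast at huv ⊢; linear_combination huv⟩
    · exact ⟨s, t, 1, .inl rfl, by linear_combination huv⟩
  obtain ⟨s, t, m, hm, hst⟩ := key
  have he : exp (L s) = exp (L t) := by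
    rw [← sub_add_cancel (L s) (L t), hst, exp_add, exp_two_pi_I_mul, one_mul]
  have h3 := hs s t he
  rw [hst] at h3
  have : m = 0 ∨ m = k ∨ m = -k := by
    refine h3.imp (fun h => two_pi_I_mul_inj (by rw [h]; simp)) (Or.imp two_pi_I_mul_inj
      fun h => two_pi_I_mul_inj (by rw [h, hc]; push_cast; ring))
  omega

theorem abs_le_one_of_log {L : I → ℂ} (hL : Continuous L) {k : ℤ}
    (h1 : L 1 = L 0 + 2 * Real.pi * Complex.I * k)
    (hs : ∀ s t, exp (L s) = exp (L t) → L s - L t = 0 ∨ L s - L t = 2 * Real.pi * Complex.I * k ∨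
      L s - L t = - (2 * Real.pi * Complex.I * k)) : |k| ≤ 1 := by
  refine abs_le'.2 ⟨natAbs_le_one_of_pos hL h1 hs,
    natAbs_le_one_of_pos (L := L ∘ unitInterval.symm) (by fun_prop) ?_ fun s t h => ?_⟩
  · simp [h1]
  · rcases hs _ _ h with h | h | h
    · exact .inl h
    · exact .inr (.inr (by rw [Function.comp, Function.comp, h]; push_cast; ring))
    · exact .inr (.inl (by rw [Function.comp, Function.comp, h]; push_cast; ring))

/-- Any two points of `K` are joined by a path in `K` along which `h` is continuous. -/
def JoinedBy (K : Set ℂ) (h : ℂ → ℂ) : Prop :=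
  ∀ p ∈ K, ∀ q ∈ K, ∃ D : Path p q, (∀ t, D t ∈ K) ∧ Continuous fun t => h (D t)

/-- A path with interior off `K` along which the logarithm `L` descends has degree at most one. -/
theorem abs_le_one_of_descends {K : Set ℂ} {g φ : ℂ → ℂ} (hK : JoinedBy K g)
    (hg : ∀ z ∈ K, exp (g z) = φ z) {p q : ℂ} (hp : p ∈ K) (hq : q ∈ K) {a : Path p q}
    (ha : ∀ t, t ≠ 0 → t ≠ 1 → a t ∉ K) (hφ : InjOn φ (K ∪ range a)) {L : I → ℂ}
    (hL : LogAlong φ a L) {k : ℤ} (h0 : L 0 = g p) (h1 : L 1 = g q + 2 * Real.pi * Complex.I * k)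
    (hd : ∀ u v, u ≠ 0 → u ≠ 1 → v ≠ 0 → v ≠ 1 → a u = a v → L u = L v) : |k| ≤ 1 := by
  obtain ⟨D, hD, hgD⟩ := hK q hq p hp
  set c : ℂ := 2 * Real.pi * Complex.I * k with hc
  have hec : exp c = 1 := exp_two_pi_I_mul k
  let A := join L (fun t => g (D t) + c)
  have hA : Continuous A := join_continuous hL.1 (hgD.add continuous_const) (by simp [h1])
  have hmem : ∀ t, (∃ u, u ≠ 0 ∧ u ≠ 1 ∧ A t = L u) ∨ ∃ z ∈ K, A t = g z ∨ A t = g z + c :=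
      fun t => by
    rcases join_mem L (fun t => g (D t) + c) t with ⟨u, hu⟩ | ⟨u, hu⟩
    · by_cases hu0 : u = 0
      · exact .inr ⟨p, hp, .inl (by rw [← h0, ← hu0]; exact hu)⟩
      by_cases hu1 : u = 1
      · exact .inr ⟨q, hq, .inr (by rw [← h1, ← hu1]; exact hu)⟩
      exact .inl ⟨u, hu0, hu1, hu⟩
    · exact .inr ⟨D u, hD u, .inr hu⟩
  refine abs_le_one_of_log hA ?_ fun s t hst => ?_
  · simp [A, join_one, join_zero, h0, c]
  · have heK : ∀ t, ∀ z ∈ K, (A t = g z ∨ A t = g z + c) → exp (A t) = φ z := by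
      rintro t z hz (h | h)
      · rw [h, hg z hz]
      · rw [h, exp_add, hec, mul_one, hg z hz]
    rcases hmem s with ⟨u, hu0, hu1, hu⟩ | ⟨z, hz, hsz⟩ <;>
      rcases hmem t with ⟨v, hv0, hv1, hv⟩ | ⟨w, hw, htw⟩
    · rw [hu, hv, hL.2, hL.2] at hst
      have := hφ (.inr ⟨u, rfl⟩) (.inr ⟨v, rfl⟩) hst
      exact .inl (by rw [hu, hv, hd u v hu0 hu1 hv0 hv1 this, sub_self])
    · rw [heK t w hw htw, hu, hL.2] at hst
      exact absurd (hφ (.inr ⟨u, rfl⟩) (.inl hw) hst ▸ hw) (ha u hu0 hu1)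
    · rw [heK s z hz hsz, hv, hL.2] at hst
      exact absurd (hφ (.inl hz) (.inr ⟨v, rfl⟩) hst ▸ hz) (ha v hv0 hv1)
    · rw [heK s z hz hsz, heK t w hw htw] at hst
      obtain rfl := hφ (.inl hz) (.inl hw) hst
      rcases hsz with h | h <;> rcases htw with h' | h' <;> rw [h, h'] <;> simp [hc]

end

section

open Complex

theorem exists_closed_curve {K : Set ℂ} {g : ℂ → ℂ} (hK : JoinedBy K g) {p q z₀ : ℂ} (hp : p ∈ K)
    (hq : q ∈ K) (hz₀ : z₀ ∈ K) {L : I → ℂ} (hL : Continuous L) {c : ℂ} (h0 : L 0 = g p)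
    (h1 : L 1 = g q + c) : ∃ A : I → ℂ, Continuous A ∧ A 0 = g z₀ ∧ A 1 = g z₀ + c ∧
      ∀ t, (∃ u, u ≠ 0 ∧ u ≠ 1 ∧ A t = L u) ∨ ∃ z ∈ K, A t = g z ∨ A t = g z + c := by
  obtain ⟨D, hD, hgD⟩ := hK z₀ hz₀ p hp
  obtain ⟨D', hD', hgD'⟩ := hK q hq z₀ hz₀
  have hB : Continuous (join L (fun t => g (D' t) + c)) :=
    join_continuous hL (hgD'.add continuous_const) (by simp [h1])
  refine ⟨join (fun t => g (D t)) (join L (fun t => g (D' t) + c)),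
    join_continuous hgD hB (by simp [join_zero, h0]), by simp [join_zero], by simp [join_one],
    fun t => ?_⟩
  rcases join_mem (fun t => g (D t)) (join L (fun t => g (D' t) + c)) t with ⟨u, hu⟩ | ⟨u, hu⟩
  · exact .inr ⟨_, hD u, .inl hu⟩
  rcases join_mem L (fun t => g (D' t) + c) u with ⟨v, hv⟩ | ⟨v, hv⟩
  · rw [hv] at hu
    by_cases hu0 : v = 0
    · exact .inr ⟨p, hp, .inl (by rw [← h0, ← hu0]; exact hu)⟩
    by_cases hu1 : v = 1
    · exact .inr ⟨q, hq, .inr (by rw [← h1, ← hu1]; exact hu)⟩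
    exact .inl ⟨v, hu0, hu1, hu⟩
  · exact .inr ⟨_, hD' v, .inr (hu.trans hv)⟩

theorem exists_interior_sub_eq {K : Set ℂ} {g φ : ℂ → ℂ} (hK : JoinedBy K g)
    (hg : ∀ z ∈ K, exp (g z) = φ z) {p q p' q' : ℂ} (hp : p ∈ K) (hq : q ∈ K) (hp' : p' ∈ K)
    (hq' : q' ∈ K) {a : Path p q} {b : Path p' q'} (ha : ∀ t, t ≠ 0 → t ≠ 1 → a t ∉ K)
    (hb : ∀ t, t ≠ 0 → t ≠ 1 → b t ∉ K) (hφ : InjOn φ (K ∪ range a ∪ range b)) {L M : I → ℂ}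
    (hL : LogAlong φ a L) (hM : LogAlong φ b M) {k k' : ℤ} (h0 : L 0 = g p)
    (h1 : L 1 = g q + 2 * Real.pi * Complex.I * k) (h0' : M 0 = g p')
    (h1' : M 1 = g q' + 2 * Real.pi * Complex.I * k') {z₀ : ℂ} (hz₀ : z₀ ∈ K)
    (hz : (∀ z ∈ K ∪ range a ∪ range b, ‖φ z‖ ≤ ‖φ z₀‖) ∨
      ∀ z ∈ K ∪ range a ∪ range b, ‖φ z₀‖ ≤ ‖φ z‖) {j : ℤ} (hk' : 0 < k')
    (hj : max 0 (k - k') < j) (hjk : j < k) :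
    ∃ u v, (u ≠ 0 ∧ u ≠ 1 ∧ v ≠ 0 ∧ v ≠ 1 ∧ a u = b v) ∧
      L u - M v = 2 * Real.pi * Complex.I * j := by
  obtain ⟨A, hA, hA0, hA1, hAm⟩ := exists_closed_curve hK hp hq hz₀ hL.1 h0 h1
  obtain ⟨B, hB, hB0, hB1, hBm⟩ := exists_closed_curve hK hp' hq' hz₀ hM.1 h0' h1'
  have hA' : ∀ t, (∃ u, u ≠ 0 ∧ u ≠ 1 ∧ A t = L u ∧ exp (A t) = φ (a u)) ∨
      ∃ z ∈ K, exp (A t) = φ z ∧ (A t = g z ∨ A t = g z + 2 * Real.pi * Complex.I * k) := by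
    refine fun t => (hAm t).imp (fun ⟨u, hu, hu', h⟩ => ⟨u, hu, hu', h, by rw [h, hL.2]⟩)
      (fun ⟨z, hz, h⟩ => ⟨z, hz, ?_, h⟩)
    rcases h with h | h
    · rw [h, hg z hz]
    · rw [h, exp_add, exp_two_pi_I_mul, mul_one, hg z hz]
  have hB' : ∀ t, (∃ u, u ≠ 0 ∧ u ≠ 1 ∧ B t = M u ∧ exp (B t) = φ (b u)) ∨
      ∃ z ∈ K, exp (B t) = φ z ∧ (B t = g z ∨ B t = g z + 2 * Real.pi * Complex.I * k') := by
    refine fun t => (hBm t).imp (fun ⟨u, hu, hu', h⟩ => ⟨u, hu, hu', h, by rw [h, hM.2]⟩)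
      (fun ⟨z, hz, h⟩ => ⟨z, hz, ?_, h⟩)
    rcases h with h | h
    · rw [h, hg z hz]
    · rw [h, exp_add, exp_two_pi_I_mul, mul_one, hg z hz]
  have hAe : ∀ t, ∃ z ∈ K ∪ range a ∪ range b, exp (A t) = φ z := fun t => by
    rcases hA' t with ⟨u, -, -, -, h⟩ | ⟨z, hz, h, -⟩
    exacts [⟨a u, .inl (.inr ⟨u, rfl⟩), h⟩, ⟨z, .inl (.inl hz), h⟩]
  have hBe : ∀ t, ∃ z ∈ K ∪ range a ∪ range b, exp (B t) = φ z := fun t => by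
    rcases hB' t with ⟨u, -, -, -, h⟩ | ⟨z, hz, h, -⟩
    exacts [⟨b u, .inr ⟨u, rfl⟩, h⟩, ⟨z, .inl (.inl hz), h⟩]
  have hex : ∃ u v, A u - B v = 2 * Real.pi * Complex.I * j := by
    rcases hz with hz | hz
    · refine exists_sub_eq hA hB (hA0.trans hB0.symm) (by rw [hA1, hA0]) (by rw [hB1, hB0]) hk' hj
        hjk
        (fun t => ?_) (fun t => ?_)
      · obtain ⟨z, hz', h⟩ := hAe t
        rw [← Real.exp_le_exp, ← norm_exp, ← norm_exp, h, hA0, hg z₀ hz₀]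
        exact hz z hz'
      · obtain ⟨z, hz', h⟩ := hBe t
        rw [← Real.exp_le_exp, ← norm_exp, ← norm_exp, h, hB0, hg z₀ hz₀]
        exact hz z hz'
    · refine exists_sub_eq' hA hB (hA0.trans hB0.symm) (by rw [hA1, hA0]) (by rw [hB1, hB0]) hk' hj
        hjk (fun t => ?_) (fun t => ?_)
      · obtain ⟨z, hz', h⟩ := hAe t
        rw [← Real.exp_le_exp, ← norm_exp, ← norm_exp, h, hA0, hg z₀ hz₀]
        exact hz z hz'
      · obtain ⟨z, hz', h⟩ := hBe t
        rw [← Real.exp_le_exp, ← norm_exp, ← norm_exp, h, hB0, hg z₀ hz₀]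
        exact hz z hz'
  obtain ⟨u, v, huv⟩ := hex
  have he : exp (A u) = exp (B v) := by
    rw [← sub_add_cancel (A u) (B v), huv, exp_add, exp_two_pi_I_mul, one_mul]
  obtain ⟨hj0, hj1⟩ := max_lt_iff.1 hj
  rcases hA' u with ⟨s, hs0, hs1, hs, hse⟩ | ⟨z, hzK, hze, hzu⟩ <;>
    rcases hB' v with ⟨t, ht0, ht1, ht, hte⟩ | ⟨w, hwK, hwe, hwv⟩
  · rw [hse, hte] at he
    exact ⟨s, t, ⟨hs0, hs1, ht0, ht1, hφ (.inl (.inr ⟨s, rfl⟩)) (.inr ⟨t, rfl⟩) he⟩,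
      by rw [← huv, hs, ht]⟩
  · rw [hse, hwe] at he
    exact absurd (hφ (.inl (.inr ⟨s, rfl⟩)) (.inl (.inl hwK)) he ▸ hwK) (ha s hs0 hs1)
  · rw [hze, hte] at he
    exact absurd (hφ (.inl (.inl hzK)) (.inr ⟨t, rfl⟩) he ▸ hzK) (hb t ht0 ht1)
  · rw [hze, hwe] at he
    obtain rfl := hφ (.inl (.inl hzK)) (.inl (.inl hwK)) he
    exfalso
    rcases hzu with h | h <;> rcases hwv with h' | h' <;> rw [h, h'] at huv
    · have := two_pi_I_mul_inj (j := j) (k := 0) (by rw [← huv]; simp)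
      omega
    · have := two_pi_I_mul_inj (j := j) (k := -k') (by rw [← huv]; push_cast; ring)
      omega
    · have := two_pi_I_mul_inj (j := j) (k := k) (by rw [← huv]; ring)
      omega
    · have := two_pi_I_mul_inj (j := j) (k := k - k') (by rw [← huv]; push_cast; ring)
      omega

/-- The set of interior coincidences of two paths. -/
def interiorCross {p q p' q' : ℂ} (a : Path p q) (b : Path p' q') : Set (I × I) :=
  {u | u.1 ≠ 0 ∧ u.1 ≠ 1 ∧ u.2 ≠ 0 ∧ u.2 ≠ 1 ∧ a u.1 = b u.2}

theorem le_encard_interiorCross_of_pos {K : Set ℂ} {g φ : ℂ → ℂ} (hK : JoinedBy K g)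
    (hg : ∀ z ∈ K, exp (g z) = φ z) {p q p' q' : ℂ} (hp : p ∈ K) (hq : q ∈ K) (hp' : p' ∈ K)
    (hq' : q' ∈ K) {a : Path p q} {b : Path p' q'} (ha : ∀ t, t ≠ 0 → t ≠ 1 → a t ∉ K)
    (hb : ∀ t, t ≠ 0 → t ≠ 1 → b t ∉ K) (hφ : InjOn φ (K ∪ range a ∪ range b)) {L M : I → ℂ}
    (hL : LogAlong φ a L) (hM : LogAlong φ b M) {k k' : ℤ} (h0 : L 0 = g p)
    (h1 : L 1 = g q + 2 * Real.pi * Complex.I * k) (h0' : M 0 = g p')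
    (h1' : M 1 = g q' + 2 * Real.pi * Complex.I * k') {z₀ : ℂ} (hz₀ : z₀ ∈ K)
    (hz : (∀ z ∈ K ∪ range a ∪ range b, ‖φ z‖ ≤ ‖φ z₀‖) ∨
      ∀ z ∈ K ∪ range a ∪ range b, ‖φ z₀‖ ≤ ‖φ z‖) {W : ℕ} (hW : W < k) (hW' : W < k') :
    (W : ℕ∞) ≤ (interiorCross a b).encard := by
  have key := fun j hj => exists_interior_sub_eq hK hg hp hq hp' hq' ha hb hφ hL hM h0 h1 h0' h1'
      hz₀
    hz (j := j) (by omega) (Finset.mem_Ioo.1 hj).1 (Finset.mem_Ioo.1 hj).2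
  choose u v huv hj using key
  let f : Finset.Ioo (max 0 (k - k')) k → I × I := fun j => (u j j.2, v j j.2)
  have hf : Function.Injective f := fun i j hij => by
    rw [Prod.mk.injEq] at hij
    have h1 := hj i i.2
    rw [hij.1, hij.2, hj j j.2] at h1
    exact Subtype.ext (two_pi_I_mul_inj h1).symm
  have hr : range f ⊆ interiorCross a b := by
    rintro _ ⟨j, rfl⟩
    exact huv j j.2
  refine le_trans ?_ (encard_le_encard hr)
  rw [← image_univ, hf.encard_image, encard_univ, ENat.card_eq_coe_fintype_card, Fintype.card_coe,
    Int.card_Ioo]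
  norm_cast
  omega

theorem exists_symm_log {g φ : ℂ → ℂ} {p q : ℂ} {a : Path p q} {L : I → ℂ} (hL : LogAlong φ a L)
    {k : ℤ} (h0 : L 0 = g p) (h1 : L 1 = g q + 2 * Real.pi * Complex.I * k) :
    ∃ M, LogAlong φ a.symm M ∧ M 0 = g q ∧ M 1 = g p + 2 * Real.pi * Complex.I * (-k : ℤ) :=
  ⟨_, hL.symm.add_const (exp_two_pi_I_mul (-k)), by simp [h1], by simp [h0]⟩

theorem symm_ne_zero (t : I) : unitInterval.symm t ≠ 0 ↔ t ≠ 1 := by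
  rw [Ne, Ne, unitInterval.symm_eq_zero]

theorem symm_ne_one (t : I) : unitInterval.symm t ≠ 1 ↔ t ≠ 0 := by
  rw [Ne, Ne, unitInterval.symm_eq_one]

theorem encard_interiorCross_symm_left {p q p' q' : ℂ} (a : Path p q) (b : Path p' q') :
    (interiorCross a.symm b).encard ≤ (interiorCross a b).encard :=
  encard_le_encard_of_injOn (f := fun u => (unitInterval.symm u.1, u.2))
    (fun u ⟨h1, h2, h⟩ => ⟨(symm_ne_zero _).2 h2, (symm_ne_one _).2 h1, h⟩)
    (Function.Injective.injOn fun u v h => by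
      simpa [Prod.ext_iff, unitInterval.symm_inj] using h)

theorem encard_interiorCross_symm_right {p q p' q' : ℂ} (a : Path p q) (b : Path p' q') :
    (interiorCross a b.symm).encard ≤ (interiorCross a b).encard :=
  encard_le_encard_of_injOn (f := fun u => (u.1, unitInterval.symm u.2))
    (fun u ⟨h1, h2, h3, h4, h⟩ => ⟨h1, h2, (symm_ne_zero _).2 h4, (symm_ne_one _).2 h3, h⟩)
    (Function.Injective.injOn fun u v h => by
      simpa [Prod.ext_iff, unitInterval.symm_inj] using h)

/-- Two paths with large degree relative to `K` meet often. -/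
theorem le_encard_interiorCross {K : Set ℂ} {g φ : ℂ → ℂ} (hK : JoinedBy K g)
    (hg : ∀ z ∈ K, exp (g z) = φ z) {p q p' q' : ℂ} (hp : p ∈ K) (hq : q ∈ K) (hp' : p' ∈ K)
    (hq' : q' ∈ K) {a : Path p q} {b : Path p' q'} (ha : ∀ t, t ≠ 0 → t ≠ 1 → a t ∉ K)
    (hb : ∀ t, t ≠ 0 → t ≠ 1 → b t ∉ K) (hφ : InjOn φ (K ∪ range a ∪ range b)) {L M : I → ℂ}
    (hL : LogAlong φ a L) (hM : LogAlong φ b M) {k k' : ℤ} (h0 : L 0 = g p)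
    (h1 : L 1 = g q + 2 * Real.pi * Complex.I * k) (h0' : M 0 = g p')
    (h1' : M 1 = g q' + 2 * Real.pi * Complex.I * k') {z₀ : ℂ} (hz₀ : z₀ ∈ K)
    (hz : (∀ z ∈ K ∪ range a ∪ range b, ‖φ z‖ ≤ ‖φ z₀‖) ∨
      ∀ z ∈ K ∪ range a ∪ range b, ‖φ z₀‖ ≤ ‖φ z‖) {W : ℕ} (hW : W < |k|) (hW' : W < |k'|) :
    (W : ℕ∞) ≤ (interiorCross a b).encard := by
  have sa : ∀ t, t ≠ 0 → t ≠ 1 → a.symm t ∉ K := fun t h h' =>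
    ha _ ((symm_ne_zero t).2 h') ((symm_ne_one t).2 h)
  have sb : ∀ t, t ≠ 0 → t ≠ 1 → b.symm t ∉ K := fun t h h' =>
    hb _ ((symm_ne_zero t).2 h') ((symm_ne_one t).2 h)
  obtain ⟨L', hL', h2, h3⟩ := exists_symm_log hL h0 h1
  obtain ⟨M', hM', h2', h3'⟩ := exists_symm_log hM h0' h1'
  rcases le_or_gt k 0 with hk | hk <;> rcases le_or_gt k' 0 with hk' | hk' <;>
    first | rw [abs_of_nonpos hk] at hW | rw [abs_of_pos hk] at hW
  all_goals first | rw [abs_of_nonpos hk'] at hW' | rw [abs_of_pos hk'] at hW'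
  · exact (le_encard_interiorCross_of_pos hK hg hq hp hq' hp' sa sb (by simpa using hφ) hL' hM' h2
      h3 h2' h3' hz₀ (by simpa using hz) hW hW').trans
      ((encard_interiorCross_symm_left _ _).trans (encard_interiorCross_symm_right _ _))
  · exact (le_encard_interiorCross_of_pos hK hg hq hp hp' hq' sa hb (by simpa using hφ) hL' hM h2
      h3 h0' h1' hz₀ (by simpa using hz) hW hW').trans (encard_interiorCross_symm_left _ _)
  · exact (le_encard_interiorCross_of_pos hK hg hp hq hq' hp' ha sb (by simpa using hφ) hL hM' h0
      h1 h2' h3' hz₀ (by simpa using hz) hW hW').trans (encard_interiorCross_symm_right _ _)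
  · exact le_encard_interiorCross_of_pos hK hg hp hq hp' hq' ha hb hφ hL hM h0 h1 h0' h1' hz₀ hz
      hW hW'

end

theorem interval_induction {F : Finset I} (h0 : 0 ∈ F) {P : ℕ → I → Prop} (hP0 : P 0 0)
    (hP : ∀ n, ∀ t ∈ F, ∀ s, t < s → (∀ u, t < u → u < s → u ∉ F) → P n t → P (n + 1) s) (s : I) :
    P (F.filter (· < s)).card s := by
  induction hn : (F.filter (· < s)).card generalizing s with
  | zero =>
    have : s = 0 := by
      by_contra h
      have : (0 : I) ∈ F.filter (· < s) :=
        Finset.mem_filter.2 ⟨h0, unitInterval.pos_iff_ne_zero.2 h⟩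
      rw [Finset.card_eq_zero] at hn
      simp [hn] at this
    rw [this]
    exact hP0
  | succ n ih =>
    have hne : (F.filter (· < s)).Nonempty := by
      rw [← Finset.card_pos]
      omega
    set t := (F.filter (· < s)).max' hne with ht
    have htm : t ∈ F.filter (· < s) := Finset.max'_mem _ _
    obtain ⟨htF, hts⟩ := Finset.mem_filter.1 htm
    have hle : ∀ u ∈ F, u < s → u ≤ t := fun u hu hus =>
      Finset.le_max' _ _ (Finset.mem_filter.2 ⟨hu, hus⟩)
    refine hP n t htF s hts (fun u h1 h2 hu => (hle u hu h2).not_gt h1) (ih t ?_)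
    have : F.filter (· < t) = (F.filter (· < s)).erase t := by
      ext u
      simp only [Finset.mem_filter, Finset.mem_erase]
      exact ⟨fun ⟨h1, h2⟩ => ⟨h2.ne, h1, h2.trans hts⟩,
        fun ⟨h1, h2, h3⟩ => ⟨h2, lt_of_le_of_ne (hle u h2 h3) h1⟩⟩
    rw [this, Finset.card_erase_of_mem htm, hn, Nat.add_sub_cancel]

theorem convexComb_injective {t s : I} (h : t < s) :
    Function.Injective (Set.Icc.convexComb t s) := by
  intro u v huv
  have h1 := congrArg (Subtype.val) huv
  have h2 : (t : ℝ) < s := h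
  simp only [Set.Icc.coe_convexComb] at h1
  have h3 : ((u : ℝ) - v) * (s - t) = 0 := by linear_combination h1
  rcases mul_eq_zero.1 h3 with h3 | h3
  · exact Subtype.ext (sub_eq_zero.1 h3)
  · linarith

theorem convexComb_mem_Ioo {t s : I} (h : t < s) (u : I) (h0 : u ≠ 0) (h1 : u ≠ 1) :
    t < Set.Icc.convexComb t s u ∧ Set.Icc.convexComb t s u < s := by
  have h2 : (t : ℝ) < s := h
  have h3 : (0 : ℝ) < u := unitInterval.pos_iff_ne_zero.2 h0
  have h4 : (u : ℝ) < 1 := unitInterval.lt_one_iff_ne_one.2 h1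
  constructor
  · rw [← Subtype.coe_lt_coe, Set.Icc.coe_convexComb]
    nlinarith
  · rw [← Subtype.coe_lt_coe, Set.Icc.coe_convexComb]
    nlinarith

/-- A choice of logarithms `g τ` of `z - τ` on `K`, continuous along paths from `x` to each point
of `K`. -/
structure Tree (T : Set ℂ) (x : ℂ) (K : Set ℂ) (g : ℂ → ℂ → ℂ) : Prop where
  mem : x ∈ K
  exp_eq : ∀ τ ∈ T, ∀ z ∈ K, Complex.exp (g τ z) = z - τ
  exists_path : ∀ p ∈ K, ∃ E : Path x p, (∀ t, E t ∈ K) ∧ ∀ τ ∈ T, Continuous fun t => g τ (E t)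

theorem exists_tree_singleton {T : Set ℂ} {x : ℂ} (hx : x ∉ T) : ∃ g, Tree T x {x} g := by
  refine ⟨fun τ z => Complex.log (z - τ), rfl, ?_, ?_⟩
  · rintro τ hτ z rfl
    rw [Complex.exp_log]
    exact sub_ne_zero.2 fun e => hx (e ▸ hτ)
  · rintro p rfl
    exact ⟨Path.refl _, fun _ => rfl, fun τ _ => by simpa using continuous_const⟩

theorem Tree.extend {T : Set ℂ} {x : ℂ} {K : Set ℂ} {g : ℂ → ℂ → ℂ} (h : Tree T x K g)
    {p q : ℂ} {A : Path p q} (hA : Avoids T A) (hp : p ∈ K) (hK : ∀ s, s ≠ 0 → s ≠ 1 → A s ∉ K)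
    (hinj : ∀ s s', s ≠ s' → A s = A s' → A s ∈ K) : ∃ g', Tree T x (K ∪ range A) g' := by
  classical
  have hL : ∀ τ : ℂ, ∃ L : I → ℂ, τ ∈ T → (LogAlong (fun z => z - τ) A L ∧ L 0 = g τ p) :=
      fun τ => by
    by_cases hτ : τ ∈ T
    · obtain ⟨L, hL⟩ := exists_logAlong A τ (fun t e => hA t (e ▸ hτ))
      refine ⟨fun t => L t + (g τ p - L 0), fun _ => ⟨hL.add_const ?_, by ring⟩⟩
      have h1 := hL.2 0
      simp only [A.source] at h1
      rw [Complex.exp_sub, h.exp_eq τ hτ p hp, ← h1, div_self (Complex.exp_ne_zero _)]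
    · exact ⟨0, fun h => absurd h hτ⟩
  choose L hL using hL
  let g' : ℂ → ℂ → ℂ := fun τ z => if z ∈ K then g τ z else
    if hz : ∃ s, A s = z then L τ hz.choose else 0
  have hgK : ∀ τ, ∀ z ∈ K, g' τ z = g τ z := fun τ z hz => if_pos hz
  have hgA : ∀ τ, ∀ s, A s ∉ K → g' τ (A s) = L τ s := fun τ s hs => by
    have hz : ∃ s', A s' = A s := ⟨s, rfl⟩
    show (if A s ∈ K then _ else _) = _
    rw [if_neg hs, dif_pos hz]
    by_contra hne
    have h1 : hz.choose ≠ s := fun e => hne (congrArg _ e)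
    exact hs (hz.choose_spec ▸ hinj _ _ h1 hz.choose_spec)
  refine ⟨g', .inl h.mem, ?_, ?_⟩
  · rintro τ hτ z hz
    by_cases hzK : z ∈ K
    · rw [hgK τ z hzK, h.exp_eq τ hτ z hzK]
    · obtain ⟨s, rfl⟩ := hz.resolve_left hzK
      rw [hgA τ s hzK, (hL τ hτ).1.2]
  · intro z hz
    by_cases hzK : z ∈ K
    · obtain ⟨E, hE, hE'⟩ := h.exists_path z hzK
      exact ⟨E, fun t => .inl (hE t), fun τ hτ => (hE' τ hτ).congr fun t => (hgK τ _ (hE t)).symm⟩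
    · obtain ⟨s, rfl⟩ := hz.resolve_left hzK
      obtain ⟨E, hE, hE'⟩ := h.exists_path p hp
      have hs0 : s ≠ 0 := fun e => hzK (by rw [e, A.source]; exact hp)
      have hA0 : A 0 = p := A.source
      let B : Path p (A s) := (A.subpath 0 s).cast hA0.symm rfl
      have hB : ∀ t, B t = A (Set.Icc.convexComb 0 s t) := fun t => rfl
      have hconv : ∀ t : I, (Set.Icc.convexComb 0 s t : I) = 1 → s = 1 := fun t ht => by
        have h1 : (Set.Icc.convexComb 0 s t : I) ≤ s := by
          rw [← Subtype.coe_le_coe, Set.Icc.coe_convexComb]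
          have := t.2.2
          have := s.2.1
          simp
          nlinarith
        rw [ht] at h1
        exact le_antisymm s.2.2 h1
      have hgB : ∀ τ ∈ T, ∀ t, g' τ (B t) = L τ (Set.Icc.convexComb 0 s t) := fun τ hτ t => by
        rw [hB]
        by_cases h0 : Set.Icc.convexComb 0 s t = 0
        · rw [h0, hA0, hgK τ p hp, (hL τ hτ).2]
        by_cases h1 : Set.Icc.convexComb 0 s t = 1
        · have := hconv t h1
          subst this
          rw [h1, hgA τ _ hzK]
        · exact hgA τ _ (hK _ h0 h1)
      refine ⟨E.trans B, fun t => ?_, fun τ hτ => ?_⟩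
      · have h1 : (E.trans B) t ∈ range E ∪ range B := Path.trans_range E B ▸ mem_range_self t
        rcases h1 with ⟨u, hu⟩ | ⟨u, hu⟩
        · exact .inl (hu ▸ hE u)
        · exact .inr (hu ▸ ⟨_, rfl⟩)
      · have h1 : Continuous (join (fun t => g' τ (E t)) (fun t => g' τ (B t))) := by
          refine join_continuous ((hE' τ hτ).congr fun t => (hgK τ _ (hE t)).symm) ?_ (by simp)
          simp only [hgB τ hτ]
          exact (hL τ hτ).1.1.comp (by fun_prop)
        refine h1.congr fun t => ?_
        rw [Path.trans_apply]
        unfold join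
        split_ifs <;> rfl

theorem Tree.extend_path {T : Set ℂ} {x : ℂ} {K : Set ℂ} {g : ℂ → ℂ → ℂ} (h : Tree T x K g)
    {q : ℂ} {γ : Path x q} (hγ : Avoids T γ) {F : Finset I} (h0 : 0 ∈ F)
    (hK : ∀ s, γ s ∈ K → s ∈ F) (hinj : ∀ s s', s ≠ s' → γ s = γ s' → s ∈ F) :
    ∃ g', Tree T x (K ∪ range γ) g' := by
  have key := interval_induction h0 (P := fun _ s => ∃ g', Tree T x (K ∪ γ '' Icc 0 s) g') ?_ ?_ 1
  · rwa [← unitInterval.univ_eq_Icc, image_univ] at key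
  · refine ⟨g, ?_⟩
    rw [Icc_self, image_singleton, γ.source, union_eq_left.2 (singleton_subset_iff.2 h.mem)]
    exact h
  · rintro - t htF s hts hF ⟨g', hg'⟩
    have hcv := fun u => convexComb_mem_Ioo hts u
    have hci := convexComb_injective hts
    have hn : ∀ u, u ≠ 0 → u ≠ 1 → Set.Icc.convexComb t s u ∉ F := fun u h0 h1 =>
      hF _ (hcv u h0 h1).1 (hcv u h0 h1).2
    have h1 := hg'.extend (A := γ.subpath t s) (fun u => hγ _) (.inr ⟨t, ⟨t.2.1, le_rfl⟩, rfl⟩) ?_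
        ?_
    · rw [Path.range_subpath_of_le _ _ _ hts.le, union_assoc, ← image_union,
        Icc_union_Icc_eq_Icc (show (0 : I) ≤ t from t.2.1) hts.le] at h1
      exact h1
    · rintro u h0 h1 (h | ⟨v, hv, h⟩)
      · exact hn u h0 h1 (hK _ h)
      · exact hn u h0 h1 (hinj _ _ (fun e => by
          rw [← e] at hv
          exact hv.2.not_gt (hcv u h0 h1).1) h.symm)
    · intro u v huv h
      have hu : u = 0 ∨ u = 1 := by
        by_contra! hh
        exact hn u hh.1 hh.2 (hinj _ _ (hci.ne huv) h)
      have hv : v = 0 ∨ v = 1 := by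
        by_contra! hh
        exact hn v hh.1 hh.2 (hinj _ _ (hci.ne huv.symm) h.symm)
      have : γ t ∈ K ∪ γ '' Icc 0 t := .inr ⟨t, ⟨t.2.1, le_rfl⟩, rfl⟩
      rcases hu with rfl | rfl
      · simpa using this
      · rcases hv with rfl | rfl
        · rw [h]
          simpa using this
        · exact absurd rfl huv

theorem continuous_comp_trans {f : ℂ → ℂ} {p q r : ℂ} {a : Path p q} {b : Path q r}
    (ha : Continuous fun t => f (a t)) (hb : Continuous fun t => f (b t)) :
    Continuous fun t => f ((a.trans b) t) := by
  refine (join_continuous ha hb (by simp)).congr fun t => ?_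
  rw [Path.trans_apply]
  unfold join
  split_ifs <;> rfl

theorem continuous_comp_symm {f : ℂ → ℂ} {p q : ℂ} {a : Path p q}
    (ha : Continuous fun t => f (a t)) : Continuous fun t => f (a.symm t) :=
  ha.comp unitInterval.continuous_symm

theorem trans_mem {X : Set ℂ} {p q r : ℂ} {a : Path p q} {b : Path q r} (ha : ∀ t, a t ∈ X)
    (hb : ∀ t, b t ∈ X) (t : I) : (a.trans b) t ∈ X := by
  have h1 : (a.trans b) t ∈ range a ∪ range b := Path.trans_range a b ▸ mem_range_self t
  rcases h1 with ⟨u, hu⟩ | ⟨u, hu⟩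
  exacts [hu ▸ ha u, hu ▸ hb u]

theorem Tree.notMem {T : Set ℂ} {x : ℂ} {K : Set ℂ} {g : ℂ → ℂ → ℂ} (h : Tree T x K g) {z : ℂ}
    (hz : z ∈ K) : z ∉ T := fun hT => by
  have := h.exp_eq z hT z hz
  rw [sub_self] at this
  exact Complex.exp_ne_zero _ this

theorem Tree.isPreconnected {T : Set ℂ} {x : ℂ} {K : Set ℂ} {g : ℂ → ℂ → ℂ} (h : Tree T x K g) :
    IsPreconnected K := by
  refine isPreconnected_of_forall x fun p hp => ?_
  obtain ⟨E, hE, -⟩ := h.exists_path p hp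
  exact ⟨range E, range_subset_iff.2 hE, ⟨0, E.source⟩, ⟨1, E.target⟩,
    isPreconnected_range E.continuous⟩

theorem Tree.joinedBy {T : Set ℂ} {x : ℂ} {K : Set ℂ} {g : ℂ → ℂ → ℂ} (h : Tree T x K g)
    {f : ℂ → ℂ} (hf : ∀ (p : ℂ) (E : Path x p), (∀ τ ∈ T, Continuous fun t => g τ (E t)) →
      Continuous fun t => f (E t)) : JoinedBy K f := by
  intro p hp q hq
  obtain ⟨E, hE, hE'⟩ := h.exists_path p hp
  obtain ⟨D, hD, hD'⟩ := h.exists_path q hq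
  exact ⟨E.symm.trans D, trans_mem (fun t => hE _) hD,
    continuous_comp_trans (continuous_comp_symm (hf _ _ hE')) (hf _ _ hD')⟩

/-- A tree on a compact set `K`, where the points of `T` lie in different bounded faces of `K`. -/
structure Frame (T : Set ℂ) (x : ℂ) (K : Set ℂ) (g : ℂ → ℂ → ℂ) : Prop extends Tree T x K g where
  finite : T.Finite
  compact : IsCompact K
  bounded : ∀ t ∈ T, Bornology.IsBounded (comp K t)
  inj : ∀ t ∈ T, ∀ t' ∈ T, t' ∈ comp K t → t = t'

theorem disjoint_comp {K : Set ℂ} {s t : ℂ} (h : s ∉ comp K t) :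
    Disjoint (comp K s) (comp K t) := by
  by_cases hs : s ∈ K
  · rw [comp, connectedComponentIn_eq_empty (show s ∉ Kᶜ from not_not_intro hs)]
    exact empty_disjoint _
  rw [Set.disjoint_left]
  intro z h1 h2
  refine h ?_
  rw [show comp K t = comp K s from
    (connectedComponentIn_eq h2).trans (connectedComponentIn_eq h1).symm]
  exact mem_connectedComponentIn hs

/-- The complement of a face of a connected set is connected. -/
theorem isPreconnected_compl_comp {K : Set ℂ} (hK : IsClosed K) (hc : IsPreconnected K) {x : ℂ}
    (hx : x ∈ K) (t : ℂ) : IsPreconnected (comp K t)ᶜ := by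
  have hKt : ∀ z ∈ K, z ∈ (comp K t)ᶜ := fun z hz h => connectedComponentIn_subset _ _ h hz
  refine isPreconnected_of_forall x fun y hy => ?_
  by_cases hyK : y ∈ K
  · exact ⟨K, hKt, hx, hyK, hc⟩
  have hyc : y ∈ comp K y := mem_connectedComponentIn hyK
  have hcl : closure (comp K y) ⊆ comp K y ∪ K := by
    rw [closure_eq_self_union_frontier]
    exact union_subset_union_right _ (frontier_comp hK y)
  obtain ⟨z, hz⟩ : (frontier (comp K y)).Nonempty := by
    by_contra h
    have h1 := isClopen_iff_frontier_eq_empty.2 (not_nonempty_iff_eq_empty.1 h)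
    rcases isClopen_iff.1 h1 with h1 | h1
    · rw [h1] at hyc
      exact hyc
    · exact connectedComponentIn_subset _ _ (h1 ▸ mem_univ x : x ∈ comp K y) hx
  have hzK := frontier_comp hK y hz
  refine ⟨K ∪ closure (comp K y), union_subset hKt (hcl.trans (union_subset ?_ hKt)), .inl hx,
    .inr (subset_closure hyc), hc.union z hzK (frontier_subset_closure hz)
      isPreconnected_connectedComponentIn.closure⟩
  exact fun w hw hw' => (disjoint_comp hy).le_bot ⟨hw, hw'⟩

theorem wnd_loop_eq {K : Set ℂ} (hK : IsClosed K) (hc : IsPreconnected K) {x : ℂ}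
    (hx : x ∈ K) {y p : ℂ} {f : Path p p} (hf : ∀ t, f t ∈ comp K y) {τ τ' : ℂ} (h : τ ∉ comp K y)
    (h' : τ' ∉ comp K y) : wnd τ f = wnd τ' f :=
  wnd_eq_of_preconnected (isPreconnected_compl_comp hK hc hx y) f (fun t h => h (hf t)) h h'

theorem wnd_loop_eq_zero {K : Set ℂ} (hK : IsClosed K) (hc : IsPreconnected K) {x : ℂ}
    (hx : x ∈ K) {y p : ℂ} {f : Path p p} (hf : ∀ t, f t ∈ comp K y) {τ : ℂ} (h : τ ∉ comp K y)
    (hb : Bornology.IsBounded (comp K y)) : wnd τ f = 0 := by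
  refine wnd_eq_zero_of_unbounded (isPreconnected_compl_comp hK hc hx y) (fun h' => ?_) f
    (fun t h => h (hf t)) h
  have := hb.union h'
  rw [union_compl_self] at this
  exact NormedSpace.unbounded_univ ℝ ℂ this

/-- A path with endpoints on `K` and interior off `K`. -/
structure Piece (T K : Set ℂ) where
  /-- The source. -/
  p : ℂ
  /-- The target. -/
  q : ℂ
  /-- The path. -/
  a : Path p q
  source : p ∈ K
  target : q ∈ K
  avoids : Avoids T a
  interior : ∀ t, t ≠ 0 → t ≠ 1 → a t ∉ K

/-- The midpoint of the unit interval. -/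
noncomputable def half : I := ⟨1 / 2, by norm_num, by norm_num⟩

theorem half_ne_zero : half ≠ 0 := fun h => by
  have := congrArg Subtype.val h
  norm_num [half] at this

theorem half_ne_one : half ≠ 1 := fun h => by
  have := congrArg Subtype.val h
  norm_num [half] at this

/-- The face of `K` containing the interior of the piece. -/
def Piece.face {T K : Set ℂ} (b : Piece T K) : Set ℂ := comp K (b.a half)

theorem Piece.mem_face {T K : Set ℂ} (b : Piece T K) {t : I} (h0 : t ≠ 0) (h1 : t ≠ 1) :
    b.a t ∈ b.face := by
  have hI : ∀ s : I, s ∈ Ioo (0 : I) 1 ↔ s ≠ 0 ∧ s ≠ 1 := fun s => by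
    rw [mem_Ioo, unitInterval.pos_iff_ne_zero, unitInterval.lt_one_iff_ne_one]
  refine (isPreconnected_Ioo (a := (0 : I)) (b := 1)).image b.a b.a.continuous.continuousOn
    |>.subset_connectedComponentIn (F := Kᶜ)
    ⟨half, (hI _).2 ⟨half_ne_zero, half_ne_one⟩, rfl⟩ ?_ ⟨t, (hI _).2 ⟨h0, h1⟩, rfl⟩
  rintro - ⟨s, hs, rfl⟩
  exact b.interior s ((hI s).1 hs).1 ((hI s).1 hs).2

theorem convexComb_ne {u v : I} (hu0 : u ≠ 0) (hu1 : u ≠ 1) (hv0 : v ≠ 0) (hv1 : v ≠ 1) (t : I) :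
    Set.Icc.convexComb u v t ≠ 0 ∧ Set.Icc.convexComb u v t ≠ 1 := by
  have h1 : (0 : ℝ) < u := unitInterval.pos_iff_ne_zero.2 hu0
  have h2 : (u : ℝ) < 1 := unitInterval.lt_one_iff_ne_one.2 hu1
  have h3 : (0 : ℝ) < v := unitInterval.pos_iff_ne_zero.2 hv0
  have h4 : (v : ℝ) < 1 := unitInterval.lt_one_iff_ne_one.2 hv1
  have h5 := t.2.1
  have h6 := t.2.2
  constructor
  · intro h
    have := congrArg Subtype.val h
    rw [Set.Icc.coe_convexComb] at this
    simp only [Icc.coe_zero] at this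
    rcases le_total (u : ℝ) v with h7 | h7
    · nlinarith [mul_nonneg h5 (sub_nonneg.2 h7)]
    · nlinarith [mul_nonneg (sub_nonneg.2 h6) (sub_nonneg.2 h7)]
  · intro h
    have := congrArg Subtype.val h
    rw [Set.Icc.coe_convexComb] at this
    simp only [Icc.coe_one] at this
    rcases le_total (u : ℝ) v with h7 | h7
    · nlinarith [mul_nonneg (sub_nonneg.2 h6) (sub_nonneg.2 h7)]
    · nlinarith [mul_nonneg h5 (sub_nonneg.2 h7)]

/-- The closed loop cut out by a self-crossing of a piece lies in its face. -/
theorem Piece.exists_loop {T K : Set ℂ} (b : Piece T K) {u v : I} (hu0 : u ≠ 0) (hu1 : u ≠ 1)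
    (hv0 : v ≠ 0) (hv1 : v ≠ 1) (h : b.a u = b.a v) :
    ∃ f : Path (b.a u) (b.a u), (∀ t, f t ∈ b.face) ∧ ∀ τ L, LogAlong (fun z => z - τ) b.a L →
      wnd τ f = L v - L u := by
  refine ⟨(b.a.subpath u v).cast rfl h, fun t => ?_, fun τ L hL => ?_⟩
  · exact b.mem_face (convexComb_ne hu0 hu1 hv0 hv1 t).1 (convexComb_ne hu0 hu1 hv0 hv1 t).2
  · rw [← wnd_subpath hL u v]
    have h1 := hL.subpath u v
    rw [wnd_eq h1, wnd_eq (show LogAlong _ ((b.a.subpath u v).cast rfl h) _ from h1)]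

theorem Frame.log_eq {T : Set ℂ} {x : ℂ} {K : Set ℂ} {g : ℂ → ℂ → ℂ} (h : Frame T x K g)
    (b : Piece T K) {τ : ℂ} (hb : Bornology.IsBounded b.face) (hτ : τ ∉ b.face) {L : I → ℂ}
    (hL : LogAlong (fun z => z - τ) b.a L) {u v : I} (hu0 : u ≠ 0) (hu1 : u ≠ 1)
    (hv0 : v ≠ 0) (hv1 : v ≠ 1) (huv : b.a u = b.a v) : L u = L v := by
  obtain ⟨f, hf, hf'⟩ := b.exists_loop hu0 hu1 hv0 hv1 huv
  have h1 := hf' τ L hL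
  rw [wnd_loop_eq_zero h.compact.isClosed h.isPreconnected h.mem hf hτ hb] at h1
  linear_combination h1

theorem Frame.log_sub_eq {T : Set ℂ} {x : ℂ} {K : Set ℂ} {g : ℂ → ℂ → ℂ} (h : Frame T x K g)
    (b : Piece T K) {τ τ' : ℂ} (hτ : τ ∉ b.face) (hτ' : τ' ∉ b.face) {L L' : I → ℂ}
    (hL : LogAlong (fun z => z - τ) b.a L) (hL' : LogAlong (fun z => z - τ') b.a L') {u v : I}
    (hu0 : u ≠ 0) (hu1 : u ≠ 1) (hv0 : v ≠ 0) (hv1 : v ≠ 1) (huv : b.a u = b.a v) :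
    L u - L' u = L v - L' v := by
  obtain ⟨f, hf, hf'⟩ := b.exists_loop hu0 hu1 hv0 hv1 huv
  have h1 := hf' τ L hL
  rw [wnd_loop_eq h.compact.isClosed h.isPreconnected h.mem hf hτ hτ', hf' τ' L' hL'] at h1
  linear_combination h1

/-- The degree of a piece about `τ`, relative to the logarithm `g τ` on `K`. -/
noncomputable def Piece.deg {T K : Set ℂ} (g : ℂ → ℂ → ℂ) (τ : ℂ) (b : Piece T K) : ℤ :=
  open Classical in
  if h : ∃ k : ℤ, wnd τ b.a = g τ b.q - g τ b.p + 2 * Real.pi * Complex.I * k then h.choose else 0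

theorem Tree.wnd_piece {T : Set ℂ} {x : ℂ} {K : Set ℂ} {g : ℂ → ℂ → ℂ} (h : Tree T x K g)
    (b : Piece T K) {τ : ℂ} (hτ : τ ∈ T) :
    wnd τ b.a = g τ b.q - g τ b.p + 2 * Real.pi * Complex.I * b.deg g τ := by
  have hk : ∃ k : ℤ, wnd τ b.a = g τ b.q - g τ b.p + 2 * Real.pi * Complex.I * k := by
    have h1 := exp_wnd b.a (fun t e => b.avoids t (e ▸ hτ))
    rw [← h.exp_eq τ hτ _ b.source, ← h.exp_eq τ hτ _ b.target, ← Complex.exp_sub,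
      Complex.exp_eq_exp_iff_exists_int] at h1
    obtain ⟨k, hk⟩ := h1
    exact ⟨k, by rw [hk]; ring⟩
  unfold Piece.deg
  rw [dif_pos hk]
  exact hk.choose_spec

theorem Tree.exists_log_piece {T : Set ℂ} {x : ℂ} {K : Set ℂ} {g : ℂ → ℂ → ℂ} (h : Tree T x K g)
    (b : Piece T K) {τ : ℂ} (hτ : τ ∈ T) : ∃ L, LogAlong (fun z => z - τ) b.a L ∧ L 0 = g τ b.p ∧
      L 1 = g τ b.q + 2 * Real.pi * Complex.I * b.deg g τ := by
  obtain ⟨L, hL⟩ := exists_logAlong b.a τ (fun t e => b.avoids t (e ▸ hτ))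
  have h1 := h.wnd_piece b hτ
  rw [wnd_eq hL] at h1
  refine ⟨fun t => L t + (g τ b.p - L 0), hL.add_const ?_, by ring, by linear_combination h1⟩
  have h2 := hL.2 0
  simp only [b.a.source] at h2
  rw [Complex.exp_sub, h.exp_eq τ hτ _ b.source, h2, div_self]
  exact sub_ne_zero.2 fun e => h.notMem b.source (e ▸ hτ)

theorem Frame.abs_deg_le_one {T : Set ℂ} {x : ℂ} {K : Set ℂ} {g : ℂ → ℂ → ℂ} (h : Frame T x K g)
    (b : Piece T K) {τ : ℂ} (hτT : τ ∈ T) (hb : Bornology.IsBounded b.face) (hτ : τ ∉ b.face) :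
    |b.deg g τ| ≤ 1 := by
  obtain ⟨L, hL, h0, h1⟩ := h.exists_log_piece b hτT
  exact abs_le_one_of_descends (h.joinedBy fun p E hE => hE τ hτT) (h.exp_eq τ hτT) b.source
    b.target b.interior (fun z _ w _ e => sub_left_injective e) hL h0 h1
    fun u v hu0 hu1 hv0 hv1 e => h.log_eq b hb hτ hL hu0 hu1 hv0 hv1 e

theorem injOn_ratio {X : Set ℂ} {τ τ' : ℂ} (hne : τ ≠ τ') (hX : τ' ∉ X) :
    InjOn (fun z => (z - τ) / (z - τ')) X := by
  intro z hz w hw e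
  have h1 : z - τ' ≠ 0 := sub_ne_zero.2 fun e => hX (e ▸ hz)
  have h2 : w - τ' ≠ 0 := sub_ne_zero.2 fun e => hX (e ▸ hw)
  have h3 : (z - τ) / (z - τ') = (w - τ) / (w - τ') := e
  rw [div_eq_div_iff h1 h2] at h3
  have h4 : (z - w) * (τ - τ') = 0 := by linear_combination h3
  exact sub_eq_zero.1 ((mul_eq_zero.1 h4).resolve_right (sub_ne_zero.2 hne))

theorem Frame.abs_deg_sub_le_one {T : Set ℂ} {x : ℂ} {K : Set ℂ} {g : ℂ → ℂ → ℂ}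
    (h : Frame T x K g) (b : Piece T K) {τ τ' : ℂ} (hτT : τ ∈ T) (hτT' : τ' ∈ T)
    (hτ : τ ∉ b.face) (hτ' : τ' ∉ b.face) : |b.deg g τ - b.deg g τ'| ≤ 1 := by
  rcases eq_or_ne τ τ' with rfl | hne
  · simp
  obtain ⟨L, hL, h0, h1⟩ := h.exists_log_piece b hτT
  obtain ⟨M, hM, h0', h1'⟩ := h.exists_log_piece b hτT'
  refine abs_le_one_of_descends (K := K) (g := fun z => g τ z - g τ' z)
    (φ := fun z => (z - τ) / (z - τ')) (h.joinedBy fun p E hE => (hE τ hτT).sub (hE τ' hτT'))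
    (fun z hz => by rw [Complex.exp_sub, h.exp_eq τ hτT z hz, h.exp_eq τ' hτT' z hz]) b.source
    b.target b.interior (injOn_ratio hne ?_) (hL.div hM) (by rw [h0, h0'])
    (by rw [h1, h1']; push_cast; ring) fun u v hu0 hu1 hv0 hv1 e =>
      h.log_sub_eq b hτ hτ' hL hM hu0 hu1 hv0 hv1 e
  rintro (h1 | ⟨t, rfl⟩)
  exacts [h.notMem h1 hτT', b.avoids t hτT']

theorem exists_glue {T K : Set ℂ} {b b' : Piece T K} {G : ℂ → ℂ} {L L' : I → ℂ}
    (h0 : L 0 = G b.p) (h1 : L 1 = G b.q) (h0' : L' 0 = G b'.p) (h1' : L' 1 = G b'.q)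
    (hb : ∀ u v, u ≠ 0 → u ≠ 1 → v ≠ 0 → v ≠ 1 → b.a u = b.a v → L u = L v)
    (hb' : ∀ u v, u ≠ 0 → u ≠ 1 → v ≠ 0 → v ≠ 1 → b'.a u = b'.a v → L' u = L' v)
    (hbb' : ∀ u v, u ≠ 0 → u ≠ 1 → v ≠ 0 → v ≠ 1 → b.a u = b'.a v → L u = L' v) :
    ∃ h : ℂ → ℂ, (∀ z ∈ K, h z = G z) ∧ (∀ t, h (b.a t) = L t) ∧ ∀ t, h (b'.a t) = L' t := by
  classical
  have hne : ∀ (b : Piece T K) t, b.a t ∉ K → t ≠ 0 ∧ t ≠ 1 := fun b t ht =>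
    ⟨fun e => ht (by rw [e, b.a.source]; exact b.source),
      fun e => ht (by rw [e, b.a.target]; exact b.target)⟩
  have hin : ∀ (b : Piece T K) t, b.a t ∈ K → t = 0 ∨ t = 1 := fun b t ht => by
    by_contra! hh
    exact b.interior t hh.1 hh.2 ht
  refine ⟨fun z => if z ∈ K then G z else if hz : ∃ t, b.a t = z then L hz.choose else
    if hz : ∃ t, b'.a t = z then L' hz.choose else 0, fun z hz => if_pos hz, fun t => ?_,
    fun t => ?_⟩
  · by_cases hK : b.a t ∈ K
    · simp only [hK, if_true]
      rcases hin b t hK with rfl | rfl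
      · rw [b.a.source, h0]
      · rw [b.a.target, h1]
    · have hz : ∃ t', b.a t' = b.a t := ⟨t, rfl⟩
      simp only [hK, if_false, dif_pos hz]
      have h2 := hne b _ (hz.choose_spec ▸ hK)
      exact hb _ _ h2.1 h2.2 (hne b t hK).1 (hne b t hK).2 hz.choose_spec
  · by_cases hK : b'.a t ∈ K
    · simp only [hK, if_true]
      rcases hin b' t hK with rfl | rfl
      · rw [b'.a.source, h0']
      · rw [b'.a.target, h1']
    · by_cases hz : ∃ t', b.a t' = b'.a t
      · simp only [hK, if_false, dif_pos hz]
        have h2 := hne b _ (hz.choose_spec ▸ hK)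
        exact hbb' _ _ h2.1 h2.2 (hne b' t hK).1 (hne b' t hK).2 hz.choose_spec
      · have hz' : ∃ t', b'.a t' = b'.a t := ⟨t, rfl⟩
        simp only [hK, if_false, dif_neg hz, dif_pos hz']
        have h2 := hne b' _ (hz'.choose_spec ▸ hK)
        exact hb' _ _ h2.1 h2.2 (hne b' t hK).1 (hne b' t hK).2 hz'.choose_spec

section

variable {T : Set ℂ} {x : ℂ} {K : Set ℂ} {g : ℂ → ℂ → ℂ}

/-- The chosen path in `K` from the base point. -/
noncomputable def Tree.path (h : Tree T x K g) {p : ℂ} (hp : p ∈ K) : Path x p :=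
  (h.exists_path p hp).choose

theorem Tree.path_mem (h : Tree T x K g) {p : ℂ} (hp : p ∈ K) (t : I) : h.path hp t ∈ K :=
  (h.exists_path p hp).choose_spec.1 t

theorem Tree.path_continuous (h : Tree T x K g) {p : ℂ} (hp : p ∈ K) {τ : ℂ} (hτ : τ ∈ T) :
    Continuous fun t => g τ (h.path hp t) :=
  (h.exists_path p hp).choose_spec.2 τ hτ

theorem Tree.path_avoids (h : Tree T x K g) {p : ℂ} (hp : p ∈ K) : Avoids T (h.path hp) :=
  fun t => h.notMem (h.path_mem hp t)

theorem Tree.wnd_path (h : Tree T x K g) {p : ℂ} (hp : p ∈ K) {τ : ℂ} (hτ : τ ∈ T) :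
    wnd τ (h.path hp) = g τ p - g τ x := by
  rw [wnd_eq ⟨h.path_continuous hp hτ, fun t => h.exp_eq τ hτ _ (h.path_mem hp t)⟩]
  simp

/-- The loop closing up a piece. -/
noncomputable def Tree.loop (h : Tree T x K g) (b : Piece T K) : Path x x :=
  ((h.path b.source).trans b.a).trans (h.path b.target).symm

theorem avoids_trans {p q r : ℂ} {a : Path p q} {b : Path q r} (ha : Avoids T a)
    (hb : Avoids T b) : Avoids T (a.trans b) :=
  trans_mem (X := Tᶜ) ha hb

theorem Avoids.symm {p q : ℂ} {a : Path p q} (ha : Avoids T a) : Avoids T a.symm := fun _ => ha _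

theorem Tree.loop_avoids (h : Tree T x K g) (b : Piece T K) : Avoids T (h.loop b) :=
  avoids_trans (avoids_trans (h.path_avoids _) b.avoids) (h.path_avoids _).symm

theorem Tree.wnd_loop (h : Tree T x K g) (b : Piece T K) {τ : ℂ} (hτ : τ ∈ T) :
    wnd τ (h.loop b) = 2 * Real.pi * Complex.I * b.deg g τ := by
  have hne : ∀ {p q : ℂ} {a : Path p q}, Avoids T a → ∀ t, a t ≠ τ := fun ha t e => ha t (e ▸ hτ)
  rw [Tree.loop, wnd_trans _ _ (hne (avoids_trans (h.path_avoids _) b.avoids))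
    (hne (h.path_avoids _).symm), wnd_trans _ _ (hne (h.path_avoids _)) (hne b.avoids),
    wnd_symm _ (hne (h.path_avoids _)), h.wnd_path _ hτ, h.wnd_path _ hτ, h.wnd_piece b hτ]
  ring

/-- The holonomy of a piece. -/
noncomputable def Holonomy.val (H : Holonomy T) (h : Tree T x K g) (b : Piece T K) : H.G :=
  H.cls (h.loop b)

theorem Tree.hasLog_loops (h : Tree T x K g) {b b' : Piece T K} {f G : ℂ → ℂ} {L L' : I → ℂ}
    (hG : ∀ (p : ℂ) (E : Path x p), (∀ τ ∈ T, Continuous fun t => g τ (E t)) →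
      Continuous fun t => G (E t)) (he : ∀ z ∈ K, Complex.exp (G z) = f z)
    (hL : LogAlong f b.a L) (hL' : LogAlong f b'.a L')
    (h0 : L 0 = G b.p) (h1 : L 1 = G b.q) (h0' : L' 0 = G b'.p) (h1' : L' 1 = G b'.q)
    (hb : ∀ u v, u ≠ 0 → u ≠ 1 → v ≠ 0 → v ≠ 1 → b.a u = b.a v → L u = L v)
    (hb' : ∀ u v, u ≠ 0 → u ≠ 1 → v ≠ 0 → v ≠ 1 → b'.a u = b'.a v → L' u = L' v)
    (hbb' : ∀ u v, u ≠ 0 → u ≠ 1 → v ≠ 0 → v ≠ 1 → b.a u = b'.a v → L u = L' v) :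
    HasLog (range (h.loop b) ∪ range (h.loop b')) f := by
  obtain ⟨k, hk, hkb, hkb'⟩ := exists_glue h0 h1 h0' h1' hb hb' hbb'
  have key : ∀ (c : Piece T K) (M : I → ℂ), LogAlong f c.a M → (∀ t, k (c.a t) = M t) →
      Continuous (k ∘ h.loop c) ∧ ∀ t, Complex.exp (k (h.loop c t)) = f (h.loop c t) := by
    intro c M hM hkc
    have h2 : ∀ p (hp : p ∈ K), Continuous fun t => k (h.path hp t) := fun p hp =>
      (hG p (h.path hp) fun τ hτ => h.path_continuous hp hτ).congr
        fun t => (hk _ (h.path_mem hp t)).symm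
    have h3 : ∀ p (hp : p ∈ K) t, h.path hp t ∈ {z | Complex.exp (k z) = f z} := fun p hp t => by
      rw [mem_ofPred, hk _ (h.path_mem hp t), he _ (h.path_mem hp t)]
    exact ⟨continuous_comp_trans (continuous_comp_trans (h2 _ c.source)
      (hM.1.congr fun t => (hkc t).symm)) (continuous_comp_symm (h2 _ c.target)),
      trans_mem (X := {z | Complex.exp (k z) = f z}) (trans_mem (h3 _ c.source)
        fun t => by rw [mem_ofPred, hkc, hM.2]) fun t => h3 _ c.target _⟩
  exact hasLog_of_comp (h.loop b).continuous (h.loop b').continuous (key b L hL hkb).1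
    (key b' L' hL' hkb').1 (key b L hL hkb).2 (key b' L' hL' hkb').2

theorem Frame.not_mem_of_unbounded (h : Frame T x K g) {y : ℂ}
    (hb : ¬ Bornology.IsBounded (comp K y)) {τ : ℂ} (hτ : τ ∈ T) : τ ∉ comp K y := fun hy =>
  hb (show Bornology.IsBounded (connectedComponentIn Kᶜ y) from
    (connectedComponentIn_eq hy) ▸ h.bounded τ hτ)

theorem Frame.eq_of_mem (h : Frame T x K g) {y τ τ' : ℂ} (hτ : τ ∈ T) (hτ' : τ' ∈ T)
    (hy : τ ∈ comp K y) (hy' : τ' ∈ comp K y) : τ = τ' := by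
  refine h.inj τ hτ τ' hτ' ?_
  have : comp K y = comp K τ := connectedComponentIn_eq hy
  rwa [← this]

/-- A piece of degree zero about all points has trivial holonomy. -/
theorem Frame.val_eq_one (H : Holonomy T) (h : Frame T x K g) (b : Piece T K)
    (hd : ∀ τ ∈ T, b.deg g τ = 0) : H.val h.toTree b = 1 := by
  have hx : Avoids T (Path.refl x) := fun _ => h.notMem h.mem
  have h1 : H.cls (Path.refl x) = 1 := by
    have := H.trans (Path.refl x) (Path.refl x) hx hx
    rwa [Path.refl_trans_refl, left_eq_mul] at this
  rw [← h1]
  have hX : ∀ t, h.loop b t ∈ range (h.loop b) ∪ range (h.loop b) := fun t => .inl ⟨t, rfl⟩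
  have hXT : ∀ z ∈ range (h.loop b) ∪ range (h.loop b), z ∉ T := by
    rintro z (⟨t, rfl⟩ | ⟨t, rfl⟩) <;> exact h.loop_avoids b t
  refine (H.eq_iff _ _ (h.loop_avoids b) hx).2 ?_
  refine homT_of_hasLog (X := range (h.loop b) ∪ range (h.loop b))
    ((isCompact_range (h.loop b).continuous).union (isCompact_range (h.loop b).continuous))
    h.finite hXT hX
    (fun s => .inl ⟨0, by simp⟩) (fun τ hτ => ?_)
    (fun τ => Bornology.IsBounded b.face ∧ τ ∉ b.face) (fun τ hτ hP => ?_)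
    fun τ hτ τ' hτ' hP hP' => ?_
  · rw [h.wnd_loop b hτ, hd τ hτ]
    have := wnd_symm (Path.refl x) (τ := τ) (fun t e => hx t (e ▸ hτ))
    rw [Path.refl_symm] at this
    simp [self_eq_neg.1 this]
  · obtain ⟨L, hL, h0, h1⟩ := h.exists_log_piece b hτ
    rw [hd τ hτ] at h1
    have hc := fun u v hu0 hu1 hv0 hv1 e =>
      h.log_eq b hP.1 hP.2 hL (u := u) (v := v) hu0 hu1 hv0 hv1 e
    exact h.hasLog_loops (fun p E hE => hE τ hτ) (h.exp_eq τ hτ) hL hL h0 (by simpa using h1) h0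
      (by simpa using h1) hc hc hc
  · by_cases hb : Bornology.IsBounded b.face
    · have h2 : τ = τ' := h.eq_of_mem hτ hτ' (by by_contra hh; exact hP ⟨hb, hh⟩)
        (by by_contra hh; exact hP' ⟨hb, hh⟩)
      subst h2
      refine ⟨fun _ => 0, continuousOn_const, fun z hz => ?_⟩
      rw [Complex.exp_zero]
      exact (div_self (sub_ne_zero.2 fun e : z = τ => hXT z hz (e ▸ hτ))).symm
    · obtain ⟨L, hL, h0, h1⟩ := h.exists_log_piece b hτ
      obtain ⟨M, hM, h0', h1'⟩ := h.exists_log_piece b hτ'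
      rw [hd τ hτ] at h1
      rw [hd τ' hτ'] at h1'
      have hc := fun u v hu0 hu1 hv0 hv1 e =>
        h.log_sub_eq b (h.not_mem_of_unbounded hb hτ) (h.not_mem_of_unbounded hb hτ') hL hM
          (u := u) (v := v) hu0 hu1 hv0 hv1 e
      exact h.hasLog_loops (G := fun z => g τ z - g τ' z) (fun p E hE => (hE τ hτ).sub (hE τ' hτ'))
        (fun z hz => by rw [Complex.exp_sub, h.exp_eq τ hτ z hz, h.exp_eq τ' hτ' z hz])
        (hL.div hM) (hL.div hM) (by rw [h0, h0']) (by rw [h1, h1']; simp) (by rw [h0, h0'])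
        (by rw [h1, h1']; simp) hc hc hc

/-- Pieces in different unpunctured faces with equal degrees have the same holonomy. -/
theorem Frame.val_eq_of_disjoint (H : Holonomy T) (h : Frame T x K g) {b b' : Piece T K}
    (hb : Bornology.IsBounded b.face) (hb' : Bornology.IsBounded b'.face)
    (hT : ∀ τ ∈ T, τ ∉ b.face) (hT' : ∀ τ ∈ T, τ ∉ b'.face) (hbb' : Disjoint b.face b'.face)
    (hd : ∀ τ ∈ T, b.deg g τ = b'.deg g τ) : H.val h.toTree b = H.val h.toTree b' := by
  have hXT : ∀ z ∈ range (h.loop b) ∪ range (h.loop b'), z ∉ T := by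
    rintro z (⟨t, rfl⟩ | ⟨t, rfl⟩)
    exacts [h.loop_avoids b t, h.loop_avoids b' t]
  have hdis : ∀ (L L' : I → ℂ) u v, u ≠ 0 → u ≠ 1 → v ≠ 0 → v ≠ 1 → b.a u = b'.a v → L u = L' v :=
    fun L L' u v hu0 hu1 hv0 hv1 e => by
      have h1 := b.mem_face hu0 hu1
      rw [e] at h1
      exact absurd (b'.mem_face hv0 hv1) (Set.disjoint_left.1 hbb' h1)
  refine (H.eq_iff _ _ (h.loop_avoids b) (h.loop_avoids b')).2 ?_
  refine homT_of_hasLog (X := range (h.loop b) ∪ range (h.loop b'))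
    ((isCompact_range (h.loop b).continuous).union (isCompact_range (h.loop b').continuous))
    h.finite hXT (fun t => .inl ⟨t, rfl⟩) (fun t => .inr ⟨t, rfl⟩)
    (fun τ hτ => by rw [h.wnd_loop b hτ, h.wnd_loop b' hτ, hd τ hτ])
    (fun τ => b.deg g τ = 0) (fun τ hτ hP => ?_) fun τ hτ τ' hτ' hP hP' => ?_
  · obtain ⟨L, hL, h0, h1⟩ := h.exists_log_piece b hτ
    obtain ⟨L', hL', h0', h1'⟩ := h.exists_log_piece b' hτ
    rw [hP] at h1
    rw [← hd τ hτ, hP] at h1'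
    exact h.hasLog_loops (fun p E hE => hE τ hτ) (h.exp_eq τ hτ) hL hL' h0 (by simpa using h1) h0'
      (by simpa using h1') (fun u v hu0 hu1 hv0 hv1 e => h.log_eq b hb (hT τ hτ) hL hu0 hu1 hv0
          hv1 e)
      (fun u v hu0 hu1 hv0 hv1 e => h.log_eq b' hb' (hT' τ hτ) hL' hu0 hu1 hv0 hv1 e) (hdis L L')
  · have hk : b.deg g τ = b.deg g τ' := by
      have h1 := abs_le.1 (h.abs_deg_le_one b hτ hb (hT τ hτ))
      have h2 := abs_le.1 (h.abs_deg_le_one b hτ' hb (hT τ' hτ'))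
      have h3 := abs_le.1 (h.abs_deg_sub_le_one b hτ hτ' (hT τ hτ) (hT τ' hτ'))
      omega
    obtain ⟨L, hL, h0, h1⟩ := h.exists_log_piece b hτ
    obtain ⟨L', hL', h0', h1'⟩ := h.exists_log_piece b' hτ
    obtain ⟨M, hM, k0, k1⟩ := h.exists_log_piece b hτ'
    obtain ⟨M', hM', k0', k1'⟩ := h.exists_log_piece b' hτ'
    rw [← hd τ hτ] at h1'
    rw [← hd τ' hτ', ← hk] at k1'
    rw [← hk] at k1
    exact h.hasLog_loops (G := fun z => g τ z - g τ' z) (fun p E hE => (hE τ hτ).sub (hE τ' hτ'))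
      (fun z hz => by rw [Complex.exp_sub, h.exp_eq τ hτ z hz, h.exp_eq τ' hτ' z hz])
      (hL.div hM) (hL'.div hM') (by rw [h0, k0]) (by rw [h1, k1]; ring) (by rw [h0', k0'])
      (by rw [h1', k1']; ring)
      (fun u v hu0 hu1 hv0 hv1 e =>
        h.log_sub_eq b (hT τ hτ) (hT τ' hτ') hL hM hu0 hu1 hv0 hv1 e)
      (fun u v hu0 hu1 hv0 hv1 e =>
        h.log_sub_eq b' (hT' τ hτ) (hT' τ' hτ') hL' hM' hu0 hu1 hv0 hv1 e)
      (hdis (fun t => L t - M t) fun t => L' t - M' t)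

end

theorem isPreconnected_norm_gt {R : ℝ} (hR : 0 ≤ R) : IsPreconnected {z : ℂ | R < ‖z‖} := by
  have h := (isPreconnected_Ioi (a := R)).prod (isPreconnected_univ (α := ℝ))
  convert h.image (fun x : ℝ × ℝ => (x.1 : ℂ) * Complex.exp (x.2 * Complex.I)) (by fun_prop) using 1
  ext z
  constructor
  · intro hz
    exact ⟨(‖z‖, z.arg), ⟨hz, trivial⟩, Complex.norm_mul_exp_arg_mul_I z⟩
  · rintro ⟨⟨ρ, θ⟩, ⟨h1, -⟩, rfl⟩
    have h2 : R < ρ := h1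
    show R < ‖(ρ : ℂ) * Complex.exp (θ * Complex.I)‖
    rw [norm_mul, Complex.norm_real, Complex.norm_exp_ofReal_mul_I, mul_one,
      Real.norm_of_nonneg (hR.trans h2.le)]
    exact h2

theorem exists_loop_wnd {S : Set ℂ} (hS : IsPathConnected S) {y τ : ℂ} (hy : y ∈ S) (hτ : τ ∉ S)
    {c : ℂ} {R : ℝ} (hR : 0 < R) (hc : ‖τ - c‖ < R) (h : ∀ z, ‖z - c‖ = R → z ∈ S) :
    ∃ l : Path y y, (∀ t, l t ∈ S) ∧ wnd τ l = 2 * Real.pi * Complex.I := by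
  let m : Path (c + R) (c + R) := ⟨⟨fun t => c + circleLoop R t, by fun_prop⟩, by simp, by simp⟩
  have hm : ∀ t, m t ∈ S := fun t => h _ (by
    show ‖c + circleLoop R t - c‖ = R
    rw [add_sub_cancel_left, norm_circleLoop hR])
  have hmw : wnd τ m = 2 * Real.pi * Complex.I := by
    obtain ⟨L, hL⟩ := exists_logAlong (circleLoop R) (τ - c) (fun t e => by
      have := norm_circleLoop hR t
      rw [e] at this
      exact hc.ne this)
    rw [← wnd_circleLoop hR hc, wnd_eq hL]
    refine wnd_eq ⟨hL.1, fun t => ?_⟩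
    rw [hL.2]
    show circleLoop R t - (τ - c) = c + circleLoop R t - τ
    ring
  obtain ⟨d, hd⟩ := hS.joinedIn y hy (c + R) (m.source ▸ hm 0)
  have hne : ∀ {p q : ℂ} {a : Path p q}, (∀ t, a t ∈ S) → ∀ t, a t ≠ τ :=
    fun ha t e => hτ (e ▸ ha t)
  have hds : ∀ t, d.symm t ∈ S := fun t => hd _
  refine ⟨(d.trans m).trans d.symm, trans_mem (trans_mem hd hm) hds, ?_⟩
  rw [wnd_trans _ _ (hne (trans_mem hd hm)) (hne hds), wnd_trans _ _ (hne hd) (hne hm),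
    wnd_symm _ (hne hd), hmw]
  ring

theorem exists_loop_wnd_int {S : Set ℂ} {y τ : ℂ} (hτ : τ ∉ S)
    (h : ∃ l : Path y y, (∀ t, l t ∈ S) ∧ wnd τ l = 2 * Real.pi * Complex.I) (k : ℤ) :
    ∃ l : Path y y, (∀ t, l t ∈ S) ∧ wnd τ l = 2 * Real.pi * Complex.I * k := by
  obtain ⟨l, hl, hw⟩ := h
  have hne : ∀ {a : Path y y}, (∀ t, a t ∈ S) → ∀ t, a t ≠ τ := fun ha t e => hτ (e ▸ ha t)
  have hls : ∀ t, l.symm t ∈ S := fun t => hl _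
  induction k using Int.induction_on with
  | zero =>
    refine ⟨l.trans l.symm, trans_mem hl hls, ?_⟩
    rw [wnd_trans _ _ (hne hl) (hne hls), wnd_symm _ (hne hl)]
    simp
  | succ n ih =>
    obtain ⟨m, hm, hm'⟩ := ih
    refine ⟨m.trans l, trans_mem hm hl, ?_⟩
    rw [wnd_trans _ _ (hne hm) (hne hl), hm', hw]
    push_cast
    ring
  | pred n ih =>
    obtain ⟨m, hm, hm'⟩ := ih
    refine ⟨m.trans l.symm, trans_mem hm hls, ?_⟩
    rw [wnd_trans _ _ (hne hm) (hne hls), wnd_symm _ (hne hl), hm', hw]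
    push_cast
    ring

theorem Holonomy.congr {T : Set ℂ} (H : Holonomy T) {p q p' q' : ℂ} {a : Path p q}
    {b : Path p' q'} (hp : p = p') (hq : q = q') (h : ∀ t, a t = b t) : H.cls a = H.cls b := by
  subst hp hq
  rw [show a = b from Path.ext (funext h)]

/-- A path from `K` to `y` which leaves `K` immediately and stays in the face of `y`. -/
structure Ray (T K : Set ℂ) (y : ℂ) where
  /-- The source. -/
  p : ℂ
  /-- The path. -/
  a : Path p y
  source : p ∈ K
  avoids : Avoids T a
  mem : ∀ t, t ≠ 0 → a t ∈ comp K y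

section

variable {T : Set ℂ} {x : ℂ} {K : Set ℂ} {g : ℂ → ℂ → ℂ} {y : ℂ}

/-- The continued value of the logarithm at the end of a ray. -/
noncomputable def Ray.off (g : ℂ → ℂ → ℂ) (r : Ray T K y) (τ : ℂ) : ℂ := wnd τ r.a + g τ r.p

/-- The holonomy of a ray. -/
noncomputable def Ray.val (H : Holonomy T) (h : Tree T x K g) (r : Ray T K y) : H.G :=
  H.cls (h.path r.source) * H.cls r.a

theorem trans_interior {p q r : ℂ} {a : Path p q} {b : Path q r} {S : Set ℂ}
    (ha : ∀ t, t ≠ 0 → a t ∈ S) (hb : ∀ t, t ≠ 1 → b t ∈ S) (t : I) (h0 : t ≠ 0) (h1 : t ≠ 1) :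
    (a.trans b) t ∈ S := by
  rw [Path.trans_apply]
  split_ifs with h
  · refine ha _ fun e => h0 ?_
    have := congrArg Subtype.val e
    exact Subtype.ext (by simpa using this)
  · refine hb _ fun e => h1 ?_
    have := congrArg Subtype.val e
    simp only [Icc.coe_one] at this
    exact Subtype.ext (by simp only [Icc.coe_one]; linarith)

theorem trans_final {p q r : ℂ} {a : Path p q} {b : Path q r} {S : Set ℂ}
    (ha : ∀ t, t ≠ 0 → a t ∈ S) (hb : ∀ t, b t ∈ S) (t : I) (h0 : t ≠ 0) : (a.trans b) t ∈ S := by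
  rw [Path.trans_apply]
  split_ifs with h
  · refine ha _ fun e => h0 ?_
    have := congrArg Subtype.val e
    exact Subtype.ext (by simpa using this)
  · exact hb _

/-- The piece consisting of one ray followed by the reverse of another. -/
noncomputable def Ray.toPiece (r r' : Ray T K y) : Piece T K where
  p := r.p
  q := r'.p
  a := r.a.trans r'.a.symm
  source := r.source
  target := r'.source
  avoids := avoids_trans r.avoids r'.avoids.symm
  interior := fun t h0 h1 => connectedComponentIn_subset _ _ (trans_interior r.mem
    (fun t ht => r'.mem _ ((symm_ne_zero t).2 ht)) t h0 h1)

theorem Ray.face_toPiece (r r' : Ray T K y) : (r.toPiece r').face = comp K y := by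
  refine (connectedComponentIn_eq ?_).symm
  exact trans_interior r.mem (fun t ht => r'.mem _ ((symm_ne_zero t).2 ht)) half half_ne_zero
    half_ne_one

theorem Ray.deg_toPiece (h : Tree T x K g) (r r' : Ray T K y) {τ : ℂ} (hτ : τ ∈ T) :
    2 * Real.pi * Complex.I * (r.toPiece r').deg g τ = r.off g τ - r'.off g τ := by
  have h1 := h.wnd_piece (r.toPiece r') hτ
  have h2 : wnd τ (r.toPiece r').a = wnd τ r.a + wnd τ r'.a.symm :=
    wnd_trans _ _ (fun t e => r.avoids t (e ▸ hτ)) (fun t e => r'.avoids.symm t (e ▸ hτ))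
  rw [wnd_symm _ (fun t e => r'.avoids t (e ▸ hτ))] at h2
  rw [h2] at h1
  unfold Ray.off
  change _ = g τ r'.p - g τ r.p + _ at h1
  linear_combination -h1

theorem Ray.val_toPiece (H : Holonomy T) (h : Tree T x K g) (r r' : Ray T K y) :
    H.val h (r.toPiece r') = r.val H h * (r'.val H h)⁻¹ := by
  unfold Holonomy.val Tree.loop Ray.val
  have h1 : Avoids T (r.a.trans r'.a.symm) := avoids_trans r.avoids r'.avoids.symm
  rw [H.trans _ _ (avoids_trans (h.path_avoids _) (r.toPiece r').avoids) (h.path_avoids _).symm,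
    H.trans _ _ (h.path_avoids _) (r.toPiece r').avoids, H.symm _ (h.path_avoids _)]
  change _ * H.cls (r.a.trans r'.a.symm) * _ = _
  rw [H.trans _ _ r.avoids r'.avoids.symm, H.symm _ r'.avoids, mul_inv_rev]
  simp only [mul_assoc]
  rfl

theorem Ray.val_eq (H : Holonomy T) (h : Frame T x K g) {r r' : Ray T K y}
    (ho : ∀ τ ∈ T, r.off g τ = r'.off g τ) : r.val H h.toTree = r'.val H h.toTree := by
  have h1 := h.val_eq_one H (r.toPiece r') fun τ hτ => by
    have h2 := r.deg_toPiece h.toTree r' hτ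
    rw [ho τ hτ, sub_self] at h2
    exact two_pi_I_mul_inj (by rw [h2]; simp)
  rw [Ray.val_toPiece] at h1
  exact mul_inv_eq_one.1 h1

/-- A ray followed by a loop. -/
noncomputable def Ray.append (r : Ray T K y) (l : Path y y) (hl : ∀ t, l t ∈ comp K y \ T) :
    Ray T K y where
  p := r.p
  a := r.a.trans l
  source := r.source
  avoids := avoids_trans r.avoids fun t => (hl t).2
  mem := trans_final r.mem fun t => (hl t).1

theorem Ray.off_append (r : Ray T K y) {l : Path y y} (hl : ∀ t, l t ∈ comp K y \ T) {τ : ℂ}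
    (hτ : τ ∈ T) : (r.append l hl).off g τ = r.off g τ + wnd τ l := by
  unfold Ray.off
  have : wnd τ (r.append l hl).a = wnd τ r.a + wnd τ l :=
    wnd_trans _ _ (fun t e => r.avoids t (e ▸ hτ)) fun t e => (hl t).2 (e ▸ hτ)
  rw [this, show (r.append l hl).p = r.p from rfl]
  ring

theorem Ray.val_append (H : Holonomy T) (h : Tree T x K g) (r : Ray T K y) {l : Path y y}
    (hl : ∀ t, l t ∈ comp K y \ T) : (r.append l hl).val H h = r.val H h * H.cls l := by
  have : H.cls (r.append l hl).a = H.cls r.a * H.cls l :=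
    H.trans _ _ r.avoids fun t => (hl t).2
  unfold Ray.val
  rw [this, mul_assoc]
  rfl

theorem Frame.isPathConnected_face (h : Frame T x K g) (hy : y ∉ K) (hyT : y ∉ T) :
    IsPathConnected (comp K y \ T) := by
  have h1 : IsOpen (comp K y \ T) := (isOpen_comp h.compact.isClosed y).sdiff h.finite.isClosed
  rw [← h1.isConnected_iff_isPathConnected]
  exact ⟨⟨y, mem_connectedComponentIn hy, hyT⟩, IsPreconnected.diff_finite
    (isOpen_comp h.compact.isClosed y) isPreconnected_connectedComponentIn h.finite⟩

/-- Two rays following the two halves of a piece. -/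
theorem Frame.exists_rays (H : Holonomy T) (h : Frame T x K g) (b : Piece T K) (hy : y ∈ b.face)
    (hyT : y ∉ T) : ∃ r r' : Ray T K y,
      (∀ τ ∈ T, r.off g τ - r'.off g τ = 2 * Real.pi * Complex.I * b.deg g τ) ∧
      H.val h.toTree b = r.val H h.toTree * (r'.val H h.toTree)⁻¹ := by
  have hyK : y ∉ K := connectedComponentIn_subset _ _ hy
  have hf : b.face = comp K y := connectedComponentIn_eq hy
  obtain ⟨d, hd⟩ := (h.isPathConnected_face hyK hyT).joinedIn (b.a half)
    ⟨hf ▸ b.mem_face half_ne_zero half_ne_one, b.avoids _⟩ y ⟨mem_connectedComponentIn hyK, hyT⟩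
  have hdT : Avoids T d := fun t => (hd t).2
  have e0 : b.p = b.a 0 := b.a.source.symm
  have e1 : b.q = b.a 1 := b.a.target.symm
  let a₀ : Path b.p (b.a half) := (b.a.subpath 0 half).cast e0 rfl
  let a₁ : Path b.q (b.a half) := (b.a.subpath 1 half).cast e1 rfl
  have ha₀ : Avoids T a₀ := fun t => b.avoids _
  have ha₁ : Avoids T a₁ := fun t => b.avoids _
  have hh : (half : ℝ) = 1 / 2 := rfl
  have hm₀ : ∀ t, t ≠ 0 → a₀ t ∈ comp K y := fun t ht => by
    rw [← hf]
    have h0 : (0 : ℝ) < t := unitInterval.pos_iff_ne_zero.2 ht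
    have h1 := t.2.2
    refine b.mem_face (fun e => ?_) fun e => ?_
    all_goals
      have := congrArg Subtype.val e
      rw [Set.Icc.coe_convexComb, hh] at this
      simp at this
      first | exact ht this | nlinarith
  have hm₁ : ∀ t, t ≠ 0 → a₁ t ∈ comp K y := fun t ht => by
    rw [← hf]
    have h0 : (0 : ℝ) < t := unitInterval.pos_iff_ne_zero.2 ht
    have h1 := t.2.2
    refine b.mem_face (fun e => ?_) fun e => ?_
    all_goals
      have := congrArg Subtype.val e
      rw [Set.Icc.coe_convexComb, hh] at this
      simp at this
      nlinarith
  let r : Ray T K y := ⟨b.p, a₀.trans d, b.source, avoids_trans ha₀ hdT,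
    trans_final hm₀ fun t => (hd t).1⟩
  let r' : Ray T K y := ⟨b.q, a₁.trans d, b.target, avoids_trans ha₁ hdT,
    trans_final hm₁ fun t => (hd t).1⟩
  refine ⟨r, r', fun τ hτ => ?_, ?_⟩
  · have hne : ∀ {p q : ℂ} {a : Path p q}, Avoids T a → ∀ t, a t ≠ τ := fun ha t e => ha t (e ▸ hτ)
    obtain ⟨L, hL⟩ := exists_logAlong b.a τ (hne b.avoids)
    have w₀ : wnd τ a₀ = L half - L 0 := by
      have h1 := wnd_eq (show LogAlong _ a₀ _ from hL.subpath 0 half)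
      simpa using h1
    have w₁ : wnd τ a₁ = L half - L 1 := by
      have h1 := wnd_eq (show LogAlong _ a₁ _ from hL.subpath 1 half)
      simpa using h1
    have w := h.wnd_piece b hτ
    rw [wnd_eq hL] at w
    have v₀ : wnd τ r.a = wnd τ a₀ + wnd τ d := wnd_trans _ _ (hne ha₀) (hne hdT)
    have v₁ : wnd τ r'.a = wnd τ a₁ + wnd τ d := wnd_trans _ _ (hne ha₁) (hne hdT)
    unfold Ray.off
    rw [v₀, v₁, w₀, w₁]
    change _ + g τ b.p - (_ + g τ b.q) = _
    linear_combination w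
  · have v₀ : H.cls r.a = H.cls a₀ * H.cls d := H.trans _ _ ha₀ hdT
    have v₁ : H.cls r'.a = H.cls a₁ * H.cls d := H.trans _ _ ha₁ hdT
    have c₀ : H.cls a₀ = H.cls (b.a.subpath 0 half) := H.congr e0 rfl fun _ => rfl
    have c₁ : H.cls a₁ = H.cls (b.a.subpath 1 half) := H.congr e1 rfl fun _ => rfl
    have c : H.cls b.a = H.cls (b.a.subpath 0 1) := H.congr e0 e1 fun t => by
      show b.a t = b.a (Set.Icc.convexComb 0 1 t)
      congr 1
      exact Subtype.ext (by rw [Set.Icc.coe_convexComb]; simp)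
    have hs := H.subpath b.a 0 1 half b.avoids
    unfold Holonomy.val Tree.loop Ray.val
    rw [H.trans _ _ (avoids_trans (h.path_avoids _) b.avoids) (h.path_avoids _).symm,
      H.trans _ _ (h.path_avoids _) b.avoids, H.symm _ (h.path_avoids _), v₀, v₁, c₀, c₁, c, ← hs]
    group

theorem Frame.exists_adjust (h : Frame T x K g) (hy : y ∉ K) (hyT : y ∉ T) (r r₀ : Ray T K y) :
    ∃ (l : Path y y) (hl : ∀ t, l t ∈ comp K y \ T), ∀ τ ∈ T,
      |((r.append l hl).toPiece r₀).deg g τ| ≤ 1 := by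
  have hS := h.isPathConnected_face hy hyT
  have hyS : y ∈ comp K y \ T := ⟨mem_connectedComponentIn hy, hyT⟩
  have hfin : ∀ τ₀ ∈ T, (∃ l : Path y y, (∀ t, l t ∈ comp K y \ T) ∧
      wnd τ₀ l = 2 * Real.pi * Complex.I) → ∃ (l : Path y y) (hl : ∀ t, l t ∈ comp K y \ T),
      ((r.append l hl).toPiece r₀).deg g τ₀ = 0 := fun τ₀ hτ₀ hl => by
    obtain ⟨l, hl, hw⟩ := exists_loop_wnd_int (fun h => h.2 hτ₀) hl (-(r.toPiece r₀).deg g τ₀)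
    refine ⟨l, hl, ?_⟩
    have h1 := (r.append l hl).deg_toPiece h.toTree r₀ hτ₀
    have h2 := r.deg_toPiece h.toTree r₀ hτ₀
    rw [r.off_append hl hτ₀, hw] at h1
    refine two_pi_I_mul_inj ?_
    rw [h1]
    push_cast
    linear_combination -h2
  by_cases hb : Bornology.IsBounded (comp K y)
  · by_cases hp : ∃ τ ∈ T, τ ∈ comp K y
    · obtain ⟨τ₀, hτ₀, hτy⟩ := hp
      obtain ⟨R, hR, hRs⟩ := Metric.nhds_basis_closedBall.mem_iff.1
        ((isOpen_comp h.compact.isClosed y).mem_nhds hτy)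
      obtain ⟨l, hl, hd⟩ := hfin τ₀ hτ₀ (exists_loop_wnd hS hyS (fun h => h.2 hτ₀) (c := τ₀) hR
        (by simpa using hR) fun z hz => by
          have hzc : z ∈ comp K y := hRs (by rw [Metric.mem_closedBall, dist_eq_norm, hz])
          refine ⟨hzc, fun hzT => ?_⟩
          rw [h.eq_of_mem hzT hτ₀ hzc hτy, sub_self, norm_zero] at hz
          exact hR.ne hz)
      refine ⟨l, hl, fun τ hτ => ?_⟩
      by_cases e : τ = τ₀
      · rw [e, hd]
        simp
      · refine h.abs_deg_le_one _ hτ ?_ ?_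
        · rwa [Ray.face_toPiece]
        · rw [Ray.face_toPiece]
          exact fun hh => e (h.eq_of_mem hτ hτ₀ hh hτy)
    · refine ⟨Path.refl y, fun _ => hyS, fun τ hτ => h.abs_deg_le_one _ hτ ?_ ?_⟩
      · rwa [Ray.face_toPiece]
      · rw [Ray.face_toPiece]
        exact fun hh => hp ⟨τ, hτ, hh⟩
  · by_cases hp : T.Nonempty
    · obtain ⟨τ₀, hτ₀⟩ := hp
      obtain ⟨R, hR0, hR⟩ := (h.compact.isBounded.union h.finite.isBounded).exists_pos_norm_lt
      have hsub : {z : ℂ | R < ‖z‖} ⊆ comp K y := by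
        obtain ⟨u, hu, huR⟩ : ∃ u ∈ comp K y, R < ‖u‖ := by
          by_contra! hh
          exact hb (isBounded_iff_forall_norm_le.2 ⟨R, hh⟩)
        have h1 : {z : ℂ | R < ‖z‖} ⊆ comp K u :=
          (isPreconnected_norm_gt hR0.le).subset_connectedComponentIn huR
            fun z hz hzK => (hR z (.inl hzK)).not_gt hz
        have h2 : comp K y = comp K u := connectedComponentIn_eq hu
        rwa [h2]
      obtain ⟨l, hl, hd⟩ := hfin τ₀ hτ₀ (exists_loop_wnd hS hyS (fun h => h.2 hτ₀) (c := 0)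
        (R := R + 1) (by linarith) (by
          rw [sub_zero]
          linarith [hR τ₀ (.inr hτ₀)]) fun z hz => by
          rw [sub_zero] at hz
          exact ⟨hsub (show R < ‖z‖ by linarith), fun hzT => by linarith [hR z (.inr hzT)]⟩)
      refine ⟨l, hl, fun τ hτ => ?_⟩
      have h3 := h.abs_deg_sub_le_one ((r.append l hl).toPiece r₀) hτ hτ₀
        (by rw [Ray.face_toPiece]; exact h.not_mem_of_unbounded hb hτ)
        (by rw [Ray.face_toPiece]; exact h.not_mem_of_unbounded hb hτ₀)
      rwa [hd, sub_zero] at h3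
    · exact ⟨Path.refl y, fun _ => hyS, fun τ hτ => absurd ⟨τ, hτ⟩ hp⟩

/-- In each face, finitely many invariants together with the degrees determine the holonomy of
a piece. -/
theorem Frame.exists_vec (H : Holonomy T) (h : Frame T x K g) (Φ : Set ℂ) :
    ∃ V : Piece T K → ℂ → ℤ, (∀ b, b.face = Φ → ∀ τ ∈ T, |V b τ| ≤ 1) ∧
      ∀ b b', b.face = Φ → b'.face = Φ → (∀ τ ∈ T, b.deg g τ = b'.deg g τ) →
        (∀ τ ∈ T, V b τ = V b' τ) → H.val h.toTree b = H.val h.toTree b' := by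
  by_cases hb : ∃ b₀ : Piece T K, b₀.face = Φ
  swap
  · exact ⟨fun _ _ => 0, fun b hb' => absurd ⟨b, hb'⟩ hb, fun b _ hb' => absurd ⟨b, hb'⟩ hb⟩
  obtain ⟨b₀, rfl⟩ := hb
  set y := b₀.a half with hy
  have hyK : y ∉ K := b₀.interior _ half_ne_zero half_ne_one
  have hyf : y ∈ b₀.face := b₀.mem_face half_ne_zero half_ne_one
  have hyT : y ∉ T := b₀.avoids _
  obtain ⟨r₀, -⟩ := h.exists_rays H b₀ hyf hyT
  have key : ∀ b : Piece T K, ∃ v : ℂ → ℤ, b.face = b₀.face → (∀ τ ∈ T, |v τ| ≤ 1) ∧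
      ∃ r r' : Ray T K y, (∀ τ ∈ T, r.off g τ = r₀.off g τ + 2 * Real.pi * Complex.I * v τ) ∧
      (∀ τ ∈ T, r.off g τ - r'.off g τ = 2 * Real.pi * Complex.I * b.deg g τ) ∧
      H.val h.toTree b = r.val H h.toTree * (r'.val H h.toTree)⁻¹ := fun b => by
    by_cases hf : b.face = b₀.face
    swap
    · exact ⟨0, fun h => absurd h hf⟩
    obtain ⟨r, r', hd, hv⟩ := h.exists_rays H b (hf ▸ hyf) hyT
    obtain ⟨l, hl, hle⟩ := h.exists_adjust hyK hyT r r₀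
    refine ⟨fun τ => ((r.append l hl).toPiece r₀).deg g τ, fun _ => ⟨hle, r.append l hl,
      r'.append l hl, fun τ hτ => ?_, fun τ hτ => ?_, ?_⟩⟩
    · rw [(r.append l hl).deg_toPiece h.toTree r₀ hτ]
      ring
    · rw [Ray.off_append _ _ hτ, Ray.off_append _ _ hτ, ← hd τ hτ]
      ring
    · rw [hv, Ray.val_append, Ray.val_append]
      group
  choose V hV using key
  refine ⟨V, fun b hb => (hV b hb).1, fun b b' hb hb' hd hv => ?_⟩
  obtain ⟨r, r', h1, h2, h3⟩ := (hV b hb).2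
  obtain ⟨s, s', k1, k2, k3⟩ := (hV b' hb').2
  rw [h3, k3, Ray.val_eq H h (r := r) (r' := s) fun τ hτ => by rw [h1 τ hτ, k1 τ hτ, hv τ hτ],
    Ray.val_eq H h (r := r') (r' := s') fun τ hτ => by
      have e1 := h2 τ hτ
      have e2 := k2 τ hτ
      rw [h1 τ hτ, hd τ hτ, hv τ hτ] at e1
      rw [k1 τ hτ] at e2
      linear_combination e2 - e1]

end

section

variable {T : Set ℂ} {x : ℂ} {K : Set ℂ} {g : ℂ → ℂ → ℂ}

theorem Piece.mem_union_face (b : Piece T K) (t : I) : b.a t ∈ K ∪ b.face := by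
  by_cases h0 : t = 0
  · rw [h0, b.a.source]
    exact .inl b.source
  by_cases h1 : t = 1
  · rw [h1, b.a.target]
    exact .inl b.target
  exact .inr (b.mem_face h0 h1)

theorem comp_eq_of_unbounded (hK : IsCompact K) {y z : ℂ} (hy : ¬Bornology.IsBounded (comp K y))
    (hz : ¬Bornology.IsBounded (comp K z)) : comp K y = comp K z := by
  obtain ⟨R, hR0, hR⟩ := hK.isBounded.exists_pos_norm_lt
  have key : ∀ y, ¬Bornology.IsBounded (comp K y) → ((R + 1 : ℝ) : ℂ) ∈ comp K y := fun y hb => by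
    obtain ⟨u, hu, huR⟩ : ∃ u ∈ comp K y, R < ‖u‖ := by
      by_contra! hh
      exact hb (isBounded_iff_forall_norm_le.2 ⟨R, hh⟩)
    have h1 : {z : ℂ | R < ‖z‖} ⊆ comp K u :=
      (isPreconnected_norm_gt hR0.le).subset_connectedComponentIn huR
        fun z hz hzK => (hR z hzK).not_gt hz
    have h2 : comp K y = comp K u := connectedComponentIn_eq hu
    rw [h2]
    refine h1 (show R < ‖((R + 1 : ℝ) : ℂ)‖ from ?_)
    rw [Complex.norm_real, Real.norm_of_nonneg (by linarith)]
    linarith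
  exact (connectedComponentIn_eq (key y hy)).trans (connectedComponentIn_eq (key z hz)).symm

/-- The distance to `τ` is extremal on `K ∪ Φ` at a point of `K`, where `Φ` is a face of `K`. -/
theorem exists_extremal (hK : IsCompact K) (hx : x ∈ K) {y τ : ℂ}
    (hτ : (τ ∈ comp K y ∧ Bornology.IsBounded (comp K y)) ∨ τ ∉ comp K y) :
    ∃ z₀ ∈ K, (∀ z ∈ K ∪ comp K y, ‖z - τ‖ ≤ ‖z₀ - τ‖) ∨
      ∀ z ∈ K ∪ comp K y, ‖z₀ - τ‖ ≤ ‖z - τ‖ := by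
  have hc : ContinuousOn (fun z : ℂ => ‖z - τ‖) K := by fun_prop
  rcases hτ with ⟨hτ, hb⟩ | hτ
  · obtain ⟨z₀, hz₀, hmax⟩ := hK.exists_isMaxOn ⟨x, hx⟩ hc
    refine ⟨z₀, hz₀, .inl ?_⟩
    rintro z (hz | hz)
    · exact hmax hz
    by_contra! hlt
    have h1 : (fun w : ℂ => w + τ) '' {w | ‖z₀ - τ‖ < ‖w‖} ⊆ comp K z :=
      ((isPreconnected_norm_gt (norm_nonneg _)).image _
        (by fun_prop)).subset_connectedComponentIn ⟨z - τ, hlt, by simp⟩ (by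
          rintro - ⟨w, hw, rfl⟩ hwK
          have h2 : ‖w + τ - τ‖ ≤ ‖z₀ - τ‖ := hmax hwK
          rw [add_sub_cancel_right] at h2
          exact h2.not_gt hw)
    have h2 : comp K y = comp K z := connectedComponentIn_eq hz
    obtain ⟨R, hR0, hR⟩ := (h2 ▸ hb).exists_pos_norm_lt
    have h3 : ‖((‖z₀ - τ‖ + ‖τ‖ + R : ℝ) : ℂ)‖ = ‖z₀ - τ‖ + ‖τ‖ + R := by
      rw [Complex.norm_real, Real.norm_of_nonneg (by positivity)]
    have h4 := hR _ (h1 ⟨((‖z₀ - τ‖ + ‖τ‖ + R : ℝ) : ℂ), by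
      rw [mem_ofPred, h3]
      linarith [norm_nonneg τ], rfl⟩)
    have h5 := norm_sub_le_norm_add ((‖z₀ - τ‖ + ‖τ‖ + R : ℝ) : ℂ) τ
    linarith [norm_nonneg (z₀ - τ)]
  · obtain ⟨z₀, hz₀, hmin⟩ := hK.exists_isMinOn ⟨x, hx⟩ hc
    refine ⟨z₀, hz₀, .inr ?_⟩
    rintro z (hz | hz)
    · exact hmin hz
    by_contra! hlt
    have h1 : Metric.ball τ ‖z₀ - τ‖ ⊆ comp K z :=
      (convex_ball τ ‖z₀ - τ‖).isPreconnected.subset_connectedComponentIn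
        (by rwa [Metric.mem_ball, dist_eq_norm]) fun w hw hwK => by
          rw [Metric.mem_ball, dist_eq_norm] at hw
          exact hw.not_ge (hmin hwK)
    have h2 : comp K y = comp K z := connectedComponentIn_eq hz
    exact hτ (h2 ▸ h1 (Metric.mem_ball_self ((norm_nonneg _).trans_lt hlt)))

/-- Two pieces of large degree in the same face cross each other many times. -/
theorem Frame.le_encard_interiorCross (h : Frame T x K g) (b b' : Piece T K)
    (hf : b.face = b'.face) {τ : ℂ} (hτ : τ ∈ T) {W : ℕ} (hW : W < |b.deg g τ|)
    (hW' : W < |b'.deg g τ|) : (W : ℕ∞) ≤ (interiorCross b.a b'.a).encard := by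
  obtain ⟨L, hL, h0, h1⟩ := h.exists_log_piece b hτ
  obtain ⟨M, hM, h0', h1'⟩ := h.exists_log_piece b' hτ
  have hb : (τ ∈ b.face ∧ Bornology.IsBounded b.face) ∨ τ ∉ b.face := by
    by_cases hmem : τ ∈ b.face
    · refine .inl ⟨hmem, ?_⟩
      have : b.face = comp K τ := connectedComponentIn_eq hmem
      rw [this]
      exact h.bounded τ hτ
    · exact .inr hmem
  obtain ⟨z₀, hz₀, hz⟩ := exists_extremal h.compact h.mem hb
  have hsub : ∀ z ∈ K ∪ range b.a ∪ range b'.a, z ∈ K ∪ b.face := by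
    rintro z ((hz | ⟨t, rfl⟩) | ⟨t, rfl⟩)
    exacts [.inl hz, b.mem_union_face t, hf ▸ b'.mem_union_face t]
  exact LoopCrossing.le_encard_interiorCross (h.joinedBy fun p E hE => hE τ hτ) (h.exp_eq τ hτ)
    b.source b.target b'.source b'.target b.interior b'.interior
    (fun z _ w _ e => sub_left_injective e) hL hM h0 h1 h0' h1' hz₀
    (hz.imp (fun hz z hzm => hz z (hsub z hzm)) fun hz z hzm => hz z (hsub z hzm)) hW hW'

theorem exists_finset_of_factors {B Λ G : Type*} [Finite Λ] [Nonempty G] (f : B → G) (F : B → Λ)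
    (h : ∀ b b', F b = F b' → f b = f b') :
    ∃ Q : Finset G, Q.card ≤ Nat.card Λ ∧ ∀ b, f b ∈ Q := by
  classical
  have := Fintype.ofFinite Λ
  obtain ⟨d⟩ := ‹Nonempty G›
  refine ⟨Finset.univ.image (Function.extend F f fun _ => d), ?_, fun b => ?_⟩
  · rw [Nat.card_eq_fintype_card]
    exact Finset.card_image_le
  · exact Finset.mem_image.2 ⟨F b, Finset.mem_univ _,
      Function.FactorsThrough.extend_apply (fun b b' e => h b b' e) _ b⟩

/-- A bound for the number of holonomies of pieces of degrees at most `W`. -/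
noncomputable def valueBound (T : Set ℂ) (W : ℕ) : ℕ :=
  Nat.card ((Set T × Prop) × (T → Icc (-W : ℤ) W) × (T → Icc (-1 : ℤ) 1))

theorem Frame.exists_values (H : Holonomy T) (h : Frame T x K g) (W : ℕ) :
    ∃ Q : Finset H.G, Q.card ≤ valueBound T W ∧
      ∀ b : Piece T K, (∀ τ ∈ T, |b.deg g τ| ≤ W) → H.val h.toTree b ∈ Q := by
  have := h.finite.to_subtype
  choose V hV hV' using h.exists_vec H
  obtain ⟨Q, hQ, hQ'⟩ := exists_finset_of_factors
    (fun b : {b : Piece T K // ∀ τ ∈ T, |b.deg g τ| ≤ W} => H.val h.toTree b.1)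
    (fun b => (({τ : T | (τ : ℂ) ∈ b.1.face}, Bornology.IsBounded b.1.face),
      (fun τ : T => (⟨b.1.deg g τ, abs_le.1 (b.2 τ τ.2)⟩ : Icc (-W : ℤ) W)),
      fun τ : T => (⟨V b.1.face b.1 τ, abs_le.1 (hV _ _ rfl τ τ.2)⟩ : Icc (-1 : ℤ) 1))) <| by
    rintro ⟨b, hb⟩ ⟨b', hb'⟩ e
    simp only [Prod.mk.injEq, funext_iff, Subtype.forall] at e
    obtain ⟨⟨e1, e2⟩, e3, e4⟩ := e
    replace e3 : ∀ τ ∈ T, b.deg g τ = b'.deg g τ := fun τ hτ => congrArg Subtype.val (e3 τ hτ)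
    replace e4 : ∀ τ ∈ T, V b.face b τ = V b'.face b' τ := fun τ hτ =>
      congrArg Subtype.val (e4 τ hτ)
    have e1' : ∀ τ ∈ T, (τ ∈ b.face ↔ τ ∈ b'.face) := fun τ hτ =>
      Set.ext_iff.1 e1 ⟨τ, hτ⟩
    by_cases hf : b.face = b'.face
    · exact hV' b'.face b b' hf rfl e3 (hf ▸ e4)
    by_cases hbd : Bornology.IsBounded b.face
    swap
    · exact absurd (comp_eq_of_unbounded h.compact hbd (e2 ▸ hbd)) hf
    by_cases hp : ∃ τ ∈ T, τ ∈ b.face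
    · obtain ⟨τ, hτ, hm⟩ := hp
      have k1 : b.face = comp K τ := connectedComponentIn_eq hm
      have k2 : b'.face = comp K τ := connectedComponentIn_eq ((e1' τ hτ).1 hm)
      exact absurd (k1.trans k2.symm) hf
    · refine h.val_eq_of_disjoint H hbd (e2 ▸ hbd) (fun τ hτ hm => hp ⟨τ, hτ, hm⟩)
        (fun τ hτ hm => hp ⟨τ, hτ, (e1' τ hτ).2 hm⟩) (disjoint_comp fun hm => hf ?_) e3
      exact (connectedComponentIn_eq hm).symm
  exact ⟨Q, hQ, fun b hb => hQ' ⟨b, hb⟩⟩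

end

section

variable {T : Set ℂ} {x : ℂ} {K : Set ℂ} {g : ℂ → ℂ → ℂ} {γ γ' : Path x x}

/-- The part of `γ` between two consecutive visits to `K`. -/
noncomputable def Piece.ofSubpath (hγ : Avoids T γ) {t s : I} (hts : t < s) (ht : γ t ∈ K)
    (hs : γ s ∈ K) (hK : ∀ u, t < u → u < s → γ u ∉ K) : Piece T K where
  p := γ t
  q := γ s
  a := γ.subpath t s
  source := ht
  target := hs
  avoids := fun _ => hγ _
  interior := fun u h0 h1 => hK _ (convexComb_mem_Ioo hts u h0 h1).1
    (convexComb_mem_Ioo hts u h0 h1).2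

theorem interiorCross_ofSubpath_le {hγ : Avoids T γ} {t s : I} {hts : t < s} {ht : γ t ∈ K}
    {hs : γ s ∈ K} {hK : ∀ u, t < u → u < s → γ u ∉ K} {hγ' : Avoids T γ'} {t' s' : I}
    {hts' : t' < s'} {ht' : γ' t' ∈ K} {hs' : γ' s' ∈ K} {hK' : ∀ u, t' < u → u < s' → γ' u ∉ K} :
    (interiorCross (Piece.ofSubpath hγ hts ht hs hK).a
      (Piece.ofSubpath hγ' hts' ht' hs' hK').a).encard ≤ (interiorCross γ γ').encard := by
  have hm : ∀ {t s u : I}, t < s → u ≠ 0 → u ≠ 1 →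
      Set.Icc.convexComb t s u ≠ 0 ∧ Set.Icc.convexComb t s u ≠ 1 := fun hts h0 h1 => by
    obtain ⟨h2, h3⟩ := convexComb_mem_Ioo hts _ h0 h1
    exact ⟨fun e => not_lt_bot (e ▸ h2 : _ < (0 : I)), fun e => not_top_lt (e ▸ h3 : (1 : I) < _)⟩
  refine encard_le_encard_of_injOn
    (f := fun u : I × I => (Set.Icc.convexComb t s u.1, Set.Icc.convexComb t' s' u.2)) ?_ ?_
  · rintro ⟨u, v⟩ ⟨h0, h1, h2, h3, h4⟩
    exact ⟨(hm hts h0 h1).1, (hm hts h0 h1).2, (hm hts' h2 h3).1, (hm hts' h2 h3).2, h4⟩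
  · rintro ⟨u, v⟩ - ⟨u', v'⟩ - e
    simp only [Prod.mk.injEq] at e
    exact Prod.ext (convexComb_injective hts e.1) (convexComb_injective hts' e.2)

/-- A loop is `W`-tame if its pieces relative to `K` have degrees at most `W`. -/
def Tame (T K : Set ℂ) (g : ℂ → ℂ → ℂ) (W : ℕ) (γ : Path x x) : Prop :=
  ∀ (hγ : Avoids T γ) (t s : I) (hts : t < s) (ht : γ t ∈ K) (hs : γ s ∈ K)
    (hK : ∀ u, t < u → u < s → γ u ∉ K), ∀ τ ∈ T, |(Piece.ofSubpath hγ hts ht hs hK).deg g τ| ≤ W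

/-- A loop which is not tame has a label in a finite set, such that loops with the same label cross
often. -/
theorem Frame.exists_label (h : Frame T x K g) {W : ℕ} (hW : 1 ≤ W) {ι : Type*}
    (γ : ι → Path x x) (hγ : ∀ i, Avoids T (γ i)) (hb : ∀ i, ¬Tame T K g W (γ i)) :
    ∃ F : ι → T × Prop, ∀ i j, F i = F j → (W : ℕ∞) ≤ (interiorCross (γ i) (γ j)).encard := by
  have key : ∀ i, ∃ (τ : T) (t s : I) (hts : t < s) (ht : γ i t ∈ K) (hs : γ i s ∈ K)
      (hK : ∀ u, t < u → u < s → γ i u ∉ K),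
      W < |(Piece.ofSubpath (hγ i) hts ht hs hK).deg g τ| := fun i => by
    have := hb i
    unfold Tame at this
    push Not at this
    obtain ⟨hγ', t, s, hts, ht, hs, hK, τ, hτ, hd⟩ := this
    exact ⟨⟨τ, hτ⟩, t, s, hts, ht, hs, hK, hd⟩
  choose τ t s hts ht hs hK hd using key
  set b : ι → Piece T K := fun i => Piece.ofSubpath (hγ i) (hts i) (ht i) (hs i) (hK i) with hbdef
  refine ⟨fun i => (τ i, Bornology.IsBounded (b i).face), fun i j e => ?_⟩
  obtain ⟨e1, e2⟩ := Prod.mk.inj e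
  have hmem : ∀ i, Bornology.IsBounded (b i).face → (b i).face = comp K (τ i) := fun i hbd => by
    by_cases hm : (τ i : ℂ) ∈ (b i).face
    · exact connectedComponentIn_eq hm
    · have h1 := h.abs_deg_le_one (b i) (τ i).2 hbd hm
      have h2 := hd i
      have h3 : (1 : ℤ) ≤ W := by exact_mod_cast hW
      exact absurd (h2.trans_le h1) h3.not_gt
  have hf : (b i).face = (b j).face := by
    by_cases hbd : Bornology.IsBounded (b i).face
    · rw [hmem i hbd, hmem j (e2 ▸ hbd), e1]
    · exact comp_eq_of_unbounded h.compact hbd (e2 ▸ hbd)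
  exact (h.le_encard_interiorCross (b i) (b j) hf (τ i).2 (hd i) (e1 ▸ hd j)).trans
    interiorCross_ofSubpath_le

theorem Holonomy.cls_subpath_self (H : Holonomy T) (hγ : Avoids T γ) (t : I) :
    H.cls (γ.subpath t t) = 1 := by
  simpa using H.subpath γ t t t hγ

theorem Holonomy.cls_subpath_univ (H : Holonomy T) :
    H.cls (γ.subpath 0 1) = H.cls γ :=
  H.congr γ.source γ.target fun t => by
    show γ (Set.Icc.convexComb 0 1 t) = γ t
    congr 1
    exact Subtype.ext (by rw [Set.Icc.coe_convexComb]; simp)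

theorem Holonomy.cls_path_congr (H : Holonomy T) (h : Tree T x K g) {p q : ℂ} {hp : p ∈ K}
    {hq : q ∈ K} (e : p = q) : H.cls (h.path hp) = H.cls (h.path hq) := by
  subst e
  rfl

open scoped Pointwise Classical in
theorem Frame.conj_mem_pow (H : Holonomy T) (h : Frame T x K g) (hγ : Avoids T γ) {Q : Finset H.G}
    (hQ : ∀ (t s : I) (hts : t < s) (ht : γ t ∈ K) (hs : γ s ∈ K)
      (hK : ∀ u, t < u → u < s → γ u ∉ K), H.val h.toTree (Piece.ofSubpath hγ hts ht hs hK) ∈ Q)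
    {F : Finset I} (hF : ∀ u, u ∈ F ↔ γ u ∈ K) {c : ℕ} (hc : F.card ≤ c + 1) :
    H.cls (h.path h.mem) * H.cls γ * (H.cls (h.path h.mem))⁻¹ ∈ (insert 1 Q) ^ c := by
  have h0 : γ 0 ∈ K := γ.source.symm ▸ h.mem
  have h1 : γ 1 ∈ K := γ.target.symm ▸ h.mem
  have key := interval_induction ((hF 0).2 h0) (P := fun n s => ∀ hs : γ s ∈ K,
    H.cls (h.path h0) * H.cls (γ.subpath 0 s) * (H.cls (h.path hs))⁻¹ ∈ (insert 1 Q) ^ n)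
    (fun hs => by
      rw [H.cls_subpath_self hγ]
      simp) (fun n t ht s hts hu ih hs => by
      have htK := (hF t).1 ht
      set b := Piece.ofSubpath hγ hts htK hs fun u h1 h2 h3 => hu u h1 h2 ((hF u).2 h3) with hbd
      have h2 : H.val h.toTree b ∈ Q := hQ t s hts htK hs _
      rw [pow_succ]
      convert Finset.mul_mem_mul (ih htK) (Finset.mem_insert_of_mem h2) using 1
      have h3 : H.val h.toTree b =
          H.cls (h.path htK) * H.cls (γ.subpath t s) * (H.cls (h.path hs))⁻¹ := by
        unfold Holonomy.val Tree.loop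
        rw [H.trans _ _ (avoids_trans (h.path_avoids _) b.avoids) (h.path_avoids _).symm,
          H.trans _ _ (h.path_avoids _) b.avoids, H.symm _ (h.path_avoids _)]
        rfl
      rw [h3, ← H.subpath γ 0 t s hγ]
      group) 1 h1
  have hcard : (F.filter (· < 1)).card ≤ c := by
    have : (F.filter (· < 1)).card < F.card :=
      Finset.card_lt_card (Finset.filter_ssubset.2 ⟨1, (hF 1).2 h1, lt_irrefl _⟩)
    omega
  have h2 := Finset.pow_subset_pow_right (Finset.mem_insert_self 1 Q) hcard key
  have e0 : H.cls (h.path h0) = H.cls (h.path h.mem) := H.cls_path_congr h.toTree (by simp)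
  have e1 : H.cls (h.path h1) = H.cls (h.path h.mem) := H.cls_path_congr h.toTree (by simp)
  rwa [H.cls_subpath_univ, e0, e1] at h2

/-- Among many tame loops with few visits to `K`, two are homotopic. -/
theorem Frame.exists_homT (h : Frame T x K g) {W c : ℕ} {ι : Type*} {s : Finset ι}
    (γ : ι → Path x x) (hγ : ∀ i, Avoids T (γ i)) (hb : ∀ i ∈ s, Tame T K g W (γ i))
    (hc : ∀ i ∈ s, {u | γ i u ∈ K}.encard ≤ c + 1)
    (hs : (valueBound T W + 1) ^ c < s.card) : ∃ i ∈ s, ∃ j ∈ s, i ≠ j ∧ HomT T (γ i) (γ j) := by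
  classical
  obtain ⟨H⟩ := exists_holonomy h.finite
  obtain ⟨Q, hQ, hQ'⟩ := h.exists_values H W
  have hmaps : ∀ i ∈ s, H.cls (h.path h.mem) * H.cls (γ i) * (H.cls (h.path h.mem))⁻¹ ∈
      open scoped Pointwise in (insert 1 Q) ^ c := fun i hi => by
    have hfin : {u | γ i u ∈ K}.Finite :=
      finite_of_encard_le_coe (k := c + 1) (by exact_mod_cast hc i hi)
    refine h.conj_mem_pow H (hγ i) (fun t s hts ht hs hK => hQ' _ (hb i hi _ t s hts ht hs hK))
      (F := hfin.toFinset) (fun u => by simp) ?_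
    have := hc i hi
    rw [hfin.encard_eq_coe_toFinset_card] at this
    exact_mod_cast this
  have hcard : (open scoped Pointwise in (insert 1 Q) ^ c : Finset H.G).card < s.card :=
    (Finset.card_pow_le.trans (Nat.pow_le_pow_left ((Finset.card_insert_le _ _).trans
      (Nat.add_le_add_right hQ 1)) c)).trans_lt hs
  obtain ⟨i, hi, j, hj, hij, e⟩ := Finset.exists_ne_map_eq_of_card_lt_of_maps_to hcard hmaps
  exact ⟨i, hi, j, hj, hij, (H.eq_iff _ _ (hγ i) (hγ j)).1
    (mul_left_cancel (mul_right_cancel e))⟩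

end

section

variable {T : Set ℂ} {x : ℂ} {K : Set ℂ} {g : ℂ → ℂ → ℂ}

theorem Tree.mono (h : Tree T x K g) {T' : Set ℂ} (hT : T' ⊆ T) : Tree T' x K g :=
  ⟨h.mem, fun τ hτ => h.exp_eq τ (hT hτ), fun p hp => by
    obtain ⟨E, hE, hE'⟩ := h.exists_path p hp
    exact ⟨E, hE, fun τ hτ => hE' τ (hT hτ)⟩⟩

/-- The union of the images of the loops in `S`. -/
def trace {ι : Type*} (γ : ι → Path x x) (S : Finset ι) : Set ℂ := insert x (⋃ l ∈ S, range (γ l))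

theorem isCompact_trace {ι : Type*} (γ : ι → Path x x) (S : Finset ι) : IsCompact (trace γ S) :=
  (S.isCompact_biUnion fun l _ => isCompact_range (γ l).continuous).insert x

theorem mem_trace {ι : Type*} {γ : ι → Path x x} {S : Finset ι} {l : ι} (hl : l ∈ S) (t : I) :
    γ l t ∈ trace γ S :=
  .inr (mem_iUnion₂.2 ⟨l, hl, t, rfl⟩)

theorem trace_mono {ι : Type*} {γ : ι → Path x x} {S S' : Finset ι} (h : S ⊆ S') :
    trace γ S ⊆ trace γ S' :=
  insert_subset_insert (biUnion_subset_biUnion_left h)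

theorem trace_avoids {ι : Type*} {γ : ι → Path x x} (hx : x ∉ T) (hγ : ∀ i, Avoids T (γ i))
    {S : Finset ι} : ∀ z ∈ trace γ S, z ∉ T := by
  rintro z (rfl | hz)
  · exact hx
  · obtain ⟨l, -, t, rfl⟩ := mem_iUnion₂.1 hz
    exact hγ l t

theorem exists_tree_trace {ι : Type*} [DecidableEq ι] {γ : ι → Path x x} (hx : x ∉ T)
    (hγ : ∀ i, Avoids T (γ i))
    (hfin : ∀ i, {s | ∃ j t, (i, s) ≠ (j, t) ∧ γ i s = γ j t}.Finite) (S : Finset ι) :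
    ∃ g, Tree T x (trace γ S) g := by
  induction S using Finset.induction_on with
  | empty => simpa [trace] using exists_tree_singleton hx
  | insert l S hl ih =>
    obtain ⟨g, hg⟩ := ih
    have hF : ∀ s, (∃ j t, (l, s) ≠ (j, t) ∧ γ l s = γ j t) → s ∈ (hfin l).toFinset :=
      fun s hs => (hfin l).mem_toFinset.2 hs
    have h0 : (0 : I) ∈ (hfin l).toFinset := hF 0 ⟨l, 1, by simp, by simp⟩
    obtain ⟨g', hg'⟩ := hg.extend_path (hγ l) h0 (fun s hs => by
      rcases hs with hs | hs
      · by_cases e : s = 0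
        · rwa [e]
        · exact hF s ⟨l, 0, by simpa using e, by simpa using hs⟩
      · obtain ⟨j, hj, t, ht⟩ := mem_iUnion₂.1 hs
        exact hF s ⟨j, t, fun e => hl ((Prod.mk.inj e).1 ▸ hj), ht.symm⟩)
      fun s s' hne e => hF s ⟨l, s', by simpa using hne, e⟩
    refine ⟨g', ?_⟩
    have : trace γ (insert l S) = trace γ S ∪ range (γ l) := by
      unfold trace
      rw [Finset.set_biUnion_insert, insert_union, union_comm]
    rwa [this]

/-- Representatives of the bounded faces meeting `T`. -/
theorem exists_reps (hKT : ∀ z ∈ K, z ∉ T) : ∃ T' ⊆ T,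
    (∀ t ∈ T', Bornology.IsBounded (comp K t)) ∧ (∀ t ∈ T', ∀ t' ∈ T', t' ∈ comp K t → t = t') ∧
    ∀ t ∈ T, ¬Bornology.IsBounded (comp K t) ∨ ∃ s ∈ T', s ∈ comp K t := by
  classical
  let rep (a : ℂ) : ℂ := Classical.epsilon fun b => b ∈ T ∧ comp K b = comp K a
  have hrep : ∀ a ∈ T, rep a ∈ T ∧ comp K (rep a) = comp K a := fun a ha =>
    Classical.epsilon_spec (p := fun b => b ∈ T ∧ comp K b = comp K a) ⟨a, ha, rfl⟩
  have hcongr : ∀ a b, comp K a = comp K b → rep a = rep b := fun a b e => by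
    simp only [rep, e]
  refine ⟨{a | a ∈ T ∧ Bornology.IsBounded (comp K a) ∧ rep a = a}, fun a h => h.1,
    fun a h => h.2.1, fun a ha b hb hab => ?_, fun a ha => ?_⟩
  · rw [← ha.2.2, ← hb.2.2]
    exact hcongr a b (connectedComponentIn_eq hab)
  · by_cases hb : Bornology.IsBounded (comp K a)
    · obtain ⟨h1, h2⟩ := hrep a ha
      exact .inr ⟨rep a, ⟨h1, h2.symm ▸ hb, hcongr _ _ h2⟩,
        h2 ▸ mem_connectedComponentIn fun h => hKT _ h h1⟩
    · exact .inl hb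

/-- A measure for how far `K` is from separating the points of `T` from each other and from
infinity. -/
noncomputable def faceCount (T K : Set ℂ) : ℕ :=
  {a | a ∈ T ∧ ¬Bornology.IsBounded (comp K a)}.ncard +
    {u : ℂ × ℂ | (u.1 ∈ T ∧ u.2 ∈ T) ∧ u.2 ∈ comp K u.1}.ncard

theorem comp_anti {K' : Set ℂ} (h : K ⊆ K') (t : ℂ) : comp K' t ⊆ comp K t :=
  connectedComponentIn_mono _ (compl_subset_compl.2 h)

theorem HomT.of_faceCount (hT : T.Finite) {K' T' : Set ℂ} (hK' : IsCompact K')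
    (hKT : ∀ z ∈ K', z ∉ T) (hKK' : K ⊆ K') (hT' : T' ⊆ T)
    (hcov : ∀ t ∈ T, ¬Bornology.IsBounded (comp K t) ∨ ∃ s ∈ T', s ∈ comp K t)
    (hle : faceCount T K ≤ faceCount T K') {p q : ℂ} {a b : Path p q} (ha : ∀ s, a s ∈ K')
    (hb : ∀ s, b s ∈ K') (hab : HomT T' a b) : HomT T a b := by
  have f1 : {a | a ∈ T ∧ ¬Bornology.IsBounded (comp K a)}.Finite := hT.subset fun _ h => h.1
  have f2 : {u : ℂ × ℂ | (u.1 ∈ T ∧ u.2 ∈ T) ∧ u.2 ∈ comp K u.1}.Finite :=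
    (hT.prod hT).subset fun _ h => h.1
  have s1 : {a | a ∈ T ∧ ¬Bornology.IsBounded (comp K' a)} ⊆
      {a | a ∈ T ∧ ¬Bornology.IsBounded (comp K a)} :=
    fun a h => ⟨h.1, fun hb => h.2 (hb.subset (comp_anti hKK' a))⟩
  have s2 : {u : ℂ × ℂ | (u.1 ∈ T ∧ u.2 ∈ T) ∧ u.2 ∈ comp K' u.1} ⊆
      {u : ℂ × ℂ | (u.1 ∈ T ∧ u.2 ∈ T) ∧ u.2 ∈ comp K u.1} :=
    fun a h => ⟨h.1, comp_anti hKK' _ h.2⟩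
  have l1 := ncard_le_ncard s1 f1
  have l2 := ncard_le_ncard s2 f2
  unfold faceCount at hle
  have e1 := eq_of_subset_of_ncard_le s1 (by omega) f1
  have e2 := eq_of_subset_of_ncard_le s2 (by omega) f2
  refine HomT.extend hK' hT hKT hT' (fun t ht => ?_) ha hb hab
  refine (hcov t ht).imp (fun h => ?_) fun ⟨s, hs, hst⟩ => ⟨s, hs, ?_⟩
  · exact (e1.symm.subset ⟨ht, h⟩ : t ∈ {a | a ∈ T ∧ ¬Bornology.IsBounded (comp K' a)}).2
  · have h : (t, s) ∈ {u : ℂ × ℂ | (u.1 ∈ T ∧ u.2 ∈ T) ∧ u.2 ∈ comp K u.1} := ⟨⟨ht, hT' hs⟩, hst⟩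
    exact (e2.symm.subset h).2

/-- The coincidences between the loops at interior parameters, as ordered pairs. -/
def crossings {X : Type*} [TopologicalSpace X] {x : X} {ι : Type*} (γ : ι → Path x x) :
    Set ((ι × I) × (ι × I)) :=
  {p | p.1 ≠ p.2 ∧ p.1.2 ≠ 0 ∧ p.1.2 ≠ 1 ∧ p.2.2 ≠ 0 ∧ p.2.2 ≠ 1 ∧ γ p.1.1 p.1.2 = γ p.2.1 p.2.2}

/-- The interior passages of a family of loops through the base point. -/
def passages {ι : Type*} (γ : ι → Path x x) : Set (ι × I) :=
  {p | p.2 ≠ 0 ∧ p.2 ≠ 1 ∧ γ p.1 p.2 = x}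

theorem offDiag_passages_subset {ι : Type*} (γ : ι → Path x x) :
    (passages γ).offDiag ⊆ crossings γ := by
  rintro ⟨p, q⟩ ⟨⟨h1, h2, h3⟩, ⟨h4, h5, h6⟩, h7⟩
  exact ⟨h7, h1, h2, h4, h5, h3.trans h6.symm⟩

theorem finite_passages {ι : Type*} {γ : ι → Path x x} (h : (crossings γ).Finite) :
    (passages γ).Finite := by
  by_cases hne : (passages γ).Nonempty
  · obtain ⟨p, hp⟩ := hne
    have h1 : ((fun q => (p, q)) '' (passages γ \ {p})).Finite :=
      h.subset (by
        rintro - ⟨q, ⟨hq, hqp⟩, rfl⟩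
        exact offDiag_passages_subset γ ⟨hp, hq, fun e => hqp e.symm⟩)
    have h2 := h1.of_finite_image (fun _ _ _ _ e => (Prod.mk.inj e).2)
    exact (h2.insert p).subset (by rw [insert_sdiff_singleton]; exact subset_insert _ _)
  · rw [not_nonempty_iff_eq_empty.1 hne]
    exact finite_empty

theorem finite_visits {ι : Type*} {γ : ι → Path x x} (h : (crossings γ).Finite) (i : ι) :
    {s | ∃ j t, (i, s) ≠ (j, t) ∧ γ i s = γ j t}.Finite := by
  refine (((finite_singleton (1 : I)).insert 0).union
    (((finite_passages h).image Prod.snd).union (h.image fun p => p.1.2))).subset ?_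
  rintro s ⟨j, t, hne, e⟩
  by_cases h0 : s = 0
  · exact .inl (.inl h0)
  by_cases h1 : s = 1
  · exact .inl (.inr h1)
  by_cases ht : t = 0 ∨ t = 1
  · refine .inr (.inl ⟨(i, s), ⟨h0, h1, ?_⟩, rfl⟩)
    rw [e]
    rcases ht with rfl | rfl <;> simp
  · push Not at ht
    exact .inr (.inr ⟨((i, s), (j, t)), ⟨hne, h0, h1, ht.1, ht.2, e⟩, rfl⟩)

end

section

variable {x : ℂ} {ι : Type*}

/-- The number of crossings between two loops of a family. -/
noncomputable def crossCount (γ : ι → Path x x) (i j : ι) : ℕ :=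
  {p | p ∈ crossings γ ∧ (p.1.1, p.2.1) = (i, j)}.ncard

/-- The number of interior passages of a loop through the base point. -/
noncomputable def passCount (γ : ι → Path x x) (i : ι) : ℕ := {p | p ∈ passages γ ∧ p.1 = i}.ncard

theorem sum_ncard_fiber {α κ : Type*} [Fintype κ] {A : Set α} (hA : A.Finite) (f : α → κ) :
    ∑ i, {a | a ∈ A ∧ f a = i}.ncard = A.ncard := by
  classical
  rw [ncard_eq_toFinset_card _ hA, Finset.card_eq_sum_card_fiberwise (f := f) (t := Finset.univ)
    fun _ _ => Finset.mem_coe.2 (Finset.mem_univ _)]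
  refine Finset.sum_congr rfl fun i _ => ?_
  rw [← ncard_coe_finset]
  congr 1
  ext a
  simp

variable {γ : ι → Path x x}

theorem sum_crossCount [Fintype ι] (h : (crossings γ).Finite) :
    ∑ i, ∑ j, crossCount γ i j = (crossings γ).ncard := by
  rw [← sum_ncard_fiber h fun p => (p.1.1, p.2.1), Fintype.sum_prod_type]
  rfl

theorem sum_passCount [Fintype ι] (h : (crossings γ).Finite) :
    ∑ i, passCount γ i = (passages γ).ncard :=
  sum_ncard_fiber (finite_passages h) Prod.fst

theorem ncard_passages_mul_le (h : (crossings γ).Finite) :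
    (passages γ).ncard * (passages γ).ncard ≤ (crossings γ).ncard + (passages γ).ncard := by
  classical
  have hP := finite_passages h
  have h1 : hP.toFinset.offDiag.card ≤ h.toFinset.card := Finset.card_le_card fun p hp => by
    rw [Finite.mem_toFinset]
    refine offDiag_passages_subset γ ?_
    simpa [Set.mem_offDiag] using hp
  rw [Finset.offDiag_card, ← ncard_eq_toFinset_card _ hP, ← ncard_eq_toFinset_card _ h] at h1
  omega

theorem crossCount_comm (i j : ι) : crossCount γ i j = crossCount γ j i := by
  have key : ∀ i j, Prod.swap '' {p | p ∈ crossings γ ∧ (p.1.1, p.2.1) = (i, j)} ⊆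
      {p | p ∈ crossings γ ∧ (p.1.1, p.2.1) = (j, i)} := by
    rintro i j - ⟨p, ⟨⟨h1, h2, h3, h4, h5, h6⟩, h7⟩, rfl⟩
    simp only [Prod.mk.injEq] at h7
    exact ⟨⟨h1.symm, h4, h5, h2, h3, h6.symm⟩, by simp [h7]⟩
  unfold crossCount
  rw [← ncard_image_of_injective _ Prod.swap_injective]
  congr 1
  refine subset_antisymm (key i j) fun p hp => ⟨p.swap, key j i ⟨p, hp, rfl⟩, by simp⟩

theorem encard_interiorCross_le (h : (crossings γ).Finite) {i j : ι} (hij : i ≠ j) :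
    (interiorCross (γ i) (γ j)).encard ≤ crossCount γ i j := by
  unfold crossCount
  rw [(h.subset fun p hp => hp.1 :
    Set.Finite {p | p ∈ crossings γ ∧ (p.1.1, p.2.1) = (i, j)}).cast_ncard_eq]
  refine encard_le_encard_of_injOn (f := fun u => ((i, u.1), (j, u.2))) ?_ ?_
  · rintro u ⟨h1, h2, h3, h4, h5⟩
    exact ⟨⟨fun e => hij (Prod.mk.inj e).1, h1, h2, h3, h4, h5⟩, rfl⟩
  · rintro u - v - e
    simp only [Prod.mk.injEq, true_and] at e
    exact Prod.ext e.1 e.2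

theorem encard_visits_le (h : (crossings γ).Finite) {S : Finset ι} {i : ι} (hi : i ∉ S) :
    {u | γ i u ∈ trace γ S}.encard ≤ (2 + passCount γ i + ∑ l ∈ S, crossCount γ i l : ℕ) := by
  classical
  have hc : ∀ l, Set.Finite {p | p ∈ crossings γ ∧ (p.1.1, p.2.1) = (i, l)} :=
    fun l => h.subset fun p hp => hp.1
  have hp : Set.Finite {p | p ∈ passages γ ∧ p.1 = i} :=
    (finite_passages h).subset fun p hp => hp.1
  let F : Finset I := ({0, 1} ∪ hp.toFinset.image Prod.snd) ∪
    S.biUnion fun l => (hc l).toFinset.image fun p => p.1.2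
  have hsub : {u | γ i u ∈ trace γ S} ⊆ F := by
    intro u hu
    simp only [F, Finset.coe_union, Finset.coe_biUnion, Finset.coe_image, Finite.coe_toFinset,
      Finset.coe_insert, Finset.coe_singleton]
    by_cases h0 : u = 0
    · exact .inl (.inl (.inl h0))
    by_cases h1 : u = 1
    · exact .inl (.inl (.inr h1))
    by_cases hux : γ i u = x
    · exact .inl (.inr ⟨(i, u), ⟨⟨h0, h1, hux⟩, rfl⟩, rfl⟩)
    rcases hu with hu | hu
    · exact absurd hu hux
    obtain ⟨l, hl, t, ht⟩ := mem_iUnion₂.1 hu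
    have ht0 : t ≠ 0 := by
      rintro rfl
      exact hux (by rw [← ht, (γ l).source])
    have ht1 : t ≠ 1 := by
      rintro rfl
      exact hux (by rw [← ht, (γ l).target])
    exact .inr (mem_iUnion₂.2 ⟨l, hl, ((i, u), (l, t)),
      ⟨⟨fun e => hi ((Prod.mk.inj e).1 ▸ hl), h0, h1, ht0, ht1, ht.symm⟩, rfl⟩, rfl⟩)
  refine (encard_le_encard hsub).trans ?_
  rw [encard_coe_eq_coe_finsetCard, Nat.cast_le]
  refine (Finset.card_union_le _ _).trans (Nat.add_le_add
    ((Finset.card_union_le _ _).trans (Nat.add_le_add Finset.card_le_two ?_))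
    (Finset.card_biUnion_le.trans (Finset.sum_le_sum fun l _ => ?_)))
  · exact Finset.card_image_le.trans_eq (ncard_eq_toFinset_card _ hp).symm
  · exact Finset.card_image_le.trans_eq (ncard_eq_toFinset_card _ (hc l)).symm

end

/-- A set of indices with many pairwise crossings within each of few classes is small. -/
theorem card_le_of_label {ι Λ : Type*} [Fintype ι] [Fintype Λ] [DecidableEq Λ]
    {N : ι → ι → ℕ} {κ lam m : ℕ} (hN : ∑ i, ∑ j, N i j ≤ κ * m ^ 2) (hΛ : Fintype.card Λ ≤ lam)
    (hm : 8 * lam ≤ m) (A : Finset ι) (F : ι → Λ)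
    (hF : ∀ i ∈ A, ∀ j ∈ A, i ≠ j → F i = F j → 2 * (8 * lam) ^ 2 * κ + 1 ≤ N i j) :
    8 * A.card ≤ m := by
  by_contra! hlt
  obtain ⟨y, hy⟩ : ∃ y, m < 8 * lam * (A.filter (F · = y)).card := by
    by_contra! hle
    have h1 : A.card = ∑ y, (A.filter (F · = y)).card :=
      Finset.card_eq_sum_card_fiberwise fun _ _ => Finset.mem_coe.2 (Finset.mem_univ _)
    have h2 : ∑ y : Λ, 8 * lam * (A.filter (F · = y)).card ≤ Fintype.card Λ * m := by
      simpa using Finset.sum_le_card_nsmul Finset.univ _ m fun y _ => hle y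
    rw [← Finset.mul_sum, ← h1] at h2
    have h3 : Fintype.card Λ * m ≤ lam * m := Nat.mul_le_mul_right m hΛ
    have hl : 0 < lam := by
      by_contra h0
      have : IsEmpty Λ := Fintype.card_eq_zero_iff.1 (by omega)
      have h4 : A.card = 0 := by rw [h1, Finset.univ_eq_empty, Finset.sum_empty]
      omega
    have h4 : lam * m < lam * (8 * A.card) := Nat.mul_lt_mul_of_pos_left hlt hl
    linarith
  set B := A.filter (F · = y) with hB
  set a := B.card with ha
  set q := 8 * lam with hq
  have h1 : B.offDiag.card * (2 * q ^ 2 * κ + 1) ≤ κ * m ^ 2 := by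
    refine le_trans ?_ hN
    rw [← Fintype.sum_prod_type']
    refine le_trans ?_ (Finset.sum_le_sum_of_subset (Finset.subset_univ B.offDiag))
    rw [← smul_eq_mul]
    refine Finset.card_nsmul_le_sum _ _ _ fun p hp => ?_
    obtain ⟨h1, h2, h3⟩ := Finset.mem_offDiag.1 hp
    obtain ⟨h1, h1'⟩ := Finset.mem_filter.1 h1
    obtain ⟨h2, h2'⟩ := Finset.mem_filter.1 h2
    exact hF _ h1 _ h2 h3 (h1'.trans h2'.symm)
  have ha2 : 2 ≤ a := by
    by_contra! h
    have : q * a ≤ q * 1 := Nat.mul_le_mul_left q (by omega)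
    omega
  have h2 : a * a ≤ 2 * B.offDiag.card := by
    rw [Finset.offDiag_card, ← ha]
    have : 2 * a ≤ a * a := Nat.mul_le_mul_right a ha2
    omega
  set d := B.offDiag.card
  have h3 : m ^ 2 ≤ q ^ 2 * (2 * d) := by
    calc m ^ 2 ≤ (q * a) ^ 2 := Nat.pow_le_pow_left hy.le 2
      _ = q ^ 2 * (a * a) := by ring
      _ ≤ _ := Nat.mul_le_mul_left _ h2
  have h4 : κ * m ^ 2 ≤ κ * (q ^ 2 * (2 * d)) := Nat.mul_le_mul_left _ h3
  nlinarith

/-- Most indices are good. -/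
theorem exists_good {ι : Type*} [Fintype ι] [DecidableEq ι] {N : ι → ι → ℕ} {P : ι → ℕ}
    (hsymm : ∀ i j, N i j = N j i) {κ s₀ : ℕ} (hN : ∑ i, ∑ j, N i j ≤ κ * Fintype.card ι ^ 2)
    (hP : (∑ i, P i) * ∑ i, P i ≤ κ * Fintype.card ι ^ 2 + ∑ i, P i) {S A : Finset ι}
    (hS : S.card ≤ s₀) (hm : 8 * (s₀ + 1) ≤ Fintype.card ι)
    (hSr : ∀ l ∈ S, ∑ j, N l j ≤ 16 * κ * Fintype.card ι) (hA : 8 * A.card ≤ Fintype.card ι) :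
    ∃ L : Finset ι, Fintype.card ι ≤ 2 * L.card ∧ ∀ i ∈ L, i ∉ S ∧ i ∉ A ∧
      ∑ j, N i j ≤ 16 * κ * Fintype.card ι ∧
      P i + ∑ l ∈ S, N i l ≤ 8 * (κ + 1 + 16 * κ * s₀) := by
  set m := Fintype.card ι with hm'
  set R := ∑ i, P i with hR
  have hm0 : 0 < m := by omega
  have hRm : R ≤ (κ + 1) * m := by
    by_contra! h
    have h1 : R * ((κ + 1) * m + 1) ≤ R * R := Nat.mul_le_mul_left _ h
    have h2 : (κ + 1) * m * ((κ + 1) * m) ≤ R * ((κ + 1) * m) := Nat.mul_le_mul_right _ h.le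
    have h3 : 0 < m ^ 2 := by positivity
    nlinarith
  let A₁ : Finset ι := Finset.univ.filter fun i => 16 * κ * m < ∑ j, N i j
  let A₂ : Finset ι := Finset.univ.filter fun i =>
    8 * (κ + 1 + 16 * κ * s₀) < P i + ∑ l ∈ S, N i l
  have h1 : 8 * A₁.card ≤ m := by
    have h2 : A₁.card * (16 * κ * m + 1) ≤ κ * m ^ 2 := by
      refine le_trans ?_ hN
      rw [← smul_eq_mul]
      refine (Finset.card_nsmul_le_sum A₁ (fun i => ∑ j, N i j) _ fun i hi =>
        (Finset.mem_filter.1 hi).2).trans (Finset.sum_le_sum_of_subset (Finset.subset_univ _))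
    by_contra! h3
    rcases Nat.eq_zero_or_pos κ with h0 | h0
    · subst h0
      have : A₁.card ≤ 0 := by linarith
      omega
    · have h4 : κ * m * m ≤ κ * m * (8 * A₁.card) := Nat.mul_le_mul_left _ h3.le
      have h5 : 0 < κ * m * m := by positivity
      nlinarith
  have h2 : 8 * A₂.card ≤ m := by
    have h3 : ∑ i, (P i + ∑ l ∈ S, N i l) ≤ (κ + 1 + 16 * κ * s₀) * m := by
      rw [Finset.sum_add_distrib, Finset.sum_comm]
      have h4 : ∑ l ∈ S, ∑ i, N i l ≤ S.card • (16 * κ * m) :=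
        Finset.sum_le_card_nsmul _ _ _ fun l hl => by
          simpa only [hsymm _ l] using hSr l hl
      rw [smul_eq_mul] at h4
      have h5 : S.card * (16 * κ * m) ≤ s₀ * (16 * κ * m) := Nat.mul_le_mul_right _ hS
      nlinarith
    have h4 : A₂.card * (8 * (κ + 1 + 16 * κ * s₀)) ≤ (κ + 1 + 16 * κ * s₀) * m := by
      refine le_trans ?_ h3
      rw [← smul_eq_mul]
      exact (Finset.card_nsmul_le_sum A₂ _ _ fun i hi => (Finset.mem_filter.1 hi).2.le).trans
        (Finset.sum_le_sum_of_subset (Finset.subset_univ _))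
    have h5 : (κ + 1 + 16 * κ * s₀) * (8 * A₂.card) ≤ (κ + 1 + 16 * κ * s₀) * m := by linarith
    exact Nat.le_of_mul_le_mul_left h5 (by omega)
  refine ⟨Finset.univ \ (A₁ ∪ A₂ ∪ S ∪ A), ?_, fun i hi => ?_⟩
  · have h3 := Finset.le_card_sdiff (A₁ ∪ A₂ ∪ S ∪ A) Finset.univ
    have h4 := Finset.card_union_le (A₁ ∪ A₂ ∪ S) A
    have h5 := Finset.card_union_le (A₁ ∪ A₂) S
    have h6 := Finset.card_union_le A₁ A₂
    rw [Finset.card_univ] at h3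
    omega
  · simp only [Finset.mem_sdiff, Finset.mem_union, not_or, A₁, A₂, Finset.mem_filter,
      Finset.mem_univ, true_and, not_lt] at hi
    exact ⟨hi.1.2, hi.2, hi.1.1.1, hi.1.1.2⟩

section

variable {T : Set ℂ} {x : ℂ}

theorem faceCount_le (hT : T.Finite) (K : Set ℂ) :
    faceCount T K ≤ T.ncard + (T ×ˢ T).ncard :=
  Nat.add_le_add (ncard_le_ncard (fun _ h => h.1) hT)
    (ncard_le_ncard (fun _ h => h.1) (hT.prod hT))

theorem no_family (hT : T.Finite) (hx : x ∉ T) (κ d : ℕ) : ∀ s₀ : ℕ, ∃ M : ℕ, ∀ m ≥ M,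
    ∀ γ : Fin m → Path x x, (∀ i, Avoids T (γ i)) → (∀ i j, i ≠ j → ¬HomT T (γ i) (γ j)) →
      (crossings γ).Finite → (crossings γ).ncard ≤ κ * m ^ 2 →
      ∀ S : Finset (Fin m), S.card ≤ s₀ → (∀ l ∈ S, ∑ j, crossCount γ l j ≤ 16 * κ * m) →
      ¬faceCount T (trace γ S) < d := by
  classical
  induction d with
  | zero => exact fun _ => ⟨0, fun _ _ _ _ _ _ _ _ _ _ => Nat.not_lt_zero _⟩
  | succ d ih =>
    intro s₀
    obtain ⟨M, hM⟩ := ih (s₀ + 2)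
    set lam := T.ncard * 2 + 1 with hlam
    set W := 2 * (8 * lam) ^ 2 * κ + 1 with hW
    obtain ⟨B, hB⟩ := (hT.finite_subsets.image fun T' => valueBound T' W).bddAbove
    set c := 8 * (κ + 1 + 16 * κ * s₀) + 1 with hc
    refine ⟨M + 8 * lam + 8 * (s₀ + 1) + 2 * ((B + 1) ^ c + 1), ?_⟩
    intro m hm γ hγ hne hfin hcard S hS hSr hd
    obtain ⟨g, hg⟩ := exists_tree_trace hx hγ (finite_visits hfin) S
    set K := trace γ S with hK
    obtain ⟨T', hT', hb, hinj, hcov⟩ := exists_reps (K := K) (trace_avoids hx hγ)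
    have hT'f := hT.subset hT'
    have h : Frame T' x K g := ⟨hg.mono hT', hT'f, isCompact_trace γ S, hb, hinj⟩
    have hγ' : ∀ i, Avoids T' (γ i) := fun i t ht => hγ i t (hT' ht)
    let A : Finset (Fin m) := Finset.univ.filter fun i => ¬Tame T' K g W (γ i)
    have hA : 8 * A.card ≤ m := by
      obtain ⟨F, hF⟩ := h.exists_label (W := W) (by omega) (fun i : A => γ i) (fun i => hγ' i)
        fun i => (Finset.mem_filter.1 i.2).2
      have := hT'f.to_subtype
      have : Fintype (Option (T' × Prop)) := Fintype.ofFinite _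
      refine card_le_of_label (Λ := Option (T' × Prop)) (N := crossCount γ) (lam := lam)
        (κ := κ) ((sum_crossCount hfin).trans_le hcard) ?_ (by omega) A
        (fun i => if hi : i ∈ A then some (F ⟨i, hi⟩) else none) fun i hi j hj hij e => ?_
      · rw [← Nat.card_eq_fintype_card, Finite.card_option, Nat.card_prod, Nat.card_coe_set_eq,
          Nat.card_eq_fintype_card, Fintype.card_prop]
        have := ncard_le_ncard hT' hT
        omega
      · simp only [hi, hj, dite_true, Option.some.injEq] at e
        have h1 := (hF ⟨i, hi⟩ ⟨j, hj⟩ e).trans (encard_interiorCross_le hfin hij)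
        exact_mod_cast h1
    obtain ⟨L, hL, hL'⟩ := exists_good (N := crossCount γ) (P := passCount γ) crossCount_comm
      (κ := κ) (s₀ := s₀) (S := S) (A := A)
      (by rw [sum_crossCount hfin, Fintype.card_fin]; exact hcard)
      (by
        rw [sum_passCount hfin, Fintype.card_fin]
        exact (ncard_passages_mul_le hfin).trans (Nat.add_le_add_right hcard _)) hS
      (by rw [Fintype.card_fin]; omega) (by rwa [Fintype.card_fin]) (by rwa [Fintype.card_fin])
    rw [Fintype.card_fin] at hL
    obtain ⟨i, hi, j, hj, hij, hhom⟩ := h.exists_homT (W := W) (c := c) (s := L) γ hγ'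
      (fun i hi => by simpa [A] using (hL' i hi).2.1)
      (fun i hi => (encard_visits_le hfin (hL' i hi).1).trans (by
        have := (hL' i hi).2.2.2
        norm_cast
        omega)) (by
        have h1 : valueBound T' W ≤ B := hB ⟨T', hT', rfl⟩
        have h2 : (valueBound T' W + 1) ^ c ≤ (B + 1) ^ c := Nat.pow_le_pow_left (by omega) c
        omega)
    set S' := insert i (insert j S) with hS'
    have hSS' : S ⊆ S' := (Finset.subset_insert _ _).trans (Finset.subset_insert _ _)
    have hiS : i ∈ S' := Finset.mem_insert_self _ _
    have hjS : j ∈ S' := Finset.mem_insert_of_mem (Finset.mem_insert_self _ _)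
    by_cases hle : faceCount T K ≤ faceCount T (trace γ S')
    · exact hne i j hij (HomT.of_faceCount hT (isCompact_trace γ S') (trace_avoids hx hγ)
        (trace_mono hSS') hT' hcov hle (mem_trace hiS) (mem_trace hjS) hhom)
    · refine hM m (by omega) γ hγ hne hfin hcard S' ?_ (fun l hl => ?_) (by omega)
      · have h1 : S'.card ≤ (insert j S).card + 1 := Finset.card_insert_le i _
        have h2 := Finset.card_insert_le j S
        omega
      · rcases Finset.mem_insert.1 hl with rfl | hl
        · simpa using (hL' _ hi).2.2.1
        rcases Finset.mem_insert.1 hl with rfl | hl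
        · simpa using (hL' _ hj).2.2.1
        exact hSr l hl

/-- The result for loops in the complement of a finite subset of the plane. -/
theorem crossings_superquadratic (hT : T.Finite) (hx : x ∉ T) (C : ℝ) : ∃ M : ℕ, ∀ m ≥ M,
    ∀ γ : Fin m → Path x x, (∀ i, Avoids T (γ i)) → (∀ i j, i ≠ j → ¬HomT T (γ i) (γ j)) →
      ENNReal.ofReal (C * (m : ℝ) ^ 2) ≤ ((crossings γ).encard : ℝ≥0∞) / 2 := by
  obtain ⟨M, hM⟩ := no_family hT hx ⌈2 * C⌉₊ (T.ncard + (T ×ˢ T).ncard + 1) 0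
  refine ⟨M, fun m hm γ hγ hne => ?_⟩
  by_contra! hlt
  have hfin : (crossings γ).Finite := by
    by_contra hinf
    rw [Set.Infinite.encard_eq hinf] at hlt
    simp [ENNReal.top_div] at hlt
  have hcard : (crossings γ).ncard ≤ ⌈2 * C⌉₊ * m ^ 2 := by
    rw [← hfin.cast_ncard_eq, ENat.toENNReal_coe, ← ENNReal.ofReal_natCast,
      ← ENNReal.ofReal_ofNat 2, ← ENNReal.ofReal_div_of_pos (by norm_num),
      ENNReal.ofReal_lt_ofReal_iff'] at hlt
    have h1 := Nat.le_ceil (2 * C)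
    have h2 : ((crossings γ).ncard : ℝ) ≤ ⌈2 * C⌉₊ * (m : ℝ) ^ 2 := by
      have h3 : (0 : ℝ) ≤ (m : ℝ) ^ 2 := by positivity
      nlinarith [hlt.1]
    exact_mod_cast h2
  exact hM m hm γ hγ hne hfin hcard ∅ (by simp) (by simp)
    (Nat.lt_succ_of_le (faceCount_le hT _))

end

/-- A finite nonempty set in the sphere has the same complement as a finite set in the plane. -/
theorem exists_planar_complement {T : Set (OnePoint ℂ)} (hT : T.Finite) (hne : T.Nonempty) :
    ∃ T' : Set ℂ, T'.Finite ∧ Nonempty ({z : ℂ // z ∉ T'} ≃ₜ {z : OnePoint ℂ // z ∉ T}) := by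
  obtain ⟨t, ht⟩ := hne
  have : Fact (Module.finrank ℝ (EuclideanSpace ℝ (Fin 3)) = 2 + 1) := ⟨by simp⟩
  let e : OnePoint ℂ ≃ₜ Metric.sphere (0 : EuclideanSpace ℝ (Fin 3)) 1 :=
    onePointEquivSphereOfFinrankEq (by simp)
  let c : ℂ ≃ₜ EuclideanSpace ℝ (Fin 2) := Complex.orthonormalBasisOneI.repr.toHomeomorph
  let s := (stereographic' 2 (e t)).symm
  have hs : s.source = univ := stereographic'_target (e t)
  let φ : ℂ → OnePoint ℂ := fun z => e.symm (s (c z))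
  have hφ : IsOpenEmbedding φ :=
    e.symm.isOpenEmbedding.comp ((s.isOpenEmbedding hs).comp c.isOpenEmbedding)
  have hr : ∀ z, z ≠ t → z ∈ range φ := fun z hz => by
    have hz' : e z ∈ (stereographic' 2 (e t)).source := by simpa using hz
    exact ⟨c.symm (stereographic' 2 (e t) (e z)), by
      simp [φ, s, (stereographic' 2 (e t)).left_inv hz']⟩
  refine ⟨φ ⁻¹' T, hT.preimage hφ.injective.injOn,
    ⟨(IsEmbedding.codRestrict (s := {z | z ∉ T}) (hφ.isEmbedding.comp .subtypeVal)
      fun z => z.2).toHomeomorphOfSurjective fun z => ?_⟩⟩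
  obtain ⟨w, hw⟩ := hr z.1 fun h => z.2 (h ▸ ht)
  exact ⟨⟨w, fun h => z.2 (hw ▸ h)⟩, Subtype.ext hw⟩

end LoopCrossing

/-- Fix a finite set `T ⊆ OnePoint ℂ` of `n > 1` points and a
basepoint `x ∉ T`. The minimal total number of crossings (half the cardinality, in
`ℕ∞`, of the set of ordered interior coincidences, including self-crossings) among
`m` pairwise non-homotopic `x`-loops in the complement of `T` is super-quadratic
in `m`. -/
theorem loop_crossings_superquadratic (n : ℕ) (hn : 1 < n)
    (T : Set (OnePoint ℂ)) (hTfin : T.Finite) (hT : T.ncard = n)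
    (x : OnePoint ℂ) (hx : x ∉ T) (C : ℝ) (hC : 0 < C) :
    ∃ M : ℕ, ∀ m : ℕ, M ≤ m →
      ∀ γ : Fin m → Path (X := {z : OnePoint ℂ // z ∉ T}) ⟨x, hx⟩ ⟨x, hx⟩,
        (∀ i j, i ≠ j → ¬ (γ i).Homotopic (γ j)) →
        ENNReal.ofReal (C * (m : ℝ) ^ 2) ≤
          (({p : (Fin m × I) × (Fin m × I) |
              p.1 ≠ p.2 ∧ p.1.2 ≠ 0 ∧ p.1.2 ≠ 1 ∧ p.2.2 ≠ 0 ∧ p.2.2 ≠ 1 ∧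
              γ p.1.1 p.1.2 = γ p.2.1 p.2.2}).encard : ℝ≥0∞) / 2 := by
  obtain ⟨T', hT', ⟨h⟩⟩ := LoopCrossing.exists_planar_complement hTfin
    (Set.nonempty_of_ncard_ne_zero (by omega))
  obtain ⟨M, hM⟩ := LoopCrossing.crossings_superquadratic hT' (h.symm ⟨x, hx⟩).2 C
  refine ⟨M, fun m hm γ hγ => ?_⟩
  let β := fun i => (γ i).map h.symm.continuous
  have key := hM m hm (fun i => (β i).map continuous_subtype_val) (fun i t => (β i t).2)
    fun i j hij hom => hγ i j hij ?_
  · convert key using 6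
    ext p
    simp [LoopCrossing.crossings, β, Subtype.val_inj]
  · rw [LoopCrossing.homT_iff _ _ (fun t => (β i t).2) fun t => (β j t).2] at hom
    obtain ⟨F⟩ := hom
    refine ⟨⟨⟨⟨fun z => h (F z), by fun_prop⟩, fun t => ?_, fun t => ?_⟩, fun s t ht => ?_⟩⟩
    · simpa [β, LoopCrossing.liftT] using congrArg h (F.apply_zero t)
    · simpa [β, LoopCrossing.liftT] using congrArg h (F.apply_one t)
    · exact (congrArg h (F.prop' s t ht)).trans (by simp [β, LoopCrossing.liftT])
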